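/- arXiv:2411.16377 — 2 statements merged into one kernel-verified Lean document; each statement's English description precedes it below -/
import Mathlib

section
/- Let n ≥ 2, p > 1, and let Ω ⊂ ℝⁿ be a strongly convex bounded open set with boundary of class C². Then for every δ > 0 there exist ε₀ > 0 and τ > 0 such that for every ε ∈ (0, ε₀) and every normalized minimizer u_ε of the ε-regularized problem, u_ε(x) ≥ τ for all x ∈ Ω_δ. -/
open MeasureTheory Real Set Metric Bornology
open scoped RealInnerProductSpace Pointwise NNReal Topology

noncomputable def gaussianMeasure (n : ℕ) : Measure (EuclideanSpace ℝ (Fin n)) :=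
  (volume : Measure (EuclideanSpace ℝ (Fin n))).withDensity
    (fun x => ENNReal.ofReal ((2 * π) ^ (-(n : ℝ) / 2) * Real.exp (-‖x‖ ^ 2 / 2)))

/-- `φ` is a smooth compactly supported test function on `Ω`. -/
def IsTestFun (n : ℕ) (Ω : Set (EuclideanSpace ℝ (Fin n)))
    (φ : EuclideanSpace ℝ (Fin n) → ℝ) : Prop :=
  ContDiff ℝ (⊤ : ℕ∞) φ ∧ HasCompactSupport φ ∧ tsupport φ ⊆ Ω

/-- The first eigenvalue of the Gaussian-weighted `p`-Laplacian on `Ω`. -/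
noncomputable def lambdaPGamma (n : ℕ) (p : ℝ) (Ω : Set (EuclideanSpace ℝ (Fin n))) : ℝ :=
  sInf { r : ℝ | ∃ v : EuclideanSpace ℝ (Fin n) → ℝ, IsTestFun n Ω v ∧ v ≠ 0 ∧
    r = (∫ x in Ω, ‖gradient v x‖ ^ p ∂(gaussianMeasure n)) /
        (∫ x in Ω, |v x| ^ p ∂(gaussianMeasure n)) }

/-- `Ω` has boundary of class `C²`. -/
def HasC2Boundary (n : ℕ) (Ω : Set (EuclideanSpace ℝ (Fin n))) : Prop :=
  ∀ x ∈ frontier Ω, ∃ (U : Set (EuclideanSpace ℝ (Fin n))) (f : EuclideanSpace ℝ (Fin n) → ℝ),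
    IsOpen U ∧ x ∈ U ∧ ContDiff ℝ 2 f ∧ (∀ y ∈ U, (y ∈ Ω ↔ f y < 0)) ∧
    (∀ y ∈ U, y ∈ frontier Ω → fderiv ℝ f y ≠ 0)

/-- The regularized functional `J_ε(v) = ∫_Ω (ε v² + ‖∇v‖²)^{p/2} dγ`. -/
noncomputable def Jeps (n : ℕ) (p ε : ℝ) (Ω : Set (EuclideanSpace ℝ (Fin n)))
    (v : EuclideanSpace ℝ (Fin n) → ℝ) : ℝ :=
  ∫ x in Ω, (ε * v x ^ 2 + ‖gradient v x‖ ^ 2) ^ (p / 2) ∂(gaussianMeasure n)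

/-- The infimum of the regularized functional over normalized test functions. -/
noncomputable def lambdaEps (n : ℕ) (p ε : ℝ) (Ω : Set (EuclideanSpace ℝ (Fin n))) : ℝ :=
  sInf { r : ℝ | ∃ v : EuclideanSpace ℝ (Fin n) → ℝ, IsTestFun n Ω v ∧
    (∫ x in Ω, |v x| ^ p ∂(gaussianMeasure n)) = 1 ∧ r = Jeps n p ε Ω v }

/-- A normalized minimizer of the `ε`-regularized problem. -/
def IsNormalizedMinimizer (n : ℕ) (p ε : ℝ) (Ω : Set (EuclideanSpace ℝ (Fin n)))
    (uε : EuclideanSpace ℝ (Fin n) → ℝ) : Prop :=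
  ContinuousOn uε (closure Ω) ∧ ContDiffOn ℝ 1 uε Ω ∧
  (∀ x ∈ closure Ω, 0 ≤ uε x) ∧ (∀ x ∈ frontier Ω, uε x = 0) ∧
  (∫ x in Ω, uε x ^ p ∂(gaussianMeasure n)) = 1 ∧
  Jeps n p ε Ω uε = lambdaEps n p ε Ω

open MeasureTheory Real Set Metric Bornology
open scoped RealInnerProductSpace Pointwise NNReal Topology
/-! part 1 -/
noncomputable def Fe (ε p s r : ℝ) : ℝ := (ε * s ^ 2 + r ^ 2) ^ (p / 2)

lemma Fe_nonneg {ε p s r : ℝ} (hε : 0 ≤ ε) : 0 ≤ Fe ε p s r := by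
  unfold Fe; positivity

lemma Fe_eq_sqrt {ε p s r : ℝ} (hε : 0 ≤ ε) : Fe ε p s r = (√(ε * s ^ 2 + r ^ 2)) ^ p := by
  unfold Fe
  rw [Real.sqrt_eq_rpow, ← Real.rpow_mul (by positivity)]
  congr 1; ring

lemma Fe_mono {ε p s r s' r' : ℝ} (hε : 0 ≤ ε) (hp : 0 ≤ p) (hs : |s| ≤ |s'|) (hr : 0 ≤ r)
    (hr' : r ≤ r') : Fe ε p s r ≤ Fe ε p s' r' := by
  unfold Fe
  have := sq_le_sq.2 hs
  gcongr

lemma Fe_mono_eps {ε ε' p s r : ℝ} (hε : 0 ≤ ε) (hp : 0 ≤ p) (h : ε ≤ ε') :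
    Fe ε p s r ≤ Fe ε' p s r := by
  unfold Fe
  gcongr

lemma Fe_smul {ε p s r c : ℝ} (hε : 0 ≤ ε) (hc : 0 ≤ c) :
    Fe ε p (c * s) (c * r) = c ^ p * Fe ε p s r := by
  rw [Fe_eq_sqrt hε, Fe_eq_sqrt hε, ← Real.mul_rpow hc (Real.sqrt_nonneg _)]
  congr 1
  rw [show ε * (c * s) ^ 2 + (c * r) ^ 2 = c ^ 2 * (ε * s ^ 2 + r ^ 2) by ring,
    Real.sqrt_mul (by positivity), Real.sqrt_sq hc]

lemma Fe_zero_left {ε p r : ℝ} (hr : 0 ≤ r) : Fe ε p 0 r = r ^ p := by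
  unfold Fe
  rw [show ε * 0 ^ 2 + r ^ 2 = r ^ (2 : ℝ) by norm_num, ← Real.rpow_mul hr]
  congr 1; ring

lemma rpow_le_Fe {ε p s r : ℝ} (hε : 0 ≤ ε) (hp : 0 ≤ p) (hr : 0 ≤ r) : r ^ p ≤ Fe ε p s r := by
  rw [← Fe_zero_left (ε := ε) hr]
  exact Fe_mono hε hp (by simp) hr le_rfl

lemma Fe_convex {ε p θ s₁ s₂ r₁ r₂ r : ℝ} (hε : 0 ≤ ε) (hp : 1 ≤ p) (h0 : 0 ≤ θ) (h1 : θ ≤ 1)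
    (hr : 0 ≤ r) (hrr : r ≤ (1 - θ) * r₁ + θ * r₂) :
    Fe ε p ((1 - θ) * s₁ + θ * s₂) r ≤ (1 - θ) * Fe ε p s₁ r₁ + θ * Fe ε p s₂ r₂ := by
  have h1' : 0 ≤ 1 - θ := by linarith
  refine (Fe_mono hε (by linarith) le_rfl hr hrr).trans ?_
  rw [Fe_eq_sqrt hε, Fe_eq_sqrt hε, Fe_eq_sqrt hε]
  set A := √(ε * s₁ ^ 2 + r₁ ^ 2) with hA
  set B := √(ε * s₂ ^ 2 + r₂ ^ 2) with hB
  have hA0 : 0 ≤ A := Real.sqrt_nonneg _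
  have hB0 : 0 ≤ B := Real.sqrt_nonneg _
  have hA2 : A ^ 2 = ε * s₁ ^ 2 + r₁ ^ 2 := Real.sq_sqrt (by positivity)
  have hB2 : B ^ 2 = ε * s₂ ^ 2 + r₂ ^ 2 := Real.sq_sqrt (by positivity)
  have hAB : ε * s₁ * s₂ + r₁ * r₂ ≤ A * B := by
    apply le_of_sq_le_sq _ (by positivity)
    rw [mul_pow, hA2, hB2]
    nlinarith [mul_nonneg hε (sq_nonneg (s₁ * r₂ - s₂ * r₁))]
  have hN : √(ε * ((1 - θ) * s₁ + θ * s₂) ^ 2 + ((1 - θ) * r₁ + θ * r₂) ^ 2)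
      ≤ (1 - θ) * A + θ * B := by
    apply Real.sqrt_le_iff.2 ⟨by positivity, ?_⟩
    have : ((1 - θ) * A + θ * B) ^ 2 = (1 - θ) ^ 2 * A ^ 2 + θ ^ 2 * B ^ 2
      + 2 * ((1 - θ) * θ) * (A * B) := by ring
    rw [this, hA2, hB2]
    nlinarith [mul_le_mul_of_nonneg_left hAB (mul_nonneg h1' h0)]
  refine (Real.rpow_le_rpow (Real.sqrt_nonneg _) hN (by linarith)).trans ?_
  have := (convexOn_rpow hp).2 (x := A) hA0 (y := B) hB0 h1' h0 (by ring)
  simpa using this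

lemma Fe_add_le {ε p s₁ s₂ r₁ r₂ r : ℝ} (hε : 0 ≤ ε) (hp : 1 ≤ p)
    (hr : 0 ≤ r) (hrr : r ≤ r₁ + r₂) :
    Fe ε p (s₁ + s₂) r ≤ 2 ^ p * (Fe ε p s₁ r₁ + Fe ε p s₂ r₂) := by
  have := Fe_convex (ε := ε) (p := p) (θ := 1 / 2) (s₁ := 2 * s₁) (s₂ := 2 * s₂) (r₁ := 2 * r₁)
    (r₂ := 2 * r₂) (r := r) hε hp (by norm_num) (by norm_num) hr (by linarith)
  rw [Fe_smul hε (by norm_num), Fe_smul hε (by norm_num)] at this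
  have e : (1 - 1 / 2) * (2 * s₁) + 1 / 2 * (2 * s₂) = s₁ + s₂ := by ring
  rw [e] at this
  have h2 : (0:ℝ) ≤ 2 ^ p := by positivity
  have := mul_nonneg h2 (Fe_nonneg (ε := ε) (p := p) (s := s₁) (r := r₁) hε)
  have := mul_nonneg h2 (Fe_nonneg (ε := ε) (p := p) (s := s₂) (r := r₂) hε)
  linarith

lemma Fe_cont (ε : ℝ) {p : ℝ} (hp : 0 ≤ p) : Continuous (fun z : ℝ × ℝ => Fe ε p z.1 z.2) := by
  unfold Fe
  exact Continuous.rpow_const (by fun_prop) (fun _ => Or.inr (by linarith))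

lemma norm_gradient_eq {n : ℕ} (f : EuclideanSpace ℝ (Fin n) → ℝ) (x : EuclideanSpace ℝ (Fin n)) :
    ‖gradient f x‖ = ‖fderiv ℝ f x‖ := by
  unfold gradient
  simp

lemma Jeps_eq (n : ℕ) (p ε : ℝ) (Ω : Set (EuclideanSpace ℝ (Fin n)))
    (v : EuclideanSpace ℝ (Fin n) → ℝ) :
    Jeps n p ε Ω v = ∫ x in Ω, Fe ε p (v x) ‖fderiv ℝ v x‖ ∂(gaussianMeasure n) := by
  simp only [Jeps, norm_gradient_eq, Fe]

/-- comparison of the Gaussian and Lebesgue measures on a bounded set -/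
lemma gauss_compare (n : ℕ) (Ω : Set (EuclideanSpace ℝ (Fin n))) (hΩo : IsOpen Ω)
    (hΩb : IsBounded Ω) : ∃ C : ℝ≥0, 0 < C ∧
      (volume : Measure (EuclideanSpace ℝ (Fin n))).restrict Ω ≤ C • (gaussianMeasure n).restrict Ω ∧
      (gaussianMeasure n).restrict Ω ≤ C • (volume : Measure (EuclideanSpace ℝ (Fin n))).restrict Ω := by
  obtain ⟨R, hR⟩ := hΩb.exists_norm_le
  set d : EuclideanSpace ℝ (Fin n) → ℝ :=
    fun x => (2 * π) ^ (-(n : ℝ) / 2) * Real.exp (-‖x‖ ^ 2 / 2) with hd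
  have hdc : Continuous d := by fun_prop
  set A : ℝ := (2 * π) ^ (-(n : ℝ) / 2) with hA
  have hA0 : 0 < A := by positivity
  set c : ℝ := A * Real.exp (-R ^ 2 / 2)
  have hc : 0 < c := by positivity
  have hdm : Measurable (fun x => ENNReal.ofReal (d x)) := hdc.measurable.ennreal_ofReal
  have hlow : ∀ x ∈ Ω, c ≤ d x := by
    intro x hx
    have h1 := hR x hx
    have : ‖x‖ ^ 2 ≤ R ^ 2 := by gcongr
    simp only [hd, c]
    gcongr
  have hup : ∀ x ∈ Ω, d x ≤ A := by
    intro x hx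
    have : Real.exp (-‖x‖ ^ 2 / 2) ≤ 1 := Real.exp_le_one_iff.2 (by have := sq_nonneg ‖x‖; linarith)
    calc d x = A * Real.exp (-‖x‖ ^ 2 / 2) := rfl
      _ ≤ A * 1 := by gcongr
      _ = A := by ring
  have hg : (gaussianMeasure n).restrict Ω =
      ((volume : Measure (EuclideanSpace ℝ (Fin n))).restrict Ω).withDensity
        (fun x => ENNReal.ofReal (d x)) := by
    rw [gaussianMeasure, restrict_withDensity hΩo.measurableSet]
  refine ⟨Real.toNNReal (A + c⁻¹), by simp; positivity, ?_, ?_⟩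
  · rw [hg]
    refine Measure.le_iff.2 fun s hs => ?_
    rw [Measure.smul_apply, withDensity_apply _ hs, Measure.restrict_restrict hs]
    have : ENNReal.ofReal c * volume (s ∩ Ω) ≤ ∫⁻ x in s ∩ Ω, ENNReal.ofReal (d x) := by
      rw [← setLIntegral_const]
      exact setLIntegral_mono hdm (fun x hx => ENNReal.ofReal_le_ofReal (hlow x hx.2))
    rw [Measure.restrict_apply hs]
    calc volume (s ∩ Ω) = ENNReal.ofReal (c⁻¹) * (ENNReal.ofReal c * volume (s ∩ Ω)) := by
          rw [← mul_assoc, ← ENNReal.ofReal_mul (by positivity), inv_mul_cancel₀ hc.ne']; simp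
      _ ≤ ENNReal.ofReal (A + c⁻¹) * ∫⁻ x in s ∩ Ω, ENNReal.ofReal (d x) := by
          gcongr; linarith
      _ = _ := rfl
  · rw [hg]
    refine Measure.le_iff.2 fun s hs => ?_
    rw [Measure.smul_apply, withDensity_apply _ hs, Measure.restrict_restrict hs,
      Measure.restrict_apply hs]
    calc ∫⁻ x in s ∩ Ω, ENNReal.ofReal (d x) ≤ ENNReal.ofReal A * volume (s ∩ Ω) := by
          rw [← setLIntegral_const]
          exact setLIntegral_mono measurable_const
            (fun x hx => ENNReal.ofReal_le_ofReal (hup x hx.2))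
      _ ≤ ENNReal.ofReal (A + c⁻¹) * volume (s ∩ Ω) := by
          gcongr
          have : 0 < c⁻¹ := by positivity
          linarith
      _ = _ := rfl

lemma Fe_tendsto {ι : Type*} {l : Filter ι} (ε : ℝ) {p : ℝ} (hp : 0 ≤ p) {a b : ι → ℝ} {s r : ℝ}
    (ha : Filter.Tendsto a l (𝓝 s)) (hb : Filter.Tendsto b l (𝓝 r)) :
    Filter.Tendsto (fun j => Fe ε p (a j) (b j)) l (𝓝 (Fe ε p s r)) := by
  unfold Fe
  exact (((ha.pow 2).const_mul ε).add (hb.pow 2)).rpow_const (Or.inr (by linarith))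

lemma Fe_continuous {X : Type*} [TopologicalSpace X] (ε : ℝ) {p : ℝ} (hp : 0 ≤ p) {a b : X → ℝ}
    (ha : Continuous a) (hb : Continuous b) :
    Continuous (fun j => Fe ε p (a j) (b j)) :=
  continuous_iff_continuousAt.2 fun x => Fe_tendsto ε hp ha.continuousAt hb.continuousAt

lemma Fe_continuousOn {X : Type*} [TopologicalSpace X] (ε : ℝ) {p : ℝ} (hp : 0 ≤ p) {a b : X → ℝ}
    {s : Set X} (ha : ContinuousOn a s) (hb : ContinuousOn b s) :
    ContinuousOn (fun j => Fe ε p (a j) (b j)) s :=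
  fun x hx => Fe_tendsto ε hp (ha x hx) (hb x hx)

open MeasureTheory Real Set Metric Bornology
open scoped RealInnerProductSpace Pointwise NNReal Topology
/-! part 2 -/
lemma mollify_C1 (n : ℕ) (Ω : Set (EuclideanSpace ℝ (Fin n))) (hΩo : IsOpen Ω)
    (v : EuclideanSpace ℝ (Fin n) → ℝ) (hv : ContDiff ℝ 1 v) (hc : HasCompactSupport v)
    (hs : tsupport v ⊆ Ω) (κ : ℝ) (hκ : 0 < κ) :
    ∃ w, IsTestFun n Ω w ∧ (∀ x, |w x - v x| ≤ κ) ∧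
      ∀ x, ‖fderiv ℝ w x - fderiv ℝ v x‖ ≤ κ := by
  have hdc : Continuous (fderiv ℝ v) := hv.continuous_fderiv one_ne_zero
  have hu1 : UniformContinuous v := hc.uniformContinuous_of_continuous hv.continuous
  have hu2 : UniformContinuous (fderiv ℝ v) := (hc.fderiv ℝ).uniformContinuous_of_continuous hdc
  obtain ⟨d₁, hd₁, h1⟩ := Metric.uniformContinuous_iff.1 hu1 κ hκ
  obtain ⟨d₂, hd₂, h2⟩ := Metric.uniformContinuous_iff.1 hu2 κ hκ
  obtain ⟨d₃, hd₃, h3⟩ := hc.isCompact.exists_cthickening_subset_open hΩo hs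
  set r := min d₁ (min d₂ d₃) with hr
  have hr0 : 0 < r := by positivity
  let φ : ContDiffBump (0 : EuclideanSpace ℝ (Fin n)) := ⟨r / 2, r, by positivity, by linarith⟩
  set L : ℝ →L[ℝ] ℝ →L[ℝ] ℝ := ContinuousLinearMap.lsmul ℝ ℝ
  set w := convolution (φ.normed volume) v L volume with hw
  have hloc : LocallyIntegrable (φ.normed volume) (volume : Measure (EuclideanSpace ℝ (Fin n))) :=
    φ.continuous_normed.locallyIntegrable
  have hsupp : tsupport w ⊆ cthickening d₃ (tsupport v) := by
    apply closure_minimal _ isClosed_cthickening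
    refine (support_convolution_subset L).trans ?_
    rintro _ ⟨a, ha, b, hb, rfl⟩
    rw [φ.support_normed_eq] at ha
    apply mem_cthickening_of_dist_le _ b _ _ (subset_tsupport _ hb)
    have : dist (a + b) b = ‖a‖ := by simp [dist_eq_norm]
    rw [this]
    have h5 : ‖a‖ < r := by simpa using ha
    exact h5.le.trans ((min_le_right _ _).trans (min_le_right _ _))
  refine ⟨w, ⟨?_, ?_, hsupp.trans h3⟩, ?_, ?_⟩
  · exact φ.hasCompactSupport_normed.contDiff_convolution_left _ φ.contDiff_normed
      hv.continuous.locallyIntegrable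
  · exact φ.hasCompactSupport_normed.convolution L hc
  · intro x
    rw [← Real.dist_eq]
    apply φ.dist_normed_convolution_le hv.continuous.aestronglyMeasurable
    intro y hy
    exact (h1 (lt_of_lt_of_le hy (min_le_left _ _))).le
  · intro x
    have hfd := hc.hasFDerivAt_convolution_right L hloc hv x
    rw [hfd.fderiv, ← dist_eq_norm]
    have hL : L.precompR (EuclideanSpace ℝ (Fin n)) =
        (ContinuousLinearMap.lsmul ℝ ℝ : ℝ →L[ℝ] (EuclideanSpace ℝ (Fin n) →L[ℝ] ℝ) →L[ℝ] _) := by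
      ext c f
      simp [L, ContinuousLinearMap.precompR]
    rw [hL]
    apply φ.dist_normed_convolution_le hdc.aestronglyMeasurable
    intro y hy
    exact (h2 (lt_of_lt_of_le hy ((min_le_right _ _).trans (min_le_left _ _)))).le

/-- set in the definition of lambdaEps is bounded below -/
lemma lambda_bdd (n : ℕ) (p ε : ℝ) (hε : 0 ≤ ε) (Ω : Set (EuclideanSpace ℝ (Fin n))) :
    BddBelow { r : ℝ | ∃ v : EuclideanSpace ℝ (Fin n) → ℝ, IsTestFun n Ω v ∧
    (∫ x in Ω, |v x| ^ p ∂(gaussianMeasure n)) = 1 ∧ r = Jeps n p ε Ω v } := by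
  refine ⟨0, ?_⟩
  rintro r ⟨v, -, -, rfl⟩
  rw [Jeps_eq]
  exact integral_nonneg fun x => Fe_nonneg hε

lemma lambda_nonneg (n : ℕ) (p ε : ℝ) (hε : 0 ≤ ε) (Ω : Set (EuclideanSpace ℝ (Fin n))) :
    0 ≤ lambdaEps n p ε Ω := by
  apply Real.sInf_nonneg
  rintro r ⟨v, -, -, rfl⟩
  rw [Jeps_eq]
  exact integral_nonneg fun x => Fe_nonneg hε

lemma lambda_le_test (n : ℕ) (p ε : ℝ) (hp : 1 < p) (hε : 0 ≤ ε)
    (Ω : Set (EuclideanSpace ℝ (Fin n)))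
    (v : EuclideanSpace ℝ (Fin n) → ℝ) (hv : IsTestFun n Ω v) :
    lambdaEps n p ε Ω * (∫ x in Ω, |v x| ^ p ∂(gaussianMeasure n)) ≤
      ∫ x in Ω, Fe ε p (v x) ‖fderiv ℝ v x‖ ∂(gaussianMeasure n) := by
  set I := ∫ x in Ω, |v x| ^ p ∂(gaussianMeasure n) with hI
  have hI0 : 0 ≤ I := integral_nonneg fun x => by positivity
  rcases hI0.eq_or_lt with h | h
  · rw [← h, mul_zero]; exact integral_nonneg fun x => Fe_nonneg hε
  set c : ℝ := I ^ (-(1 / p)) with hcdef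
  have hc : 0 < c := by positivity
  have hcp : c ^ p = I⁻¹ := by
    rw [hcdef, ← Real.rpow_mul hI0, ← Real.rpow_neg_one]
    congr 1; field_simp
  have hmem : IsTestFun n Ω (fun x => c * v x) := by
    refine ⟨contDiff_const.mul hv.1, hv.2.1.mul_left, ?_⟩
    exact (tsupport_mul_subset_right (f := fun _ => c) (g := v)).trans hv.2.2
  have h1 : lambdaEps n p ε Ω ≤ Jeps n p ε Ω (fun x => c * v x) := by
    apply csInf_le (lambda_bdd n p ε hε Ω)
    refine ⟨_, hmem, ?_, rfl⟩
    simp_rw [abs_mul, abs_of_pos hc, Real.mul_rpow hc.le (abs_nonneg _)]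
    rw [integral_const_mul, ← hI, hcp, inv_mul_cancel₀ h.ne']
  have h2 : Jeps n p ε Ω (fun x => c * v x) =
      I⁻¹ * ∫ x in Ω, Fe ε p (v x) ‖fderiv ℝ v x‖ ∂(gaussianMeasure n) := by
    rw [Jeps_eq, ← hcp, ← integral_const_mul]
    congr 1
    ext x
    have : fderiv ℝ (fun x => c * v x) x = c • fderiv ℝ v x :=
      fderiv_const_mul (hv.1.differentiable (by simp) x) c
    rw [this, norm_smul, Real.norm_of_nonneg hc.le, Fe_smul hε hc.le]
  rw [h2] at h1
  calc _ ≤ (I⁻¹ * ∫ x in Ω, Fe ε p (v x) ‖fderiv ℝ v x‖ ∂(gaussianMeasure n)) * I := by gcongr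
    _ = _ := by field_simp

lemma lambda_le_C1 (n : ℕ) (p ε : ℝ) (hp : 1 < p) (hε : 0 ≤ ε)
    (Ω : Set (EuclideanSpace ℝ (Fin n))) (hΩo : IsOpen Ω)
    [IsFiniteMeasure ((gaussianMeasure n).restrict Ω)]
    (v : EuclideanSpace ℝ (Fin n) → ℝ) (hv : ContDiff ℝ 1 v) (hc : HasCompactSupport v)
    (hs : tsupport v ⊆ Ω) :
    lambdaEps n p ε Ω * (∫ x in Ω, |v x| ^ p ∂(gaussianMeasure n)) ≤
      ∫ x in Ω, Fe ε p (v x) ‖fderiv ℝ v x‖ ∂(gaussianMeasure n) := by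
  have hex : ∀ j : ℕ, ∃ w, IsTestFun n Ω w ∧ (∀ x, |w x - v x| ≤ 1 / ((j : ℝ) + 1)) ∧
      ∀ x, ‖fderiv ℝ w x - fderiv ℝ v x‖ ≤ 1 / ((j : ℝ) + 1) :=
    fun j => mollify_C1 n Ω hΩo v hv hc hs _ (by positivity)
  choose w hw1 hw2 hw3 using hex
  have hdc : Continuous (fderiv ℝ v) := hv.continuous_fderiv one_ne_zero
  obtain ⟨A, hA⟩ := hv.continuous.bounded_above_of_compact_support hc
  obtain ⟨B, hB⟩ := hdc.bounded_above_of_compact_support (hc.fderiv ℝ)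
  have hj : ∀ j : ℕ, 1 / ((j : ℝ) + 1) ≤ 1 := fun j => by
    rw [div_le_one (by positivity)]; linarith [(Nat.cast_nonneg j : (0:ℝ) ≤ j)]
  have hwA : ∀ j x, |w j x| ≤ A + 1 := fun j x => by
    have h1 := hw2 j x; have h2 := hA x; have h3 := hj j
    rw [Real.norm_eq_abs] at h2
    have := abs_add_le (w j x - v x) (v x)
    simp at this; linarith
  have hwB : ∀ j x, ‖fderiv ℝ (w j) x‖ ≤ B + 1 := fun j x => by
    have h1 := hw3 j x; have h2 := hB x; have h3 := hj j
    have := norm_add_le (fderiv ℝ (w j) x - fderiv ℝ v x) (fderiv ℝ v x)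
    simp at this; linarith
  have hA0 : 0 ≤ A := (norm_nonneg _).trans (hA 0)
  have ht1 : ∀ x, Filter.Tendsto (fun j => w j x) Filter.atTop (𝓝 (v x)) := fun x => by
    rw [tendsto_iff_norm_sub_tendsto_zero]
    exact squeeze_zero (fun _ => norm_nonneg _) (fun j => hw2 j x)
      tendsto_one_div_add_atTop_nhds_zero_nat
  have ht2 : ∀ x, Filter.Tendsto (fun j => fderiv ℝ (w j) x) Filter.atTop (𝓝 (fderiv ℝ v x)) :=
    fun x => by
    rw [tendsto_iff_norm_sub_tendsto_zero]
    exact squeeze_zero (fun _ => norm_nonneg _) (fun j => hw3 j x)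
      tendsto_one_div_add_atTop_nhds_zero_nat
  have hT1 : Filter.Tendsto (fun j => ∫ x in Ω, |w j x| ^ p ∂(gaussianMeasure n)) Filter.atTop
      (𝓝 (∫ x in Ω, |v x| ^ p ∂(gaussianMeasure n))) := by
    apply tendsto_integral_of_dominated_convergence (fun _ => (A + 1) ^ p)
    · intro j
      exact ((hw1 j).1.continuous.abs.rpow_const
        (fun _ => Or.inr (by linarith))).aestronglyMeasurable
    · exact integrable_const _
    · intro j
      refine Filter.Eventually.of_forall fun x => ?_
      rw [Real.norm_of_nonneg (by positivity)]
      exact Real.rpow_le_rpow (abs_nonneg _) (hwA j x) (by linarith)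
    · refine Filter.Eventually.of_forall fun x => ?_
      exact ((ht1 x).abs).rpow_const (Or.inr (by linarith))
  have hT2 : Filter.Tendsto (fun j => ∫ x in Ω, Fe ε p (w j x) ‖fderiv ℝ (w j) x‖
      ∂(gaussianMeasure n)) Filter.atTop
      (𝓝 (∫ x in Ω, Fe ε p (v x) ‖fderiv ℝ v x‖ ∂(gaussianMeasure n))) := by
    apply tendsto_integral_of_dominated_convergence (fun _ => Fe ε p (A + 1) (B + 1))
    · intro j
      refine Continuous.aestronglyMeasurable ?_
      exact Fe_continuous ε (by linarith) (hw1 j).1.continuous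
        ((hw1 j).1.continuous_fderiv (by simp)).norm
    · exact integrable_const _
    · intro j
      refine Filter.Eventually.of_forall fun x => ?_
      rw [Real.norm_of_nonneg (Fe_nonneg hε)]
      exact Fe_mono hε (by linarith) ((hwA j x).trans (le_abs_self _)) (norm_nonneg _) (hwB j x)
    · refine Filter.Eventually.of_forall fun x => ?_
      exact Fe_tendsto ε (by linarith) (ht1 x) (ht2 x).norm
  exact le_of_tendsto_of_tendsto' (hT1.const_mul _) hT2
    (fun j => lambda_le_test n p ε hp hε Ω (w j) (hw1 j))

open MeasureTheory Real Set Metric Bornology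
open scoped RealInnerProductSpace Pointwise NNReal Topology
/-! part 3 -/
lemma hasDerivAt_max_rpow {q : ℝ} (hq : 1 < q) (x : ℝ) :
    HasDerivAt (fun x : ℝ => (max x 0) ^ q) (q * (max x 0) ^ (q - 1)) x := by
  rcases lt_trichotomy x 0 with h | h | h
  · rw [max_eq_right h.le, Real.zero_rpow (by linarith), mul_zero]
    apply (hasDerivAt_const x (0 : ℝ)).congr_of_eventuallyEq
    filter_upwards [gt_mem_nhds h] with y hy
    rw [max_eq_right hy.le, Real.zero_rpow (by linarith)]
  · subst h
    rw [max_self, Real.zero_rpow (by linarith), mul_zero]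
    rw [hasDerivAt_iff_isLittleO_nhds_zero]
    simp only [zero_add, max_self, smul_zero, sub_zero, Real.zero_rpow (by linarith : q ≠ 0)]
    have h1 : (fun x : ℝ => |x| ^ q) =o[𝓝 0] fun x => x := by
      have e : (fun x : ℝ => |x| ^ q) = fun x => |x| ^ (q - 1) * |x| := by
        ext x
        rcases eq_or_ne x 0 with rfl | hx
        · simp [Real.zero_rpow (by linarith : q ≠ 0)]
        · rw [← Real.rpow_add_one (by simpa using hx)]; ring_nf
      rw [e]
      have h2 : Filter.Tendsto (fun x : ℝ => |x| ^ (q - 1)) (𝓝 0) (𝓝 0) := by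
        have : Continuous (fun x : ℝ => |x| ^ (q - 1)) :=
          continuous_abs.rpow_const fun _ => Or.inr (by linarith)
        have h := this.tendsto 0
        simpa [Real.zero_rpow (by linarith : q - 1 ≠ 0)] using h
      have h3 := (Asymptotics.isLittleO_one_iff ℝ).2 h2
      have h4 := h3.mul_isBigO (Asymptotics.isBigO_refl (fun x : ℝ => |x|) (𝓝 0))
      simp only [one_mul] at h4
      exact (h4.trans_isBigO (Asymptotics.isBigO_of_le _ (by simp)))
    refine Asymptotics.IsBigO.trans_isLittleO (Asymptotics.isBigO_of_le _ fun x => ?_) h1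
    have h0 : 0 ≤ max x 0 := le_max_right _ _
    rw [Real.norm_of_nonneg (by positivity), Real.norm_of_nonneg (by positivity)]
    exact Real.rpow_le_rpow h0 (max_le (le_abs_self _) (abs_nonneg _)) (by linarith)
  · rw [max_eq_left h.le]
    apply (Real.hasDerivAt_rpow_const (Or.inl h.ne')).congr_of_eventuallyEq
    filter_upwards [lt_mem_nhds h] with y hy
    rw [max_eq_left hy.le]

lemma contDiff_max_rpow {q : ℝ} (hq : 1 < q) : ContDiff ℝ 1 (fun x : ℝ => (max x 0) ^ q) := by
  rw [contDiff_one_iff_deriv]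
  refine ⟨fun x => (hasDerivAt_max_rpow hq x).differentiableAt, ?_⟩
  have : deriv (fun x : ℝ => (max x 0) ^ q) = fun x => q * (max x 0) ^ (q - 1) := by
    ext x; exact (hasDerivAt_max_rpow hq x).deriv
  rw [this]
  exact continuous_const.mul ((by fun_prop : Continuous fun x : ℝ => max x 0).rpow_const
    fun _ => Or.inr (by linarith))

structure Good (n : ℕ) (p ε : ℝ) (Ω : Set (EuclideanSpace ℝ (Fin n)))
    (u : EuclideanSpace ℝ (Fin n) → ℝ) : Prop where
  cont : Continuous u
  nonneg : ∀ x, 0 ≤ u x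
  zero : ∀ x, x ∉ Ω → u x = 0
  diff : ContDiffOn ℝ 1 u Ω
  norm : ∫ x in Ω, u x ^ p ∂(gaussianMeasure n) = 1
  int : Integrable (fun x => Fe ε p (u x) ‖fderiv ℝ u x‖) ((gaussianMeasure n).restrict Ω)
  eq : ∫ x in Ω, Fe ε p (u x) ‖fderiv ℝ u x‖ ∂(gaussianMeasure n) = lambdaEps n p ε Ω

section
variable {n : ℕ} {p ε : ℝ} {Ω : Set (EuclideanSpace ℝ (Fin n))} {u : EuclideanSpace ℝ (Fin n) → ℝ}

lemma Good.diffAt (hu : Good n p ε Ω u) (hΩo : IsOpen Ω) {x : EuclideanSpace ℝ (Fin n)}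
    (hx : x ∈ Ω) : ContDiffAt ℝ 1 u x := hu.diff.contDiffAt (hΩo.mem_nhds hx)

lemma Good.dAt (hu : Good n p ε Ω u) (hΩo : IsOpen Ω) {x : EuclideanSpace ℝ (Fin n)}
    (hx : x ∈ Ω) : HasFDerivAt u (fderiv ℝ u x) x :=
  ((hu.diffAt hΩo hx).differentiableAt (by simp)).hasFDerivAt

lemma Good.fderiv_cont (hu : Good n p ε Ω u) (hΩo : IsOpen Ω) :
    ContinuousOn (fderiv ℝ u) Ω := hu.diff.continuousOn_fderiv_of_isOpen hΩo le_rfl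

lemma Good.bdd (hu : Good n p ε Ω u) (hΩb : IsBounded Ω) : ∃ M, 0 ≤ M ∧ ∀ x, u x ≤ M := by
  have hc : HasCompactSupport u := by
    apply HasCompactSupport.intro hΩb.isCompact_closure
    intro x hx
    exact hu.zero x fun h => hx (subset_closure h)
  obtain ⟨M, hM⟩ := hu.cont.bounded_above_of_compact_support hc
  exact ⟨M, (norm_nonneg _).trans (hM 0), fun x => (le_abs_self _).trans (hM x)⟩

lemma Good.trunc (hu : Good n p ε Ω u) (hΩo : IsOpen Ω) (hΩb : IsBounded Ω) {h : ℝ} (hh : 0 < h)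
    {H : ℝ → ℝ} (hH : ContDiff ℝ 1 H) (hH0 : ∀ s ≤ h, H s = 0) :
    ContDiff ℝ 1 (fun x => H (u x)) ∧ HasCompactSupport (fun x => H (u x)) ∧
      tsupport (fun x => H (u x)) ⊆ Ω := by
  have hts : tsupport (fun x => H (u x)) ⊆ {x | h ≤ u x} := by
    apply closure_minimal _ (isClosed_le continuous_const hu.cont)
    intro x hx
    by_contra h'
    exact hx (hH0 _ (not_le.1 h').le)
  have hts2 : tsupport (fun x => H (u x)) ⊆ Ω := by
    intro x hx
    by_contra h'
    have h1 : h ≤ u x := hts hx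
    have := hu.zero x h'
    linarith
  refine ⟨?_, ?_, hts2⟩
  · rw [contDiff_iff_contDiffAt]
    intro x
    by_cases hx : x ∈ Ω
    · exact hH.contDiffAt.comp x (hu.diffAt hΩo hx)
    · have : (fun x => H (u x)) =ᶠ[𝓝 x] fun _ => 0 :=
        notMem_tsupport_iff_eventuallyEq.1 fun h => hx (hts2 h)
      exact contDiffAt_const.congr_of_eventuallyEq this
  · exact HasCompactSupport.intro hΩb.isCompact_closure
      (fun x hx => image_eq_zero_of_notMem_tsupport (f := fun x => H (u x))
        fun h' => hx (subset_closure (hts2 h')))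

noncomputable def Gt (h s : ℝ) : ℝ := (max (s - h) 0) ^ (2 : ℝ) * s⁻¹

lemma Gt_zero {h s : ℝ} (hs : s ≤ h) : Gt h s = 0 := by
  unfold Gt
  rw [max_eq_right (by linarith), Real.zero_rpow (by norm_num), zero_mul]

lemma Gt_contDiff {h : ℝ} (hh : 0 < h) : ContDiff ℝ 1 (Gt h) := by
  rw [contDiff_iff_contDiffAt]
  intro s
  rcases lt_or_ge s h with hs | hs
  · apply (contDiffAt_const (c := (0 : ℝ))).congr_of_eventuallyEq
    filter_upwards [gt_mem_nhds hs] with y hy using Gt_zero hy.le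
  · unfold Gt
    refine ContDiffAt.mul ?_ (contDiffAt_inv ℝ (by linarith))
    exact ((contDiff_max_rpow (q := 2) (by norm_num)).comp (contDiff_id.sub contDiff_const)).contDiffAt

lemma Gt_hasDerivAt {h s : ℝ} (hh : 0 < h) :
    HasDerivAt (Gt h) (1 - (1 - max (s - h) 0 * s⁻¹) ^ 2) s := by
  rcases lt_or_ge s h with hs | hs
  · rw [max_eq_right (by linarith)]
    simp only [zero_mul, sub_zero, one_pow, sub_self]
    apply (hasDerivAt_const s (0 : ℝ)).congr_of_eventuallyEq
    filter_upwards [gt_mem_nhds hs] with y hy using Gt_zero hy.le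
  · have hs0 : 0 < s := by linarith
    have h1 := (hasDerivAt_max_rpow (q := 2) (by norm_num) (s - h)).comp s
      ((hasDerivAt_id s).sub_const h)
    have h2 := h1.mul (hasDerivAt_inv hs0.ne')
    have e : (1 - (1 - max (s - h) 0 * s⁻¹) ^ 2) = (2 * max (s - h) 0 ^ ((2:ℝ) - 1) * 1) * s⁻¹ +
        max (s - h) 0 ^ (2:ℝ) * -(s ^ 2)⁻¹ := by
      norm_num
      field_simp
      ring
    rw [e]
    exact h2

lemma Gt_bounds {h s : ℝ} (hh : 0 < h) (hs : 0 ≤ s) : 0 ≤ Gt h s ∧ Gt h s ≤ s ∧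
    0 ≤ max (s - h) 0 * s⁻¹ ∧ max (s - h) 0 * s⁻¹ ≤ 1 := by
  have h0 : 0 ≤ max (s - h) 0 := le_max_right _ _
  have h1 : max (s - h) 0 ≤ s := max_le (by linarith) hs
  refine ⟨by unfold Gt; positivity, ?_, by positivity, ?_⟩
  · rcases hs.eq_or_lt with rfl | hs
    · simp [Gt]
    · unfold Gt
      rw [← div_eq_mul_inv, div_le_iff₀ hs, ← sq]
      norm_num
      gcongr
  · rcases hs.eq_or_lt with rfl | hs
    · simp
    · rw [← div_eq_mul_inv, div_le_one hs]; exact h1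

lemma Good.super (hu : Good n p ε Ω u) (hΩo : IsOpen Ω) (hΩb : IsBounded Ω) (hp : 1 < p)
    (hε : 0 ≤ ε) [IsFiniteMeasure ((gaussianMeasure n).restrict Ω)]
    {ψ : EuclideanSpace ℝ (Fin n) → ℝ} (hψ : ContDiff ℝ 1 ψ) (hc : HasCompactSupport ψ)
    (hs : tsupport ψ ⊆ Ω) (hψ0 : ∀ x, 0 ≤ ψ x) :
    Integrable (fun x => Fe ε p (u x + ψ x) ‖fderiv ℝ u x + fderiv ℝ ψ x‖)
      ((gaussianMeasure n).restrict Ω) ∧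
    ∫ x in Ω, Fe ε p (u x) ‖fderiv ℝ u x‖ ∂(gaussianMeasure n) ≤
      ∫ x in Ω, Fe ε p (u x + ψ x) ‖fderiv ℝ u x + fderiv ℝ ψ x‖ ∂(gaussianMeasure n) := by
  have hdc : Continuous (fderiv ℝ ψ) := hψ.continuous_fderiv one_ne_zero
  obtain ⟨A, hA⟩ := hψ.continuous.bounded_above_of_compact_support hc
  obtain ⟨B, hB⟩ := hdc.bounded_above_of_compact_support (hc.fderiv ℝ)
  obtain ⟨M, hM0, hM⟩ := hu.bdd hΩb
  have hA0 : 0 ≤ A := (norm_nonneg _).trans (hA 0)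
  have hψA : ∀ x, ψ x ≤ A := fun x => (le_abs_self _).trans (hA x)
  set D : EuclideanSpace ℝ (Fin n) → ℝ :=
    fun x => 2 ^ p * (Fe ε p (u x) ‖fderiv ℝ u x‖ + Fe ε p A B) with hD
  have hDint : Integrable D ((gaussianMeasure n).restrict Ω) :=
    (hu.int.add (integrable_const _)).const_mul _
  have hdom : ∀ x, ∀ a, ∀ r, 0 ≤ r → 0 ≤ a → a ≤ u x + ψ x → r ≤ ‖fderiv ℝ u x‖ + ‖fderiv ℝ ψ x‖ →
      Fe ε p a r ≤ D x := by
    intro x a r hr ha0 ha hrr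
    have h1 := hψA x; have h2 := hB x
    refine le_trans ?_ (Fe_add_le (r := r) hε hp.le hr (by linarith))
    apply Fe_mono hε (by linarith) _ hr le_rfl
    rw [abs_of_nonneg ha0]
    exact (by linarith : a ≤ u x + A).trans (le_abs_self _)
  have hint : Integrable (fun x => Fe ε p (u x + ψ x) ‖fderiv ℝ u x + fderiv ℝ ψ x‖)
      ((gaussianMeasure n).restrict Ω) := by
    apply hDint.mono'
    · apply ContinuousOn.aestronglyMeasurable _ hΩo.measurableSet
      apply Fe_continuousOn ε (by linarith)
      · exact (hu.cont.add hψ.continuous).continuousOn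
      · exact ((hu.fderiv_cont hΩo).add hdc.continuousOn).norm
    · refine Filter.Eventually.of_forall fun x => ?_
      rw [Real.norm_of_nonneg (Fe_nonneg hε)]
      exact hdom x _ _ (norm_nonneg _) (add_nonneg (hu.nonneg x) (hψ0 x)) le_rfl (norm_add_le _ _)
  refine ⟨hint, ?_⟩
  set h : ℕ → ℝ := fun j => 1 / ((j : ℝ) + 1) with hh
  have hh0 : ∀ j, 0 < h j := fun j => by simp only [hh]; positivity
  have hht : Filter.Tendsto h Filter.atTop (𝓝 0) := tendsto_one_div_add_atTop_nhds_zero_nat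
  set v : ℕ → EuclideanSpace ℝ (Fin n) → ℝ := fun j x => Gt (h j) (u x) + ψ x with hv
  have htr := fun j => hu.trunc hΩo hΩb (hh0 j) (Gt_contDiff (hh0 j)) (fun s hs => Gt_zero hs)
  have hv1 : ∀ j, ContDiff ℝ 1 (v j) := fun j => (htr j).1.add hψ
  have hv2 : ∀ j, HasCompactSupport (v j) := fun j => (htr j).2.1.add hc
  have hv3 : ∀ j, tsupport (v j) ⊆ Ω := fun j =>
    (tsupport_add (fun x => Gt (h j) (u x)) ψ).trans (union_subset (htr j).2.2 hs)
  set t : ℕ → EuclideanSpace ℝ (Fin n) → ℝ := fun j x => max (u x - h j) 0 * (u x)⁻¹ with ht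
  have hvd : ∀ j, ∀ x ∈ Ω, fderiv ℝ (v j) x =
      (1 - (1 - t j x) ^ 2) • fderiv ℝ u x + fderiv ℝ ψ x := by
    intro j x hx
    have h1 := (Gt_hasDerivAt (s := u x) (hh0 j)).comp_hasFDerivAt x (hu.dAt hΩo hx)
    exact (h1.add (hψ.differentiable one_ne_zero x).hasFDerivAt).fderiv
  have htt : ∀ x, u x ≠ 0 → Filter.Tendsto (fun j => t j x) Filter.atTop (𝓝 1) := by
    intro x hx
    have h1 : Filter.Tendsto (fun j => t j x) Filter.atTop (𝓝 (max (u x - 0) 0 * (u x)⁻¹)) :=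
      ((tendsto_const_nhds.sub hht).max tendsto_const_nhds).mul_const _
    rwa [sub_zero, max_eq_left (hu.nonneg x), mul_inv_cancel₀ hx] at h1
  have hvt : ∀ x, Filter.Tendsto (fun j => v j x) Filter.atTop (𝓝 (u x + ψ x)) := by
    intro x
    refine Filter.Tendsto.add_const _ ?_
    by_cases hx : u x = 0
    · simp only [hx, Gt, inv_zero, mul_zero]; exact tendsto_const_nhds
    · have e : ∀ j, Gt (h j) (u x) = t j x ^ 2 * u x := by
        intro j
        simp only [Gt, ht]
        norm_num
        field_simp
      simp_rw [e]
      have := ((htt x hx).pow 2).mul_const (u x)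
      simpa using this
  have hvdt : ∀ x ∈ Ω, Filter.Tendsto (fun j => fderiv ℝ (v j) x) Filter.atTop
      (𝓝 (fderiv ℝ u x + fderiv ℝ ψ x)) := by
    intro x hx
    simp_rw [hvd _ x hx]
    refine Filter.Tendsto.add_const _ ?_
    by_cases hx0 : u x = 0
    · have : fderiv ℝ u x = 0 := by
        apply IsLocalMin.fderiv_eq_zero
        exact Filter.Eventually.of_forall fun y => by rw [hx0]; exact hu.nonneg y
      simp only [this, smul_zero]; exact tendsto_const_nhds
    · have h1 : Filter.Tendsto (fun j => 1 - (1 - t j x) ^ 2) Filter.atTop (𝓝 (1 - (1 - 1) ^ 2)) :=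
        tendsto_const_nhds.sub ((tendsto_const_nhds.sub (htt x hx0)).pow 2)
      have := h1.smul_const (fderiv ℝ u x)
      simpa using this
  have hv0 : ∀ j x, 0 ≤ v j x := fun j x =>
    add_nonneg (Gt_bounds (hh0 j) (hu.nonneg x)).1 (hψ0 x)
  have hvle : ∀ j x, v j x ≤ u x + ψ x := fun j x => by
    have := (Gt_bounds (hh0 j) (hu.nonneg x)).2.1
    simp only [hv]; linarith
  have hT1 : Filter.Tendsto (fun j => ∫ x in Ω, |v j x| ^ p ∂(gaussianMeasure n)) Filter.atTop
      (𝓝 (∫ x in Ω, (u x + ψ x) ^ p ∂(gaussianMeasure n))) := by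
    apply tendsto_integral_of_dominated_convergence (fun _ => (M + A) ^ p)
    · intro j
      exact ((hv1 j).continuous.abs.rpow_const
        (fun _ => Or.inr (by linarith))).aestronglyMeasurable
    · exact integrable_const _
    · intro j
      refine Filter.Eventually.of_forall fun x => ?_
      rw [Real.norm_of_nonneg (by positivity), abs_of_nonneg (hv0 j x)]
      have := hvle j x; have := hM x; have := hψA x
      exact Real.rpow_le_rpow (hv0 j x) (by linarith) (by linarith)
    · refine Filter.Eventually.of_forall fun x => ?_
      have := ((hvt x).abs).rpow_const (p := p) (Or.inr (by linarith))
      rwa [abs_of_nonneg (add_nonneg (hu.nonneg x) (hψ0 x))] at this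
  have hT2 : Filter.Tendsto (fun j => ∫ x in Ω, Fe ε p (v j x) ‖fderiv ℝ (v j) x‖
      ∂(gaussianMeasure n)) Filter.atTop
      (𝓝 (∫ x in Ω, Fe ε p (u x + ψ x) ‖fderiv ℝ u x + fderiv ℝ ψ x‖ ∂(gaussianMeasure n))) := by
    apply tendsto_integral_of_dominated_convergence D
    · intro j
      refine Continuous.aestronglyMeasurable ?_
      exact Fe_continuous ε (by linarith) (hv1 j).continuous
        ((hv1 j).continuous_fderiv (by simp)).norm
    · exact hDint
    · intro j
      refine (ae_restrict_iff' hΩo.measurableSet).2 (Filter.Eventually.of_forall fun x hx => ?_)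
      rw [Real.norm_of_nonneg (Fe_nonneg hε)]
      refine hdom x _ _ (norm_nonneg _) (hv0 j x) (hvle j x) ?_
      rw [hvd j x hx]
      refine (norm_add_le _ _).trans ?_
      gcongr
      rw [norm_smul]
      obtain ⟨-, -, h3, h4⟩ := Gt_bounds (hh0 j) (hu.nonneg x)
      change 0 ≤ t j x at h3
      change t j x ≤ 1 at h4
      have : ‖1 - (1 - t j x) ^ 2‖ ≤ 1 := by
        rw [Real.norm_eq_abs, abs_le]; constructor <;> nlinarith
      exact mul_le_of_le_one_left (norm_nonneg _) this
    · refine (ae_restrict_iff' hΩo.measurableSet).2 (Filter.Eventually.of_forall fun x hx => ?_)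
      exact Fe_tendsto ε (by linarith) (hvt x) (hvdt x hx).norm
  have hlim := le_of_tendsto_of_tendsto' (hT1.const_mul _) hT2
    (fun j => lambda_le_C1 n p ε hp hε Ω hΩo (v j) (hv1 j) (hv2 j) (hv3 j))
  refine le_trans ?_ hlim
  rw [hu.eq]
  have h1 : (1 : ℝ) ≤ ∫ x in Ω, (u x + ψ x) ^ p ∂(gaussianMeasure n) := by
    rw [← hu.norm]
    apply integral_mono_of_nonneg
    · exact Filter.Eventually.of_forall fun x => Real.rpow_nonneg (hu.nonneg x) _
    · apply (integrable_const ((M + A) ^ p)).mono'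
      · exact ((hu.cont.add hψ.continuous).rpow_const
          (fun _ => Or.inr (by linarith))).aestronglyMeasurable
      · refine Filter.Eventually.of_forall fun x => ?_
        have h0 := add_nonneg (hu.nonneg x) (hψ0 x)
        rw [Real.norm_of_nonneg (by positivity)]
        exact Real.rpow_le_rpow h0 (add_le_add (hM x) (hψA x)) (by linarith)
    · refine Filter.Eventually.of_forall fun x => ?_
      have := hψ0 x
      exact Real.rpow_le_rpow (hu.nonneg x) (by linarith) (by linarith)
  have := mul_le_mul_of_nonneg_left h1 (lambda_nonneg n p ε hε Ω)
  linarith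
end

open MeasureTheory Real Set Metric Bornology
open scoped RealInnerProductSpace Pointwise NNReal Topology
/-! part 4 -/
lemma integral_transfer {X : Type*} [MeasurableSpace X] {μ ν : Measure X} {C : ℝ≥0}
    (h : μ ≤ C • ν) {f : X → ℝ} (hf : ∀ x, 0 ≤ f x) (hi : Integrable f ν) :
    Integrable f μ ∧ ∫ x, f x ∂μ ≤ C * ∫ x, f x ∂ν := by
  have h1 : Integrable f (C • ν) := by
    have : (C • ν) = (C : ENNReal) • ν := rfl
    rw [this]
    exact hi.smul_measure ENNReal.coe_ne_top
  refine ⟨h1.mono_measure h, ?_⟩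
  have := integral_mono_measure h (Filter.Eventually.of_forall hf) h1
  refine this.trans ?_
  rw [integral_smul_nnreal_measure]
  rfl

section
variable {n : ℕ} {p ε : ℝ} {Ω : Set (EuclideanSpace ℝ (Fin n))} {u : EuclideanSpace ℝ (Fin n) → ℝ}

lemma Good.cacc (hu : Good n p ε Ω u) (hΩo : IsOpen Ω) (hΩb : IsBounded Ω) (hp : 1 < p)
    (hε : 0 ≤ ε) {C : ℝ≥0}
    (hC1 : (volume : Measure (EuclideanSpace ℝ (Fin n))).restrict Ω ≤
      C • (gaussianMeasure n).restrict Ω)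
    (hC2 : (gaussianMeasure n).restrict Ω ≤
      C • (volume : Measure (EuclideanSpace ℝ (Fin n))).restrict Ω)
    [IsFiniteMeasure ((gaussianMeasure n).restrict Ω)]
    [IsFiniteMeasure ((volume : Measure (EuclideanSpace ℝ (Fin n))).restrict Ω)]
    {η : EuclideanSpace ℝ (Fin n) → ℝ} (hη : ContDiff ℝ 1 η) (hc : HasCompactSupport η)
    (hs : tsupport η ⊆ Ω) (hη0 : ∀ x, 0 ≤ η x) (hη1 : ∀ x, η x ≤ 1) {L : ℝ}
    (hL : ∀ x, ‖fderiv ℝ η x‖ ≤ L)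
    {g a b : ℝ → ℝ} (hg : ∀ t, 0 ≤ t → HasDerivAt g (-a t) t)
    (hg1 : ∀ t, 0 ≤ t → ContDiffAt ℝ 1 g t)
    (ha : ContinuousOn a (Ici 0)) (hb : ContinuousOn b (Ici 0))
    (ha0 : ∀ t, 0 ≤ t → 0 ≤ a t) (ha1 : ∀ t, 0 ≤ t → a t ≤ 1) (hb0 : ∀ t, 0 ≤ t → 0 ≤ b t)
    (hgab : ∀ t, 0 ≤ t → g t = a t * b t) :
    Integrable (fun x => η x ^ p * a (u x) * Fe ε p (u x) ‖fderiv ℝ u x‖)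
      ((volume : Measure (EuclideanSpace ℝ (Fin n))).restrict Ω) ∧
    Integrable (indicator {x | η x ≠ 0} (fun x => a (u x) * Fe ε p (u x + b (u x)) (p * L * b (u x))))
      ((volume : Measure (EuclideanSpace ℝ (Fin n))).restrict Ω) ∧
    ∫ x in Ω, η x ^ p * a (u x) * Fe ε p (u x) ‖fderiv ℝ u x‖ ≤
      C ^ 2 * ∫ x in Ω, indicator {x | η x ≠ 0}
        (fun x => a (u x) * Fe ε p (u x + b (u x)) (p * L * b (u x))) x := by
  have hp0 : 0 ≤ p := by linarith
  obtain ⟨M, hM0, hM⟩ := hu.bdd hΩb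
  have hL0 : 0 ≤ L := (norm_nonneg _).trans (hL 0)
  set ζ : EuclideanSpace ℝ (Fin n) → ℝ := fun x => η x ^ p with hζ
  have hζe : ζ = fun x => (max (η x) 0) ^ p := by
    ext x; simp only [hζ]; rw [max_eq_left (hη0 x)]
  have hζ1 : ContDiff ℝ 1 ζ := by
    rw [hζe]; exact (contDiff_max_rpow hp).comp hη
  have hζd : ∀ x, HasFDerivAt ζ ((p * η x ^ (p - 1)) • fderiv ℝ η x) x := by
    intro x
    have h1 := (hasDerivAt_max_rpow hp (η x)).comp_hasFDerivAt x
      (hη.differentiable one_ne_zero x).hasFDerivAt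
    rw [max_eq_left (hη0 x)] at h1
    rw [hζe]; exact h1
  have hζ0 : ∀ x, 0 ≤ ζ x := fun x => Real.rpow_nonneg (hη0 x) _
  have hζle : ∀ x, ζ x ≤ 1 := fun x => Real.rpow_le_one (hη0 x) (hη1 x) hp0
  set ψ : EuclideanSpace ℝ (Fin n) → ℝ := fun x => ζ x * g (u x) with hψ
  have hψs : Function.support ψ ⊆ Function.support η := by
    intro x hx h0
    apply hx
    simp only [hψ, hζ, h0, Real.zero_rpow (by linarith : p ≠ 0), zero_mul]
  have hψts : tsupport ψ ⊆ Ω := (closure_mono hψs).trans hs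
  have hψc : HasCompactSupport ψ := hc.mono hψs
  have hψ1 : ContDiff ℝ 1 ψ := by
    rw [contDiff_iff_contDiffAt]
    intro x
    by_cases hx : x ∈ Ω
    · exact hζ1.contDiffAt.mul ((hg1 _ (hu.nonneg x)).comp x (hu.diffAt hΩo hx))
    · have : ψ =ᶠ[𝓝 x] fun _ => 0 :=
        notMem_tsupport_iff_eventuallyEq.1 fun h => hx (hψts h)
      exact contDiffAt_const.congr_of_eventuallyEq this
  have hψ0 : ∀ x, 0 ≤ ψ x := fun x => by
    have h0 := hu.nonneg x
    simp only [hψ, hgab _ h0]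
    exact mul_nonneg (hζ0 x) (mul_nonneg (ha0 _ h0) (hb0 _ h0))
  have hψd : ∀ x ∈ Ω, fderiv ℝ ψ x = ζ x • (-a (u x)) • fderiv ℝ u x +
      g (u x) • (p * η x ^ (p - 1)) • fderiv ℝ η x := by
    intro x hx
    have h1 := (hg _ (hu.nonneg x)).comp_hasFDerivAt x (hu.dAt hΩo hx)
    exact ((hζd x).mul h1).fderiv
  obtain ⟨hvi, hsup⟩ := hu.super hΩo hΩb hp hε hψ1 hψc hψts hψ0
  set θF : EuclideanSpace ℝ (Fin n) → ℝ :=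
    fun x => η x ^ p * a (u x) * Fe ε p (u x) ‖fderiv ℝ u x‖ with hθF
  set R : EuclideanSpace ℝ (Fin n) → ℝ := indicator {x | η x ≠ 0}
    (fun x => a (u x) * Fe ε p (u x + b (u x)) (p * L * b (u x))) with hR
  have hau : Continuous (fun x => a (u x)) := ha.comp_continuous hu.cont hu.nonneg
  have hbu : Continuous (fun x => b (u x)) := hb.comp_continuous hu.cont hu.nonneg
  have hR0 : ∀ x, 0 ≤ R x := fun x =>
    indicator_nonneg (fun x _ => mul_nonneg (ha0 _ (hu.nonneg x)) (Fe_nonneg hε)) x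
  have hθF0 : ∀ x, 0 ≤ θF x := fun x =>
    mul_nonneg (mul_nonneg (hζ0 x) (ha0 _ (hu.nonneg x))) (Fe_nonneg hε)
  have hθi : Integrable θF ((gaussianMeasure n).restrict Ω) := by
    apply hu.int.mono'
    · apply ContinuousOn.aestronglyMeasurable _ hΩo.measurableSet
      exact ((hζ1.continuous.mul hau).continuousOn).mul
        (Fe_continuousOn ε hp0 hu.cont.continuousOn (hu.fderiv_cont hΩo).norm)
    · refine Filter.Eventually.of_forall fun x => ?_
      rw [Real.norm_of_nonneg (hθF0 x)]
      exact mul_le_of_le_one_left (Fe_nonneg hε)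
        (mul_le_one₀ (hζle x) (ha0 _ (hu.nonneg x)) (ha1 _ (hu.nonneg x)))
  have hRb : ∃ K, ∀ x, a (u x) * Fe ε p (u x + b (u x)) (p * L * b (u x)) ≤ K := by
    have hsub : Icc 0 M ⊆ Ici (0:ℝ) := fun t ht => ht.1
    have hcont : ContinuousOn (fun t => a t * Fe ε p (t + b t) (p * L * b t)) (Icc 0 M) :=
      (ha.mono hsub).mul (Fe_continuousOn ε hp0 (continuousOn_id.add (hb.mono hsub))
        (continuousOn_const.mul (hb.mono hsub)))
    obtain ⟨K, hK⟩ := isCompact_Icc.exists_bound_of_continuousOn hcont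
    exact ⟨K, fun x => (le_abs_self _).trans (hK (u x) ⟨hu.nonneg x, hM x⟩)⟩
  obtain ⟨K, hK⟩ := hRb
  have hRi : ∀ μ : Measure (EuclideanSpace ℝ (Fin n)), IsFiniteMeasure μ → Integrable R μ := by
    intro μ _
    apply (integrable_const K).mono'
    · apply AEStronglyMeasurable.indicator
      · exact (hau.mul (Fe_continuous ε hp0 (hu.cont.add hbu)
          (continuous_const.mul hbu))).aestronglyMeasurable
      · exact (isOpen_ne_fun hη.continuous continuous_const).measurableSet
    · refine Filter.Eventually.of_forall fun x => ?_
      rw [Real.norm_of_nonneg (hR0 x)]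
      have hK0 : 0 ≤ K := (mul_nonneg (ha0 _ (hu.nonneg x)) (Fe_nonneg hε)).trans (hK x)
      exact indicator_le' (fun x _ => hK x) (fun _ _ => hK0) x
  have hpt : ∀ x ∈ Ω, Fe ε p (u x + ψ x) ‖fderiv ℝ u x + fderiv ℝ ψ x‖ ≤
      Fe ε p (u x) ‖fderiv ℝ u x‖ - θF x + R x := by
    intro x hx
    have h0 := hu.nonneg x
    set θ := ζ x * a (u x) with hθ
    have hθ0 : 0 ≤ θ := mul_nonneg (hζ0 x) (ha0 _ h0)
    have hθ1 : θ ≤ 1 := mul_le_one₀ (hζle x) (ha0 _ h0) (ha1 _ h0)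
    have e1 : u x + ψ x = (1 - θ) * u x + θ * (u x + b (u x)) := by
      simp only [hψ, hθ, hgab _ h0]; ring
    have hηpow : η x ^ (p - 1) = η x ^ p * (η x)⁻¹ := by
      rcases (hη0 x).eq_or_lt with h | h
      · rw [← h, Real.zero_rpow (by linarith), Real.zero_rpow (by linarith), zero_mul]
      · rw [Real.rpow_sub_one h.ne', div_eq_mul_inv]
    have e2 : ‖fderiv ℝ u x + fderiv ℝ ψ x‖ ≤
        (1 - θ) * ‖fderiv ℝ u x‖ + θ * (p * b (u x) * (η x)⁻¹ * ‖fderiv ℝ η x‖) := by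
      have : fderiv ℝ u x + fderiv ℝ ψ x = (1 - θ) • fderiv ℝ u x +
          (θ * (p * b (u x) * (η x)⁻¹)) • fderiv ℝ η x := by
        rw [hψd x hx, hgab _ h0, hηpow]
        simp only [hθ, hζ, smul_smul]
        module
      rw [this]
      refine (norm_add_le _ _).trans ?_
      rw [norm_smul, norm_smul, Real.norm_of_nonneg (by linarith), Real.norm_of_nonneg]
      · linarith
      · have := hb0 _ h0; have := hη0 x; positivity
    rw [e1]
    refine (Fe_convex hε hp.le hθ0 hθ1 (norm_nonneg _) e2).trans ?_
    have e3 : θ * Fe ε p (u x + b (u x)) (p * b (u x) * (η x)⁻¹ * ‖fderiv ℝ η x‖) ≤ R x := by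
      rcases (hη0 x).eq_or_lt with h | h
      · have : θ = 0 := by
          simp only [hθ, hζ, ← h, Real.zero_rpow (by linarith : p ≠ 0), zero_mul]
        rw [this, zero_mul]; exact hR0 x
      · have hRx : R x = a (u x) * Fe ε p (u x + b (u x)) (p * L * b (u x)) :=
          indicator_of_mem (by exact h.ne') _
        rw [hRx, hθ, mul_comm (ζ x), mul_assoc]
        apply mul_le_mul_of_nonneg_left _ (ha0 _ h0)
        simp only [hζ]
        rw [← Fe_smul hε (hη0 x)]
        have hb' := hb0 _ h0
        apply Fe_mono hε hp0
        · rw [abs_of_nonneg (by positivity), abs_of_nonneg (by positivity)]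
          exact mul_le_of_le_one_left (by positivity) (hη1 x)
        · positivity
        · have : η x * (p * b (u x) * (η x)⁻¹ * ‖fderiv ℝ η x‖) = p * b (u x) * ‖fderiv ℝ η x‖ := by
            field_simp
          rw [this]
          have := mul_le_mul_of_nonneg_left (hL x) (mul_nonneg hp0 hb')
          linarith
    have e4 : θF x = θ * Fe ε p (u x) ‖fderiv ℝ u x‖ := rfl
    rw [e4]; linarith
  have hmain : ∫ x in Ω, θF x ∂(gaussianMeasure n) ≤ ∫ x in Ω, R x ∂(gaussianMeasure n) := by
    have h1 : ∫ x in Ω, Fe ε p (u x + ψ x) ‖fderiv ℝ u x + fderiv ℝ ψ x‖ ∂(gaussianMeasure n) ≤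
        ∫ x in Ω, (Fe ε p (u x) ‖fderiv ℝ u x‖ - θF x + R x) ∂(gaussianMeasure n) :=
      setIntegral_mono_on hvi ((hu.int.sub hθi).add (hRi _ inferInstance)) hΩo.measurableSet hpt
    have hsub : Integrable (fun x => Fe ε p (u x) ‖fderiv ℝ u x‖ - θF x)
      ((gaussianMeasure n).restrict Ω) := hu.int.sub hθi
    rw [integral_add hsub (hRi _ inferInstance), integral_sub hu.int hθi] at h1
    linarith
  obtain ⟨t1, t2⟩ := integral_transfer hC1 hθF0 hθi
  obtain ⟨-, t4⟩ := integral_transfer hC2 hR0 (hRi _ inferInstance)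
  refine ⟨t1, hRi _ inferInstance, ?_⟩
  calc _ ≤ (C : ℝ) * ∫ x in Ω, θF x ∂(gaussianMeasure n) := t2
    _ ≤ C * (C * ∫ x in Ω, R x) := by
        gcongr
        exact hmain.trans t4
    _ = _ := by ring
end

open MeasureTheory Real Set Metric Bornology
open scoped RealInnerProductSpace Pointwise NNReal Topology
/-! part 5 -/
lemma sobolev_real (n : ℕ) (hn : 2 ≤ n) : ∃ S : ℝ, 0 < S ∧
    ∀ f : EuclideanSpace ℝ (Fin n) → ℝ, ContDiff ℝ 1 f → HasCompactSupport f →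
      Integrable (fun x => |f x| ^ ((n : ℝ) / (n - 1))) ∧
      ∫ x, |f x| ^ ((n : ℝ) / (n - 1)) ≤ S * (∫ x, ‖fderiv ℝ f x‖) ^ ((n : ℝ) / (n - 1)) := by
  have hn' : (2 : ℝ) ≤ n := by exact_mod_cast hn
  set q : ℝ := (n : ℝ) / (n - 1) with hq
  have hq0 : 0 < q := by apply div_pos <;> linarith
  have hconj : Real.HolderConjugate (Module.finrank ℝ (EuclideanSpace ℝ (Fin n))) q := by
    rw [finrank_euclideanSpace_fin, hq]
    exact Real.HolderConjugate.conjExponent (by linarith)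
  set S := lintegralPowLePowLIntegralFDerivConst
    (volume : Measure (EuclideanSpace ℝ (Fin n))) q
  refine ⟨S + 1, by positivity, fun f hf hc => ?_⟩
  have hdc : Continuous (fderiv ℝ f) := hf.continuous_fderiv one_ne_zero
  have h := lintegral_pow_le_pow_lintegral_fderiv
    (volume : Measure (EuclideanSpace ℝ (Fin n))) hf hc hconj
  have hfc : Continuous (fun x => |f x| ^ q) :=
    hf.continuous.abs.rpow_const fun _ => Or.inr hq0.le
  have hfs : HasCompactSupport (fun x => |f x| ^ q) := by
    apply hc.mono
    intro x hx h0
    apply hx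
    simp [h0, Real.zero_rpow hq0.ne']
  have i1 : Integrable (fun x => |f x| ^ q) := hfc.integrable_of_hasCompactSupport hfs
  have i2 : Integrable (fun x => ‖fderiv ℝ f x‖) :=
    hdc.norm.integrable_of_hasCompactSupport (hc.fderiv ℝ).norm
  refine ⟨i1, ?_⟩
  have e1 : ∫⁻ x, ‖f x‖ₑ ^ q = ENNReal.ofReal (∫ x, |f x| ^ q) := by
    rw [ofReal_integral_eq_lintegral_ofReal i1
      (Filter.Eventually.of_forall fun x => by positivity)]
    congr 1; ext x
    rw [← ENNReal.ofReal_rpow_of_nonneg (abs_nonneg _) hq0.le, Real.enorm_eq_ofReal_abs]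
  have e2 : ∫⁻ x, ‖fderiv ℝ f x‖ₑ = ENNReal.ofReal (∫ x, ‖fderiv ℝ f x‖) := by
    rw [ofReal_integral_eq_lintegral_ofReal i2
      (Filter.Eventually.of_forall fun x => by positivity)]
    congr 1; ext x
    rw [ofReal_norm]
  have hI : 0 ≤ ∫ x, ‖fderiv ℝ f x‖ := integral_nonneg fun x => norm_nonneg _
  rw [e1, e2, ENNReal.ofReal_rpow_of_nonneg hI hq0.le] at h
  have e3 : (S : ENNReal) = ENNReal.ofReal S := by simp
  change _ ≤ (S : ENNReal) * _ at h
  rw [e3, ← ENNReal.ofReal_mul (by positivity)] at h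
  have h' := (ENNReal.ofReal_le_ofReal_iff (by positivity)).1 h
  refine h'.trans ?_
  gcongr
  linarith

/-- Poincaré-type inequality on convex sets -/
lemma poincare_aux (n : ℕ) (D : Set (EuclideanSpace ℝ (Fin n))) (hDo : IsOpen D)
    (hDc : Convex ℝ D) (H : EuclideanSpace ℝ (Fin n) → ENNReal) (hH : Measurable H) (t : ℝ)
    (ht0 : 0 ≤ t) (ht1 : t ≤ 1 / 2) (y : EuclideanSpace ℝ (Fin n)) (hy : y ∈ D) :
    ∫⁻ x in D, H (x + t • (y - x)) ≤ 2 ^ n * ∫⁻ x in D, H x := by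
  have h1t : 0 < 1 - t := by linarith
  set F : EuclideanSpace ℝ (Fin n) → ENNReal := D.indicator H with hF
  have hFm : Measurable F := hH.indicator hDo.measurableSet
  calc ∫⁻ x in D, H (x + t • (y - x)) = ∫⁻ x in D, F ((1 - t) • x + t • y) := by
        apply setLIntegral_congr_fun hDo.measurableSet
        intro x hx
        have e : x + t • (y - x) = (1 - t) • x + t • y := by module
        simp only [e]
        rw [hF, indicator_of_mem]
        exact hDc hx hy h1t.le ht0 (by ring)
    _ ≤ ∫⁻ x, F ((1 - t) • x + t • y) := setLIntegral_le_lintegral _ _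
    _ = ENNReal.ofReal (|((1 - t) ^ n)⁻¹|) * ∫⁻ x, F x := by
        have h3 : ∫⁻ x, F ((1 - t) • x + t • y) = ∫⁻ x, F (x + t • y)
            ∂(Measure.map (fun x => (1 - t) • x) (volume : Measure (EuclideanSpace ℝ (Fin n)))) := by
          rw [lintegral_map (by fun_prop) (by fun_prop)]
        rw [h3, Measure.map_addHaar_smul _ h1t.ne', lintegral_smul_measure, finrank_euclideanSpace_fin,
          lintegral_add_right_eq_self (fun x => F x), smul_eq_mul]
    _ ≤ 2 ^ n * ∫⁻ x in D, H x := by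
        rw [hF, lintegral_indicator hDo.measurableSet]
        gcongr
        rw [abs_of_pos (by positivity)]
        have : ((1 - t) ^ n)⁻¹ ≤ 2 ^ n := by
          rw [← inv_pow]
          apply pow_le_pow_left₀ (by positivity)
          rw [inv_le_comm₀ h1t (by norm_num)]
          linarith
        calc ENNReal.ofReal ((1 - t) ^ n)⁻¹ ≤ ENNReal.ofReal (2 ^ n) := ENNReal.ofReal_le_ofReal this
          _ = 2 ^ n := by rw [ENNReal.ofReal_pow (by norm_num)]; norm_num

lemma poincare (n : ℕ) (D : Set (EuclideanSpace ℝ (Fin n))) (hDo : IsOpen D)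
    (hDc : Convex ℝ D) (d : ℝ≥0) (hd : ∀ x ∈ D, ∀ y ∈ D, ‖y - x‖ ≤ d)
    (w : EuclideanSpace ℝ (Fin n) → ℝ) (hw : ContDiffOn ℝ 1 w D) :
    ∫⁻ y in D, ∫⁻ x in D, ‖w (x + (1 / 2 : ℝ) • (y - x)) - w x‖ₑ ≤
      volume D * (d * (2 ^ n * ∫⁻ x in D, ‖fderiv ℝ w x‖ₑ)) := by
  have hm : Measurable (fderiv ℝ w) := measurable_fderiv ℝ w
  have hdc : ContinuousOn (fderiv ℝ w) D := hw.continuousOn_fderiv_of_isOpen hDo le_rfl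
  have key : ∀ y ∈ D, ∀ x ∈ D, ‖w (x + (1 / 2 : ℝ) • (y - x)) - w x‖ₑ ≤
      d * ∫⁻ t in Icc (0 : ℝ) (1 / 2), ‖fderiv ℝ w (x + t • (y - x))‖ₑ := by
    intro y hy x hx
    have hin : ∀ t ∈ Icc (0:ℝ) (1/2), x + t • (y - x) ∈ D := by
      intro t ht
      have e : x + t • (y - x) = (1 - t) • x + t • y := by module
      rw [e]
      exact hDc hx hy (by linarith [ht.2]) ht.1 (by ring)
    have hder : ∀ t ∈ Icc (0:ℝ) (1/2), HasDerivAt (fun t : ℝ => w (x + t • (y - x)))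
        (fderiv ℝ w (x + t • (y - x)) (y - x)) t := by
      intro t ht
      have h1 : HasFDerivAt w (fderiv ℝ w (x + t • (y - x))) (x + t • (y - x)) :=
        ((hw.contDiffAt (hDo.mem_nhds (hin t ht))).differentiableAt (by simp)).hasFDerivAt
      have h2 : HasDerivAt (fun t : ℝ => x + t • (y - x)) (y - x) t := by
        simpa using ((hasDerivAt_id t).smul_const (y - x)).const_add x
      exact h1.comp_hasDerivAt t h2
    have hcont : ContinuousOn (fun t : ℝ => fderiv ℝ w (x + t • (y - x)) (y - x)) (Icc 0 (1/2)) := by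
      have : ContinuousOn (fun t : ℝ => fderiv ℝ w (x + t • (y - x))) (Icc 0 (1/2)) :=
        hdc.comp (by fun_prop) hin
      exact this.clm_apply continuousOn_const
    have hu : uIcc (0:ℝ) (1/2) = Icc 0 (1/2) := uIcc_of_le (by norm_num)
    have hftc := intervalIntegral.integral_eq_sub_of_hasDerivAt (a := (0:ℝ)) (b := 1/2)
      (fun t ht => hder t (hu ▸ ht)) (ContinuousOn.intervalIntegrable (hu ▸ hcont))
    simp only [zero_smul, add_zero] at hftc
    rw [← hftc, intervalIntegral.integral_of_le (by norm_num)]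
    refine (enorm_integral_le_lintegral_enorm _).trans ?_
    refine (lintegral_mono_set Ioc_subset_Icc_self).trans ?_
    rw [← lintegral_const_mul' _ _ ENNReal.coe_ne_top]
    apply lintegral_mono
    intro t
    refine (ContinuousLinearMap.le_opENorm _ _).trans ?_
    rw [mul_comm]
    have hxy : ‖y - x‖ₑ ≤ (d : ENNReal) := by
      rw [enorm_le_coe]; exact_mod_cast hd x hx y hy
    exact mul_le_mul' hxy le_rfl
  have hH : Measurable (fun x => ‖fderiv ℝ w x‖ₑ) := hm.enorm
  have inner : ∀ y ∈ D, ∫⁻ x in D, ‖w (x + (1 / 2 : ℝ) • (y - x)) - w x‖ₑ ≤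
      d * (2 ^ n * ∫⁻ x in D, ‖fderiv ℝ w x‖ₑ) := by
    intro y hy
    calc ∫⁻ x in D, ‖w (x + (1 / 2 : ℝ) • (y - x)) - w x‖ₑ
        ≤ ∫⁻ x in D, d * ∫⁻ t in Icc (0 : ℝ) (1 / 2), ‖fderiv ℝ w (x + t • (y - x))‖ₑ :=
          setLIntegral_mono' hDo.measurableSet (key y hy)
      _ = d * ∫⁻ x in D, ∫⁻ t in Icc (0 : ℝ) (1 / 2), ‖fderiv ℝ w (x + t • (y - x))‖ₑ :=
          lintegral_const_mul' _ _ ENNReal.coe_ne_top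
      _ = d * ∫⁻ t in Icc (0 : ℝ) (1 / 2), ∫⁻ x in D, ‖fderiv ℝ w (x + t • (y - x))‖ₑ := by
          congr 1
          apply lintegral_lintegral_swap
          apply Measurable.aemeasurable
          exact hH.comp (by fun_prop : Measurable
            (fun z : EuclideanSpace ℝ (Fin n) × ℝ => z.1 + z.2 • (y - z.1)))
      _ ≤ d * ∫⁻ t in Icc (0 : ℝ) (1 / 2), 2 ^ n * ∫⁻ x in D, ‖fderiv ℝ w x‖ₑ := by
          gcongr 1
          exact setLIntegral_mono' measurableSet_Icc fun t ht =>
            poincare_aux n D hDo hDc _ hH t ht.1 ht.2 y hy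
      _ ≤ d * (2 ^ n * ∫⁻ x in D, ‖fderiv ℝ w x‖ₑ) := by
          gcongr 1
          rw [setLIntegral_const]
          apply mul_le_of_le_one_right zero_le
          rw [Real.volume_Icc]
          norm_num
  calc _ ≤ ∫⁻ y in D, d * (2 ^ n * ∫⁻ x in D, ‖fderiv ℝ w x‖ₑ) :=
        setLIntegral_mono' hDo.measurableSet inner
    _ = _ := by rw [setLIntegral_const, mul_comm]

/-- consequence for level sets -/
lemma poincare_levels (n : ℕ) (D : Set (EuclideanSpace ℝ (Fin n))) (hDo : IsOpen D)
    (hDc : Convex ℝ D) (d : ℝ≥0) (hd : ∀ x ∈ D, ∀ y ∈ D, ‖y - x‖ ≤ d)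
    (w : EuclideanSpace ℝ (Fin n) → ℝ) (hw : ContDiffOn ℝ 1 w D) (hwm : Measurable w)
    (A B : Set (EuclideanSpace ℝ (Fin n))) (hA : MeasurableSet A) (hB : MeasurableSet B)
    (hAD : A ⊆ D) (hBD : B ⊆ D) (m : ℝ≥0) (hm : ∀ x ∈ A, ∀ y ∈ B, m ≤ w x - w y) :
    m * volume A * volume B ≤ 2 * (volume D * (d * (2 ^ n * ∫⁻ x in D, ‖fderiv ℝ w x‖ₑ))) := by
  have h := poincare n D hDo hDc d hd w hw
  set P := fun (y x : EuclideanSpace ℝ (Fin n)) => ‖w (x + (1 / 2 : ℝ) • (y - x)) - w x‖ₑ with hP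
  have hPm : Measurable (Function.uncurry P) := by
    have h1 : Measurable (fun z : EuclideanSpace ℝ (Fin n) × EuclideanSpace ℝ (Fin n) =>
      w (z.2 + (1 / 2 : ℝ) • (z.1 - z.2))) := hwm.comp (by fun_prop)
    exact (h1.sub (hwm.comp measurable_snd)).enorm
  have hsymm : ∫⁻ y in D, ∫⁻ x in D, P x y = ∫⁻ y in D, ∫⁻ x in D, P y x :=
    lintegral_lintegral_swap (hPm.comp measurable_swap).aemeasurable
  have hsum : ∫⁻ y in D, ∫⁻ x in D, (P y x + P x y) =
      (∫⁻ y in D, ∫⁻ x in D, P y x) + ∫⁻ y in D, ∫⁻ x in D, P x y := by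
    rw [← lintegral_add_left (hPm.lintegral_prod_right (ν := volume.restrict D))]
    congr 1; ext y
    have hy : Measurable (P y) := hPm.of_uncurry_left
    rw [lintegral_add_left hy]
  have hlow : ∀ x ∈ A, ∀ y ∈ B, (m : ENNReal) ≤ P y x + P x y := by
    intro x hx y hy
    have e : y + (1 / 2 : ℝ) • (x - y) = x + (1 / 2 : ℝ) • (y - x) := by module
    simp only [hP, e]
    have h1 : (m : ENNReal) ≤ ‖w x - w y‖ₑ := by
      rw [Real.enorm_eq_ofReal_abs, ← ENNReal.ofReal_coe_nnreal]
      exact ENNReal.ofReal_le_ofReal ((hm x hx y hy).trans (le_abs_self _))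
    refine h1.trans ?_
    set z := w (x + (1 / 2 : ℝ) • (y - x))
    have e2 : w x - w y = -(z - w x) + (z - w y) := by ring
    rw [e2]
    refine (enorm_add_le _ _).trans ?_
    rw [enorm_neg]
  calc (m : ENNReal) * volume A * volume B = ∫⁻ y in B, ∫⁻ x in A, (m : ENNReal) := by
        rw [setLIntegral_const, setLIntegral_const]
    _ ≤ ∫⁻ y in B, ∫⁻ x in A, (P y x + P x y) :=
        setLIntegral_mono' hB fun y hy => setLIntegral_mono' hA fun x hx => hlow x hx y hy
    _ ≤ ∫⁻ y in D, ∫⁻ x in D, (P y x + P x y) :=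
        (lintegral_mono_set hBD).trans (lintegral_mono fun y => lintegral_mono_set hAD)
    _ ≤ _ := by
        rw [hsum, hsymm, two_mul]
        exact add_le_add h h

open MeasureTheory Real Set Metric Bornology
open scoped RealInnerProductSpace Pointwise NNReal Topology
/-! part 6 -/
lemma fast_geom (q N B : ℝ) (hq : 1 < q) (hN : 0 < N) (hB : 1 < B) : ∃ ν : ℝ, 0 < ν ∧
    ∀ Y : ℕ → ℝ, (∀ j, 0 ≤ Y j) → Y 0 ≤ ν → (∀ j, Y (j + 1) ≤ N * B ^ j * (Y j) ^ q) →
      Filter.Tendsto Y Filter.atTop (𝓝 0) := by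
  have hq' : 0 < q - 1 := by linarith
  set r : ℝ := (B⁻¹) ^ (1 / (q - 1)) with hr
  have hB0 : 0 < B := by linarith
  have hr0 : 0 < r := by positivity
  have hr1 : r < 1 := by
    apply Real.rpow_lt_one (by positivity) (inv_lt_one_of_one_lt₀ hB) (by positivity)
  have hrq : r ^ (q - 1) = B⁻¹ := by
    rw [hr, ← Real.rpow_mul (by positivity), one_div, inv_mul_cancel₀ hq'.ne', Real.rpow_one]
  set ν : ℝ := (r / N) ^ (1 / (q - 1)) with hν
  have hν0 : 0 < ν := by positivity
  have hνq : ν ^ (q - 1) = r / N := by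
    rw [hν, ← Real.rpow_mul (by positivity), one_div, inv_mul_cancel₀ hq'.ne', Real.rpow_one]
  refine ⟨ν, hν0, fun Y h0 hY hrec => ?_⟩
  have hb : ∀ j, Y j ≤ ν * r ^ j := by
    intro j
    induction j with
    | zero => simpa using hY
    | succ j ih =>
      have e1 : ∀ x : ℝ, 0 < x → x ^ q = x * x ^ (q - 1) := by
        intro x hx
        rw [← Real.rpow_one_add' hx.le (by linarith)]; congr 1; ring
      have e2 : (r ^ j) ^ (q - 1) = (B⁻¹) ^ j := by
        rw [← hrq, ← Real.rpow_natCast, ← Real.rpow_natCast, ← Real.rpow_mul hr0.le,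
          ← Real.rpow_mul hr0.le, mul_comm]
      calc Y (j + 1) ≤ N * B ^ j * (Y j) ^ q := hrec j
        _ ≤ N * B ^ j * (ν * r ^ j) ^ q := by
            gcongr
            exact h0 j
        _ = ν * r ^ (j + 1) := by
            rw [Real.mul_rpow hν0.le (by positivity), e1 ν hν0, e1 (r ^ j) (by positivity), e2, hνq,
              inv_pow]
            field_simp
            ring
  refine squeeze_zero h0 hb ?_
  simpa using (tendsto_pow_atTop_nhds_zero_of_lt_one hr0.le hr1).const_mul ν

lemma ball_cutoff (n : ℕ) (x0 : EuclideanSpace ℝ (Fin n)) (ρ : ℝ) (hρ : 0 < ρ) :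
    ∃ η : EuclideanSpace ℝ (Fin n) → ℝ, ContDiff ℝ 1 η ∧ HasCompactSupport η ∧
      tsupport η ⊆ closedBall x0 ρ ∧ (∀ x, 0 ≤ η x) ∧ (∀ x, η x ≤ 1) ∧
      (∀ x, ‖fderiv ℝ η x‖ ≤ 4 / ρ) ∧ (∀ x, x ∉ ball x0 ρ → η x = 0 ∧ fderiv ℝ η x = 0) ∧
      (∀ σ : ℝ, 0 ≤ σ → ∀ x, ‖x - x0‖ ≤ (1 - σ) * ρ → σ ^ 2 ≤ η x) := by
  set N : EuclideanSpace ℝ (Fin n) → ℝ := fun x => 1 - ‖x - x0‖ ^ 2 / ρ ^ 2 with hN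
  have hNs : ContDiff ℝ 1 N := by
    have : ContDiff ℝ 1 (fun x : EuclideanSpace ℝ (Fin n) => ‖x - x0‖ ^ 2) :=
      (contDiff_id.sub contDiff_const).norm_sq ℝ
    exact contDiff_const.sub (this.div_const _)
  set η : EuclideanSpace ℝ (Fin n) → ℝ := fun x => (max (N x) 0) ^ (2 : ℝ) with hη
  have hη1 : ContDiff ℝ 1 η := (contDiff_max_rpow (by norm_num : (1:ℝ) < 2)).comp hNs
  have hNout : ∀ x, x ∉ ball x0 ρ → N x ≤ 0 := by
    intro x hx
    rw [mem_ball, not_lt, dist_eq_norm] at hx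
    have : 1 ≤ ‖x - x0‖ ^ 2 / ρ ^ 2 := by
      rw [one_le_div (by positivity)]; gcongr
    simp only [hN]; linarith
  have hNder : ∀ x, HasFDerivAt N (-((ρ ^ 2)⁻¹ • (2 • (innerSL ℝ (x - x0))))) x := by
    intro x
    have h1 : HasFDerivAt (fun x : EuclideanSpace ℝ (Fin n) => x - x0)
      (ContinuousLinearMap.id ℝ _) x := (hasFDerivAt_id x).sub_const x0
    have h2 := h1.norm_sq
    have h3 := (h2.const_mul ((ρ ^ 2)⁻¹)).const_sub 1
    have e : N = fun x => 1 - (ρ ^ 2)⁻¹ * ‖x - x0‖ ^ 2 := by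
      ext x; simp only [hN]; ring
    rw [e]
    refine h3.congr_fderiv ?_
    ext v; simp
  have hder : ∀ x, fderiv ℝ η x = (2 * max (N x) 0) • (-((ρ ^ 2)⁻¹ • (2 • (innerSL ℝ (x - x0))))) := by
    intro x
    have h := (hasDerivAt_max_rpow (by norm_num : (1:ℝ) < 2) (N x)).comp_hasFDerivAt x (hNder x)
    have h' := h.fderiv
    change fderiv ℝ η x = _ at h'
    rw [h']
    norm_num
  have hNle : ∀ x, N x ≤ 1 := by
    intro x; simp only [hN]
    have : 0 ≤ ‖x - x0‖ ^ 2 / ρ ^ 2 := by positivity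
    linarith
  have hts : tsupport η ⊆ closedBall x0 ρ := by
    apply closure_minimal _ isClosed_closedBall
    intro x hx
    by_contra h
    apply hx
    have : N x ≤ 0 := hNout x fun h' => h (ball_subset_closedBall h')
    simp [hη, max_eq_right this]
  refine ⟨η, hη1, HasCompactSupport.of_support_subset_isCompact (isCompact_closedBall x0 ρ)
    (subset_closure.trans hts), hts, fun x => by positivity, ?_, ?_, ?_, ?_⟩
  · intro x
    exact Real.rpow_le_one (le_max_right _ _) (max_le (hNle x) zero_le_one) (by norm_num)
  · intro x
    rw [hder, norm_smul, norm_neg, norm_smul, ← Nat.cast_smul_eq_nsmul ℝ, norm_smul, innerSL_apply_norm]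
    by_cases hx : x ∈ ball x0 ρ
    · rw [mem_ball, dist_eq_norm] at hx
      have h1 : ‖2 * max (N x) 0‖ ≤ 2 := by
        rw [Real.norm_of_nonneg (by positivity)]
        linarith [max_le (hNle x) zero_le_one]
      calc _ ≤ 2 * (‖(ρ ^ 2)⁻¹‖ * (‖((2:ℕ):ℝ)‖ * ρ)) := by gcongr
        _ = 4 / ρ := by
          rw [Real.norm_of_nonneg (by positivity), Real.norm_of_nonneg (by positivity)]
          push_cast; field_simp; norm_num
    · rw [max_eq_right (hNout x hx)]
      simp; positivity
  · intro x hx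
    have := hNout x hx
    refine ⟨by simp [hη, max_eq_right this], ?_⟩
    rw [hder, max_eq_right this]; simp
  · intro σ hσ x hx
    have h1 : σ ≤ N x := by
      have hs : σ ≤ 1 := by
        by_contra hc
        have : (1 - σ) * ρ < 0 := mul_neg_of_neg_of_pos (by linarith) hρ
        linarith [norm_nonneg (x - x0)]
      have : ‖x - x0‖ ^ 2 / ρ ^ 2 ≤ (1 - σ) ^ 2 := by
        rw [div_le_iff₀ (by positivity), ← mul_pow]; gcongr
      simp only [hN]; nlinarith
    have e : η x = (max (N x) 0) ^ 2 := by simp [hη]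
    rw [e]
    have := h1.trans (le_max_left _ 0)
    gcongr

open MeasureTheory Real Set Metric Bornology
open scoped RealInnerProductSpace Pointwise NNReal Topology
/-! part 7 -/
lemma le_one_add_rpow {x p : ℝ} (hx : 0 ≤ x) (hp : 1 < p) : x ≤ 1 + x ^ p := by
  rcases le_total x 1 with h | h
  · have : 0 ≤ x ^ p := by positivity
    linarith
  · have := Real.self_le_rpow_of_one_le h hp.le
    linarith

section
variable {n : ℕ} {p ε : ℝ} {Ω : Set (EuclideanSpace ℝ (Fin n))} {u : EuclideanSpace ℝ (Fin n) → ℝ}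

lemma Good.level_energy (hu : Good n p ε Ω u) (hΩo : IsOpen Ω) (hΩb : IsBounded Ω) (hp : 1 < p)
    (hε : 0 ≤ ε) (hε1 : ε ≤ 1) {C : ℝ≥0}
    (hC1 : (volume : Measure (EuclideanSpace ℝ (Fin n))).restrict Ω ≤
      C • (gaussianMeasure n).restrict Ω)
    (hC2 : (gaussianMeasure n).restrict Ω ≤
      C • (volume : Measure (EuclideanSpace ℝ (Fin n))).restrict Ω)
    [IsFiniteMeasure ((gaussianMeasure n).restrict Ω)]
    [IsFiniteMeasure ((volume : Measure (EuclideanSpace ℝ (Fin n))).restrict Ω)]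
    {η : EuclideanSpace ℝ (Fin n) → ℝ} (hη : ContDiff ℝ 1 η) (hc : HasCompactSupport η)
    (hs : tsupport η ⊆ Ω) (hη0 : ∀ x, 0 ≤ η x) (hη1 : ∀ x, η x ≤ 1) {L : ℝ}
    (hL : ∀ x, ‖fderiv ℝ η x‖ ≤ L) {k : ℝ} (hk : 0 < k)
    {E : Set (EuclideanSpace ℝ (Fin n))} (hE : MeasurableSet E) (hEΩ : E ⊆ Ω)
    (hEη : ∀ x, x ∉ E → η x = 0) :
    Integrable (fun x => η x ^ p * (max (k - u x) 0 / k) ^ p * Fe ε p (u x) ‖fderiv ℝ u x‖)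
      ((volume : Measure (EuclideanSpace ℝ (Fin n))).restrict Ω) ∧
    ∫ x in Ω, η x ^ p * (max (k - u x) 0 / k) ^ p * Fe ε p (u x) ‖fderiv ℝ u x‖ ≤
      C ^ 2 * (k ^ p * Fe 1 p 1 (p * L) * (volume : Measure (EuclideanSpace ℝ (Fin n))).real
        (E ∩ {x | u x < k})) := by
  have hL0 : 0 ≤ L := (norm_nonneg _).trans (hL 0)
  have hp0 : 0 < p := by linarith
  set c : ℝ := 1 / ((p + 1) * k ^ p) with hcdef
  have hkp : 0 < k ^ p := by positivity
  set A : Set (EuclideanSpace ℝ (Fin n)) := E ∩ {x | u x < k} with hA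
  have hAm : MeasurableSet A := hE.inter (hu.cont.measurable measurableSet_Iio)
  have hcont : Continuous (fun t : ℝ => max (k - t) 0) := by fun_prop
  obtain ⟨i1, i2, h⟩ := hu.cacc hΩo hΩb hp hε hC1 hC2 hη hc hs hη0 hη1 hL
    (g := fun t => c * (max (k - t) 0) ^ (p + 1)) (a := fun t => (max (k - t) 0 / k) ^ p)
    (b := fun t => max (k - t) 0 / (p + 1))
    (by
      intro t ht
      have h1 := (hasDerivAt_max_rpow (by linarith : 1 < p + 1) (k - t)).comp t
        ((hasDerivAt_id t).const_sub k)
      have h2 := h1.const_mul c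
      refine h2.congr_deriv ?_
      simp only [add_sub_cancel_right]
      rw [Real.div_rpow (le_max_right _ _) hk.le, hcdef]
      field_simp)
    (by
      intro t ht
      have h1 : ContDiff ℝ 1 (fun t : ℝ => (max (k - t) 0) ^ (p + 1)) :=
        (contDiff_max_rpow (by linarith : 1 < p + 1)).comp (contDiff_const.sub contDiff_id)
      exact (contDiff_const.mul h1).contDiffAt)
    (((hcont.div_const k).rpow_const fun _ => Or.inr hp0.le).continuousOn)
    ((hcont.div_const _).continuousOn)
    (fun t ht => by positivity)
    (fun t ht => by
      apply Real.rpow_le_one (by positivity) _ hp0.le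
      rw [div_le_one hk]
      exact max_le (by linarith) hk.le)
    (fun t ht => by positivity)
    (fun t ht => by
      rw [Real.div_rpow (le_max_right _ _) hk.le, hcdef,
        Real.rpow_add_one' (le_max_right _ _) (by linarith)]
      field_simp)
  refine ⟨i1, h.trans ?_⟩
  gcongr
  have hb : ∀ x, indicator {x | η x ≠ 0} (fun x => (max (k - u x) 0 / k) ^ p *
      Fe ε p (u x + max (k - u x) 0 / (p + 1)) (p * L * (max (k - u x) 0 / (p + 1)))) x ≤
      A.indicator (fun _ => k ^ p * Fe 1 p 1 (p * L)) x := by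
    intro x
    have hu0 := hu.nonneg x
    by_cases hx : x ∈ A
    · rw [indicator_of_mem hx]
      have hxk : u x < k := hx.2
      have hT : max (k - u x) 0 = k - u x := max_eq_left (by linarith)
      have hTp : (k - u x) / (p + 1) ≤ k - u x := div_le_self (by linarith) (by linarith)
      have hTp0 : 0 ≤ (k - u x) / (p + 1) := div_nonneg (by linarith) (by linarith)
      have h0 : 0 ≤ k ^ p * Fe 1 p 1 (p * L) := mul_nonneg hkp.le (Fe_nonneg zero_le_one)
      rw [indicator_apply]
      split_ifs with hx'
      · rw [hT]
        have q1 : ((k - u x) / k) ^ p ≤ 1 := by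
          apply Real.rpow_le_one (div_nonneg (by linarith) hk.le) _ hp0.le
          rw [div_le_one hk]; linarith
        have q2 : Fe ε p (u x + (k - u x) / (p + 1)) (p * L * ((k - u x) / (p + 1))) ≤
            Fe 1 p (k * 1) (k * (p * L)) := by
          refine (Fe_mono_eps hε hp0.le hε1).trans (Fe_mono zero_le_one hp0.le ?_ (by positivity) ?_)
          · rw [abs_of_nonneg (by linarith), abs_of_nonneg (by linarith)]
            linarith
          · rw [mul_comm k]
            gcongr
            linarith
        rw [Fe_smul zero_le_one hk.le] at q2
        calc _ ≤ 1 * (k ^ p * Fe 1 p 1 (p * L)) :=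
              mul_le_mul q1 q2 (Fe_nonneg hε) zero_le_one
          _ = _ := one_mul _
      · exact h0
    · rw [indicator_of_notMem hx]
      by_cases hx2 : x ∈ E
      · have : k ≤ u x := by
          by_contra hc
          exact hx ⟨hx2, not_le.1 hc⟩
        have hT : max (k - u x) 0 = 0 := max_eq_right (by linarith)
        simp [indicator_apply, hT, Real.zero_rpow hp0.ne']
      · rw [indicator_of_notMem]
        simp [hEη x hx2]
  calc _ ≤ ∫ x in Ω, A.indicator (fun _ => k ^ p * Fe 1 p 1 (p * L)) x :=
        integral_mono i2 ((integrable_const _).indicator hAm) hb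
    _ = _ := by
        rw [integral_indicator hAm, Measure.restrict_restrict hAm,
          inter_eq_self_of_subset_left (inter_subset_left.trans hEΩ), setIntegral_const, smul_eq_mul,
          mul_comm]

lemma Good.level_step (hn : 2 ≤ n) (hu : Good n p ε Ω u) (hΩo : IsOpen Ω) (hΩb : IsBounded Ω)
    (hp : 1 < p)
    (hε : 0 ≤ ε) (hε1 : ε ≤ 1) {C : ℝ≥0}
    (hC1 : (volume : Measure (EuclideanSpace ℝ (Fin n))).restrict Ω ≤
      C • (gaussianMeasure n).restrict Ω)
    (hC2 : (gaussianMeasure n).restrict Ω ≤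
      C • (volume : Measure (EuclideanSpace ℝ (Fin n))).restrict Ω)
    [IsFiniteMeasure ((gaussianMeasure n).restrict Ω)]
    [IsFiniteMeasure ((volume : Measure (EuclideanSpace ℝ (Fin n))).restrict Ω)]
    {S : ℝ} (hS0 : 0 < S) (hS : ∀ f : EuclideanSpace ℝ (Fin n) → ℝ, ContDiff ℝ 1 f →
      HasCompactSupport f →
      Integrable (fun x => |f x| ^ ((n : ℝ) / (n - 1))) ∧
      ∫ x, |f x| ^ ((n : ℝ) / (n - 1)) ≤ S * (∫ x, ‖fderiv ℝ f x‖) ^ ((n : ℝ) / (n - 1)))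
    {k h ρ ρ' σ L : ℝ} (hk : 0 < k) (hρ : 0 < ρ) (hσ : 0 < σ) (hh : h ≤ (1 - σ) * k)
    (hρ' : ρ' ≤ (1 - σ) * ρ) (hL : 4 / ρ ≤ L) {x0 : EuclideanSpace ℝ (Fin n)}
    (hball : closedBall x0 ρ ⊆ Ω) :
    (σ ^ 4) ^ ((n : ℝ) / (n - 1)) * (volume : Measure (EuclideanSpace ℝ (Fin n))).real
        (ball x0 ρ' ∩ {x | u x < h}) ≤
      S * ((L + 2 + 2 * (C ^ 2 * Fe 1 p 1 (p * L))) *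
        (volume : Measure (EuclideanSpace ℝ (Fin n))).real
        (ball x0 ρ ∩ {x | u x < k})) ^ ((n : ℝ) / (n - 1)) := by
  have hn' : (2 : ℝ) ≤ n := by exact_mod_cast hn
  set q : ℝ := (n : ℝ) / (n - 1) with hq
  have hq0 : 0 < q := by apply div_pos <;> linarith
  have hp0 : 0 < p := by linarith
  have hkp : 0 < k ^ p := by positivity
  obtain ⟨η, hη, hηc, hηs, hη0, hη1, hηL, hηout, hηlow⟩ := ball_cutoff n x0 ρ hρ
  have hηL' : ∀ x, ‖fderiv ℝ η x‖ ≤ L := fun x => (hηL x).trans hL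
  have hL0 : 0 ≤ L := (norm_nonneg _).trans (hηL' 0)
  have hbΩ : ball x0 ρ ⊆ Ω := ball_subset_closedBall.trans hball
  obtain ⟨i1, hen⟩ := hu.level_energy hΩo hΩb hp hε hε1 hC1 hC2 hη hηc (hηs.trans hball) hη0 hη1
    hηL' hk measurableSet_ball hbΩ (fun x hx => (hηout x hx).1)
  set A : Set (EuclideanSpace ℝ (Fin n)) := ball x0 ρ ∩ {x | u x < k} with hA
  have hAm : MeasurableSet A := measurableSet_ball.inter (hu.cont.measurable measurableSet_Iio)
  have hAΩ : A ⊆ Ω := inter_subset_left.trans hbΩ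
  set V : ℝ := (volume : Measure (EuclideanSpace ℝ (Fin n))).real A with hV
  set T : EuclideanSpace ℝ (Fin n) → ℝ := fun x => max (k - u x) 0 with hT
  have hT0 : ∀ x, 0 ≤ T x := fun x => le_max_right _ _
  have hTk : ∀ x, T x ≤ k := fun x => max_le (by linarith [hu.nonneg x]) hk.le
  set W : EuclideanSpace ℝ (Fin n) → ℝ := fun x => (T x) ^ (2 : ℝ) / k ^ 2 with hW
  set f : EuclideanSpace ℝ (Fin n) → ℝ := fun x => η x * W x with hf
  have hTd : ContDiff ℝ 1 (fun t : ℝ => (max (k - t) 0) ^ (2 : ℝ)) :=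
    (contDiff_max_rpow (by norm_num : (1:ℝ) < 2)).comp (contDiff_const.sub contDiff_id)
  have hWd : ∀ x ∈ Ω, ContDiffAt ℝ 1 W x := by
    intro x hx
    exact (hTd.contDiffAt.comp x (hu.diffAt hΩo hx)).div_const _
  have hfout : ∀ x, x ∉ tsupport η → f =ᶠ[𝓝 x] fun _ => 0 := by
    intro x hx
    have := notMem_tsupport_iff_eventuallyEq.1 hx
    filter_upwards [this] with y hy
    simp [hf, hy]
  have hfd : ContDiff ℝ 1 f := by
    rw [contDiff_iff_contDiffAt]
    intro x
    by_cases hx : x ∈ tsupport η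
    · exact hη.contDiffAt.mul (hWd x (hball (hηs hx)))
    · exact contDiffAt_const.congr_of_eventuallyEq (hfout x hx)
  have hfc : HasCompactSupport f := hηc.mul_right
  obtain ⟨if1, hsob⟩ := hS f hfd hfc
  have hWder : ∀ x ∈ Ω, HasFDerivAt W (((k ^ 2)⁻¹ * (2 * T x * (-1))) • fderiv ℝ u x) x := by
    intro x hx
    have h1 := (hasDerivAt_max_rpow (by norm_num : (1:ℝ) < 2) (k - u x)).comp_hasFDerivAt x
      ((hu.dAt hΩo hx).const_sub k)
    have h2 := h1.const_mul ((k ^ 2)⁻¹)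
    have e : W = fun x => (k ^ 2)⁻¹ * (max (k - u x) 0) ^ (2 : ℝ) := by
      ext x; simp only [hW, hT]; ring
    rw [e]
    refine h2.congr_fderiv ?_
    ext v
    simp only [hT]
    norm_num
    ring
  have hW1 : ∀ x, W x ≤ 1 := by
    intro x
    simp only [hW]
    rw [div_le_one (by positivity)]
    have := hT0 x
    have := hTk x
    norm_num
    gcongr
  have hW0 : ∀ x, 0 ≤ W x := fun x => by
    have := hT0 x
    simp only [hW]; positivity
  have hgrad : ∀ x ∈ Ω, ‖fderiv ℝ f x‖ ≤ A.indicator (fun _ => L + 2) x +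
      2 * (k ^ p)⁻¹ * (η x ^ p * (T x / k) ^ p * Fe ε p (u x) ‖fderiv ℝ u x‖) := by
    intro x hx
    have hd : HasFDerivAt f _ x :=
      ((hη.differentiable (by simp) x).hasFDerivAt).mul (hWder x hx)
    rw [hd.fderiv]
    have hFe := Fe_nonneg (ε := ε) (p := p) (s := u x) (r := ‖fderiv ℝ u x‖) hε
    have hT0x := hT0 x
    have hη0x := hη0 x
    by_cases hxA : x ∈ A
    · rw [indicator_of_mem hxA]
      refine (norm_add_le _ _).trans ?_
      rw [norm_smul, norm_smul, norm_smul]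
      set r := ‖fderiv ℝ u x‖ with hr
      have hr0 : 0 ≤ r := norm_nonneg _
      have e1 : ‖η x‖ = η x := Real.norm_of_nonneg hη0x
      have e2 : ‖W x‖ = W x := Real.norm_of_nonneg (hW0 x)
      have e3 : ‖(k ^ 2)⁻¹ * (2 * T x * (-1))‖ = (k ^ 2)⁻¹ * (2 * T x) := by
        rw [show (k ^ 2)⁻¹ * (2 * T x * (-1)) = -((k ^ 2)⁻¹ * (2 * T x)) by ring, norm_neg,
          Real.norm_of_nonneg (by positivity)]
      rw [e1, e2, e3]
      have y1 := le_one_add_rpow (x := η x * (T x / k) * (r / k)) (by positivity) hp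
      rw [Real.mul_rpow (by positivity) (by positivity), Real.mul_rpow (by positivity) (by positivity),
        Real.div_rpow hr0 hk.le] at y1
      have y2 : r ^ p ≤ Fe ε p (u x) r := rpow_le_Fe hε hp0.le hr0
      have y3 : η x ^ p * (T x / k) ^ p * (r ^ p / k ^ p) ≤
          (k ^ p)⁻¹ * (η x ^ p * (T x / k) ^ p * Fe ε p (u x) r) := by
        rw [show η x ^ p * (T x / k) ^ p * (r ^ p / k ^ p) =
          (k ^ p)⁻¹ * (η x ^ p * (T x / k) ^ p * r ^ p) by ring]
        gcongr
      have y4 : W x * ‖fderiv ℝ η x‖ ≤ 1 * L :=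
        mul_le_mul (hW1 x) (hηL' x) (norm_nonneg _) zero_le_one
      have y5 : η x * ((k ^ 2)⁻¹ * (2 * T x) * r) = 2 * (η x * (T x / k) * (r / k)) := by
        field_simp
      rw [y5]
      linarith
    · rw [indicator_of_notMem hxA, zero_add]
      have hz : η x • ((k ^ 2)⁻¹ * (2 * T x * (-1))) • fderiv ℝ u x + W x • fderiv ℝ η x = 0 := by
        by_cases hxb : x ∈ ball x0 ρ
        · have hku : k ≤ u x := by
            by_contra hc
            exact hxA ⟨hxb, not_le.1 hc⟩
          have hTx : T x = 0 := max_eq_right (by linarith)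
          have hWx : W x = 0 := by simp [hW, hTx]
          simp [hTx, hWx]
        · simp [(hηout x hxb).1, (hηout x hxb).2]
      rw [hz, norm_zero]
      positivity
  have hint : ∫ x, ‖fderiv ℝ f x‖ ≤ (L + 2 + 2 * (C ^ 2 * Fe 1 p 1 (p * L))) * V := by
    have e0 : ∫ x, ‖fderiv ℝ f x‖ = ∫ x in Ω, ‖fderiv ℝ f x‖ := by
      symm
      apply setIntegral_eq_integral_of_forall_compl_eq_zero
      intro x hx
      have : x ∉ tsupport η := fun h' => hx (hball (hηs h'))
      rw [(hfout x this).fderiv_eq]; simp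
    rw [e0]
    have j1 : Integrable (A.indicator (fun _ => L + 2))
        ((volume : Measure (EuclideanSpace ℝ (Fin n))).restrict Ω) :=
      (integrable_const _).indicator hAm
    have j0 : Integrable (fun x => ‖fderiv ℝ f x‖)
        ((volume : Measure (EuclideanSpace ℝ (Fin n))).restrict Ω) :=
      ((hfd.continuous_fderiv one_ne_zero).norm.integrable_of_hasCompactSupport
        (hfc.fderiv ℝ).norm).restrict
    calc ∫ x in Ω, ‖fderiv ℝ f x‖ ≤ ∫ x in Ω, (A.indicator (fun _ => L + 2) x +
      2 * (k ^ p)⁻¹ * (η x ^ p * (T x / k) ^ p * Fe ε p (u x) ‖fderiv ℝ u x‖)) :=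
          setIntegral_mono_on j0 (j1.add (i1.const_mul _)) hΩo.measurableSet hgrad
      _ = (L + 2) * V + 2 * (k ^ p)⁻¹ *
          ∫ x in Ω, (η x ^ p * (T x / k) ^ p * Fe ε p (u x) ‖fderiv ℝ u x‖) := by
          rw [integral_add j1 (i1.const_mul _), integral_const_mul]
          congr 1
          rw [integral_indicator hAm, Measure.restrict_restrict hAm,
            inter_eq_self_of_subset_left hAΩ, setIntegral_const, smul_eq_mul, mul_comm]
      _ ≤ (L + 2) * V + 2 * (k ^ p)⁻¹ * (C ^ 2 * (k ^ p * Fe 1 p 1 (p * L) * V)) := by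
          gcongr
      _ = _ := by field_simp
  have hvol : volume Ω < ⊤ := by
    have := measure_lt_top ((volume : Measure (EuclideanSpace ℝ (Fin n))).restrict Ω) univ
    simpa using this
  set A' : Set (EuclideanSpace ℝ (Fin n)) := ball x0 ρ' ∩ {x | u x < h} with hA'
  have hA'm : MeasurableSet A' := measurableSet_ball.inter (hu.cont.measurable measurableSet_Iio)
  have hρle : ρ' ≤ ρ := by nlinarith
  have hA'Ω : A' ⊆ Ω := inter_subset_left.trans ((ball_subset_ball hρle).trans hbΩ)
  have hA'fin : volume A' < ⊤ := (measure_mono hA'Ω).trans_lt hvol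
  have hlow : (σ ^ 4) ^ q * (volume : Measure (EuclideanSpace ℝ (Fin n))).real A' ≤
      ∫ x, |f x| ^ q := by
    have e : (σ ^ 4) ^ q * (volume : Measure (EuclideanSpace ℝ (Fin n))).real A' =
        ∫ x, A'.indicator (fun _ => (σ ^ 4) ^ q) x := by
      rw [integral_indicator hA'm, setIntegral_const, smul_eq_mul, mul_comm]
    rw [e]
    apply integral_mono _ if1
    · intro x
      simp only
      by_cases hx : x ∈ A'
      · rw [indicator_of_mem hx]
        have h1 : σ ^ 2 ≤ η x := by
          apply hηlow σ hσ.le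
          have := mem_ball.1 hx.1
          rw [dist_eq_norm] at this
          linarith
        have h2 : σ ^ 2 ≤ W x := by
          have hxh : u x < h := hx.2
          have : σ * k ≤ T x := le_trans (by linarith) (le_max_left _ _)
          simp only [hW]
          rw [le_div_iff₀ (by positivity), ← mul_pow]
          norm_num
          gcongr
        have h3 : σ ^ 4 ≤ |f x| := by
          refine le_trans ?_ (le_abs_self _)
          calc σ ^ 4 = σ ^ 2 * σ ^ 2 := by ring
            _ ≤ η x * W x := by
              have := hη0 x
              gcongr
        gcongr
      · rw [indicator_of_notMem hx]; positivity
    · exact (integrable_indicator_iff hA'm).2 (by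
        rw [integrableOn_const_iff]; exact Or.inr hA'fin)
  refine hlow.trans (hsob.trans ?_)
  have : 0 ≤ ∫ x, ‖fderiv ℝ f x‖ := integral_nonneg fun x => norm_nonneg _
  gcongr
end

open MeasureTheory Real Set Metric Bornology
open scoped RealInnerProductSpace Pointwise NNReal Topology
/-! part 8 -/

lemma de_giorgi (n : ℕ) (hn : 2 ≤ n) (p : ℝ) (hp : 1 < p) (Ω : Set (EuclideanSpace ℝ (Fin n)))
    (hΩo : IsOpen Ω) (hΩb : IsBounded Ω) {C : ℝ≥0}
    (hC1 : (volume : Measure (EuclideanSpace ℝ (Fin n))).restrict Ω ≤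
      C • (gaussianMeasure n).restrict Ω)
    (hC2 : (gaussianMeasure n).restrict Ω ≤
      C • (volume : Measure (EuclideanSpace ℝ (Fin n))).restrict Ω)
    [IsFiniteMeasure ((gaussianMeasure n).restrict Ω)]
    [IsFiniteMeasure ((volume : Measure (EuclideanSpace ℝ (Fin n))).restrict Ω)]
    (d : ℝ) (hd : 0 < d) :
    ∃ ν : ℝ, 0 < ν ∧ ∀ ε : ℝ, 0 ≤ ε → ε ≤ 1 → ∀ u : EuclideanSpace ℝ (Fin n) → ℝ, Good n p ε Ω u →
      ∀ x0, closedBall x0 d ⊆ Ω → ∀ k : ℝ, 0 < k →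
      (volume : Measure (EuclideanSpace ℝ (Fin n))).real (ball x0 d ∩ {x | u x < k}) ≤ ν →
      k / 2 ≤ u x0 := by
  have hn' : (2 : ℝ) ≤ n := by exact_mod_cast hn
  obtain ⟨S, hS0, hS⟩ := sobolev_real n hn
  set q : ℝ := (n : ℝ) / (n - 1) with hq
  have hq1 : 1 < q := by rw [hq, one_lt_div] <;> linarith
  have hq0 : 0 < q := by linarith
  set L : ℝ := 8 / d with hL
  set K : ℝ := L + 2 + 2 * (C ^ 2 * Fe 1 p 1 (p * L)) with hK
  have hK0 : 0 < K := by
    have := Fe_nonneg (ε := 1) (p := p) (s := 1) (r := p * L) zero_le_one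
    positivity
  obtain ⟨ν, hν, hit⟩ := fast_geom q (S * K ^ q * (4 ^ 4) ^ q) ((2 ^ 4) ^ q) hq1 (by positivity)
    (Real.one_lt_rpow (by norm_num) hq0)
  refine ⟨ν, hν, fun ε hε hε1 u hu x0 hball k hk hsmall => ?_⟩
  set s : ℕ → ℝ := fun j => (1 / 2) ^ j with hs
  have hs0 : ∀ j, 0 < s j := fun j => by simp only [hs]; positivity
  have hs1 : ∀ j, s j ≤ 1 := fun j => pow_le_one₀ (by norm_num) (by norm_num)
  have hss : ∀ j, s (j + 1) = s j / 2 := fun j => by simp only [hs]; rw [pow_succ]; ring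
  set A : ℕ → Set (EuclideanSpace ℝ (Fin n)) := fun j =>
    ball x0 (d / 2 * (1 + s j)) ∩ {x | u x < k / 2 * (1 + s j)} with hA
  have hvol : volume Ω < ⊤ := by
    have := measure_lt_top ((volume : Measure (EuclideanSpace ℝ (Fin n))).restrict Ω) univ
    simpa using this
  have hsub : ∀ j, closedBall x0 (d / 2 * (1 + s j)) ⊆ Ω := by
    intro j
    refine (closedBall_subset_closedBall ?_).trans hball
    nlinarith [hs1 j]
  have hlim := hit (fun j => (volume : Measure (EuclideanSpace ℝ (Fin n))).real (A j))
    (fun j => measureReal_nonneg)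
    (by
      have : s 0 = 1 := by simp [hs]
      simp only [hA, this]
      rw [show d / 2 * (1 + 1) = d by ring, show k / 2 * (1 + 1) = k by ring]
      exact hsmall)
    (by
      intro j
      have h0 := hs0 j
      have h1 := hs1 j
      have aux : ∀ z : ℝ, 0 < z → z / 2 * (1 + s (j + 1)) ≤ (1 - s j / 4) * (z / 2 * (1 + s j)) := by
        intro z hz
        rw [hss]
        nlinarith [mul_nonneg hz.le (mul_nonneg h0.le (sub_nonneg.2 h1))]
      have h := hu.level_step hn hΩo hΩb hp hε hε1 hC1 hC2 hS0 hS
        (k := k / 2 * (1 + s j)) (h := k / 2 * (1 + s (j + 1))) (ρ := d / 2 * (1 + s j))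
        (ρ' := d / 2 * (1 + s (j + 1))) (σ := s j / 4) (L := L) (by positivity) (by positivity)
        (by positivity) (aux k hk) (aux d hd)
        (by
          rw [hL, div_le_div_iff₀ (by positivity) hd]
          nlinarith) (hsub j)
      rw [← hq, ← hK] at h
      change _ * (volume : Measure (EuclideanSpace ℝ (Fin n))).real (A (j + 1)) ≤ _ * (_ *
        (volume : Measure (EuclideanSpace ℝ (Fin n))).real (A j)) ^ q at h
      rw [Real.mul_rpow hK0.le measureReal_nonneg] at h
      have e : ((s j / 4) ^ 4) ^ q * ((4 ^ 4) ^ q * ((2 ^ 4) ^ q) ^ j) = 1 := by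
        have e1 : (((2:ℝ) ^ 4) ^ q) ^ j = ((2 ^ 4) ^ j) ^ q := by
          rw [← Real.rpow_natCast, ← Real.rpow_mul (by norm_num), mul_comm,
            Real.rpow_mul (by norm_num), Real.rpow_natCast]
        rw [e1, ← Real.mul_rpow (by positivity) (by positivity),
          ← Real.mul_rpow (by positivity) (by positivity)]
        have : (s j / 4) ^ 4 * (4 ^ 4 * (2 ^ 4) ^ j) = 1 := by
          simp only [hs]
          rw [div_pow, ← pow_mul, ← pow_mul, one_div, inv_pow, mul_comm 4 j]
          field_simp
        rw [this, Real.one_rpow]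
      have hpos : 0 ≤ ((4:ℝ) ^ 4) ^ q * ((2 ^ 4) ^ q) ^ j := by positivity
      have := mul_le_mul_of_nonneg_left h hpos
      calc (volume : Measure (EuclideanSpace ℝ (Fin n))).real (A (j + 1))
          = (((s j / 4) ^ 4) ^ q * ((4 ^ 4) ^ q * ((2 ^ 4) ^ q) ^ j)) *
            (volume : Measure (EuclideanSpace ℝ (Fin n))).real (A (j + 1)) := by rw [e, one_mul]
        _ = ((4 ^ 4) ^ q * ((2 ^ 4) ^ q) ^ j) * (((s j / 4) ^ 4) ^ q *
            (volume : Measure (EuclideanSpace ℝ (Fin n))).real (A (j + 1))) := by ring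
        _ ≤ _ := this
        _ = _ := by ring)
  set A0 : Set (EuclideanSpace ℝ (Fin n)) := ball x0 (d / 2) ∩ {x | u x < k / 2} with hA0
  have hA0sub : ∀ j, A0 ⊆ A j := by
    intro j x hx
    have h0 := hs0 j
    refine ⟨ball_subset_ball (by nlinarith) hx.1, ?_⟩
    have : u x < k / 2 := hx.2
    show u x < _
    nlinarith
  have hzero : (volume : Measure (EuclideanSpace ℝ (Fin n))).real A0 ≤ 0 := by
    refine ge_of_tendsto' hlim fun j => ?_
    refine measureReal_mono (hA0sub j) ?_
    exact ((measure_mono (inter_subset_left.trans (ball_subset_closedBall.trans (hsub j)))).trans_lt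
      hvol).ne
  have hA0fin : volume A0 ≠ ⊤ := ((measure_mono (inter_subset_left.trans
    ((ball_subset_ball (by linarith)).trans (ball_subset_closedBall.trans hball)))).trans_lt hvol).ne
  have hz : volume A0 = 0 := by
    have := le_antisymm hzero measureReal_nonneg
    rwa [measureReal_eq_zero_iff hA0fin] at this
  have hopen : IsOpen A0 := isOpen_ball.inter (isOpen_lt hu.cont continuous_const)
  have hempty := (hopen.measure_eq_zero_iff volume).1 hz
  by_contra hc
  have : x0 ∈ A0 := ⟨mem_ball_self (by positivity), not_le.1 hc⟩
  rw [hempty] at this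
  exact this

open MeasureTheory Real Set Metric Bornology
open scoped RealInnerProductSpace Pointwise NNReal Topology
/-! part 9 -/

lemma rpow_young {a b p : ℝ} (ha : 0 ≤ a) (hb : 0 ≤ b) (hp : 1 < p) :
    a ^ (p - 1) * b ≤ a ^ p + b ^ p := by
  have e : ∀ x : ℝ, 0 ≤ x → x ^ (p - 1) * x = x ^ p := by
    intro x hx
    rw [← Real.rpow_add_one' hx (by linarith)]; congr 1; ring
  rcases le_total a b with h | h
  · calc a ^ (p - 1) * b ≤ b ^ (p - 1) * b := by
          gcongr
      _ = b ^ p := e b hb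
      _ ≤ _ := le_add_of_nonneg_left (by positivity)
  · calc a ^ (p - 1) * b ≤ a ^ (p - 1) * a := by gcongr
      _ = a ^ p := e a ha
      _ ≤ _ := le_add_of_nonneg_right (by positivity)

lemma base_est (n : ℕ) (hn : 2 ≤ n) (p : ℝ) (hp : 1 < p) (Ω : Set (EuclideanSpace ℝ (Fin n)))
    (hΩo : IsOpen Ω) (hΩb : IsBounded Ω) {C : ℝ≥0} (hC0 : 0 < C)
    (hC1 : (volume : Measure (EuclideanSpace ℝ (Fin n))).restrict Ω ≤
      C • (gaussianMeasure n).restrict Ω)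
    (hC2 : (gaussianMeasure n).restrict Ω ≤
      C • (volume : Measure (EuclideanSpace ℝ (Fin n))).restrict Ω)
    [IsFiniteMeasure ((gaussianMeasure n).restrict Ω)]
    [IsFiniteMeasure ((volume : Measure (EuclideanSpace ℝ (Fin n))).restrict Ω)]
    (Λ : ℝ) (hΛ : 0 ≤ Λ) :
    ∃ k θ : ℝ, 0 < k ∧ 0 < θ ∧ ∀ ε : ℝ, 0 ≤ ε → ∀ u : EuclideanSpace ℝ (Fin n) → ℝ, Good n p ε Ω u →
      lambdaEps n p ε Ω ≤ Λ →
      θ ≤ (volume : Measure (EuclideanSpace ℝ (Fin n))).real {x | k ≤ u x} := by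
  have hn' : (2 : ℝ) ≤ n := by exact_mod_cast hn
  have hp0 : 0 < p := by linarith
  obtain ⟨S, hS0, hS⟩ := sobolev_real n hn
  set q : ℝ := (n : ℝ) / (n - 1) with hq
  have hq1 : 1 < q := by rw [hq, one_lt_div] <;> linarith
  have hq0 : 0 < q := by linarith
  have hCr : (0:ℝ) < C := by exact_mod_cast hC0
  set G : ℝ := p * (C * (1 + Λ)) with hG
  have hG0 : 0 ≤ G := by positivity
  set C0 : ℝ := S * G ^ q with hC0'
  have hC00 : 0 ≤ C0 := by positivity
  set V : ℝ := (volume : Measure (EuclideanSpace ℝ (Fin n))).real Ω with hV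
  have hV0 : 0 ≤ V := measureReal_nonneg
  set k : ℝ := (1 / (4 * C * (V + 1))) ^ (1 / p) with hk
  have hk0 : 0 < k := by positivity
  have hkp : k ^ p = 1 / (4 * C * (V + 1)) := by
    rw [hk, ← Real.rpow_mul (by positivity), one_div_mul_cancel hp0.ne', Real.rpow_one]
  set M : ℝ := (1 / (4 * C * 2 ^ p * (C0 + 1))) ^ (1 / (1 - q)) with hM
  have hM0 : 0 < M := by positivity
  have hMq : M ^ (1 - q) = 1 / (4 * C * 2 ^ p * (C0 + 1)) := by
    rw [hM, ← Real.rpow_mul (by positivity), one_div_mul_cancel (by linarith), Real.rpow_one]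
  refine ⟨k, 1 / (2 * C * 2 ^ p * M), hk0, by positivity, fun ε hε u hu hlam => ?_⟩
  set H : ℝ → ℝ := fun s => (max (s - k / 2) 0) ^ p with hH
  have hHd : ContDiff ℝ 1 H := (contDiff_max_rpow hp).comp (contDiff_id.sub contDiff_const)
  obtain ⟨hf, hfc, hfs⟩ := hu.trunc hΩo hΩb (half_pos hk0) hHd (by
    intro s hs
    simp only [hH]
    rw [max_eq_right (by linarith), Real.zero_rpow hp0.ne'])
  set f : EuclideanSpace ℝ (Fin n) → ℝ := fun x => H (u x) with hfdef
  have hf0 : ∀ x, 0 ≤ f x := fun x => by simp only [hfdef, hH]; positivity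
  obtain ⟨if1, hsob⟩ := hS f hf hfc
  have iu : Integrable (fun x => u x ^ p) ((gaussianMeasure n).restrict Ω) := by
    by_contra hc
    have := hu.norm
    rw [integral_undef hc] at this
    exact zero_ne_one this
  obtain ⟨iu2, hu2⟩ := integral_transfer hC1 (fun x => Real.rpow_nonneg (hu.nonneg x) p) iu
  rw [hu.norm] at hu2
  obtain ⟨iF2, hF2⟩ := integral_transfer hC1 (fun x => Fe_nonneg hε) hu.int
  rw [hu.eq] at hF2
  obtain ⟨-, hu3⟩ := integral_transfer hC2 (fun x => Real.rpow_nonneg (hu.nonneg x) p) iu2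
  rw [hu.norm] at hu3
  have hgrad : ∀ x ∈ Ω, ‖fderiv ℝ f x‖ ≤ p * (u x ^ p + Fe ε p (u x) ‖fderiv ℝ u x‖) := by
    intro x hx
    have h1 := (hasDerivAt_max_rpow hp (u x - k / 2)).comp_hasFDerivAt x
      ((hu.dAt hΩo hx).sub_const (k / 2))
    have h2 : fderiv ℝ f x = _ := h1.fderiv
    rw [h2, norm_smul, Real.norm_of_nonneg (by positivity), mul_assoc]
    gcongr
    have hu0 := hu.nonneg x
    have h3 : max (u x - k / 2) 0 ≤ u x := max_le (by linarith) hu0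
    calc (max (u x - k / 2) 0) ^ (p - 1) * ‖fderiv ℝ u x‖ ≤ u x ^ (p - 1) * ‖fderiv ℝ u x‖ := by
          gcongr
      _ ≤ u x ^ p + ‖fderiv ℝ u x‖ ^ p := rpow_young hu0 (norm_nonneg _) hp
      _ ≤ _ := by
          gcongr
          exact rpow_le_Fe hε hp0.le (norm_nonneg _)
  have hint : ∫ x, ‖fderiv ℝ f x‖ ≤ G := by
    have e0 : ∫ x, ‖fderiv ℝ f x‖ = ∫ x in Ω, ‖fderiv ℝ f x‖ := by
      symm
      apply setIntegral_eq_integral_of_forall_compl_eq_zero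
      intro x hx
      have : x ∉ tsupport f := fun h' => hx (hfs h')
      rw [(notMem_tsupport_iff_eventuallyEq.1 this).fderiv_eq]; simp
    have j0 : Integrable (fun x => ‖fderiv ℝ f x‖)
        ((volume : Measure (EuclideanSpace ℝ (Fin n))).restrict Ω) :=
      ((hf.continuous_fderiv one_ne_zero).norm.integrable_of_hasCompactSupport
        (hfc.fderiv ℝ).norm).restrict
    rw [e0]
    calc _ ≤ ∫ x in Ω, p * (u x ^ p + Fe ε p (u x) ‖fderiv ℝ u x‖) :=
          setIntegral_mono_on j0 ((iu2.add iF2).const_mul p) hΩo.measurableSet hgrad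
      _ = p * ((∫ x in Ω, u x ^ p) + ∫ x in Ω, Fe ε p (u x) ‖fderiv ℝ u x‖) := by
          rw [integral_const_mul, integral_add iu2 iF2]
      _ ≤ p * (C * 1 + C * Λ) := by
          gcongr
          exact hF2.trans (by gcongr)
      _ = G := by rw [hG]; ring
  have hfq : ∫ x, |f x| ^ q ≤ C0 := by
    refine hsob.trans ?_
    rw [hC0']
    have : 0 ≤ ∫ x, ‖fderiv ℝ f x‖ := integral_nonneg fun x => norm_nonneg _
    gcongr
  have hfqΩ : ∫ x in Ω, |f x| ^ q ≤ C0 :=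
    (setIntegral_le_integral if1 (Filter.Eventually.of_forall fun x => by positivity)).trans hfq
  set E : Set (EuclideanSpace ℝ (Fin n)) := {x | k ≤ u x} with hE
  have hEm : MeasurableSet E := hu.cont.measurable measurableSet_Ici
  have hEΩ : E ⊆ Ω := by
    intro x hx
    by_contra hc
    have h1 : k ≤ u x := hx
    rw [hu.zero x hc] at h1
    linarith
  have hpt : ∀ x, u x ^ p ≤ k ^ p + E.indicator (fun _ => 2 ^ p * M) x +
      2 ^ p * M ^ (1 - q) * |f x| ^ q := by
    intro x
    have hu0 := hu.nonneg x
    by_cases hx : x ∈ E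
    · rw [indicator_of_mem hx]
      have hxk : k ≤ u x := hx
      have h1 : u x ^ p ≤ 2 ^ p * f x := by
        simp only [hfdef, hH]
        rw [max_eq_left (by linarith), ← Real.mul_rpow (by norm_num) (by linarith)]
        gcongr
        linarith
      have h2 : f x ≤ M + M ^ (1 - q) * |f x| ^ q := by
        rw [abs_of_nonneg (hf0 x)]
        rcases le_total (f x) M with h | h
        · have := hf0 x
          have : 0 ≤ M ^ (1 - q) * f x ^ q := by positivity
          linarith
        · have hfp : 0 < f x := lt_of_lt_of_le hM0 h
          have h3 : f x = (f x) ^ (1 - q) * (f x) ^ q := by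
            rw [← Real.rpow_add hfp]; simp
          have h4 : (f x) ^ (1 - q) ≤ M ^ (1 - q) :=
            Real.rpow_le_rpow_of_nonpos hM0 h (by linarith)
          have : (f x) ^ (1 - q) * (f x) ^ q ≤ M ^ (1 - q) * (f x) ^ q := by gcongr
          linarith
      have h2p : (0:ℝ) < 2 ^ p := by positivity
      have := mul_le_mul_of_nonneg_left h2 h2p.le
      have : 0 ≤ k ^ p := by positivity
      linarith
    · rw [indicator_of_notMem hx]
      have hxk : u x < k := not_le.1 hx
      have : u x ^ p ≤ k ^ p := by gcongr
      have : 0 ≤ 2 ^ p * M ^ (1 - q) * |f x| ^ q := by positivity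
      linarith
  have j1 : Integrable (E.indicator (fun _ => 2 ^ p * M))
      ((volume : Measure (EuclideanSpace ℝ (Fin n))).restrict Ω) :=
    (integrable_const _).indicator hEm
  have hfinal : ∫ x in Ω, u x ^ p ≤ k ^ p * V +
      2 ^ p * M * (volume : Measure (EuclideanSpace ℝ (Fin n))).real E + 2 ^ p * M ^ (1 - q) * C0 := by
    calc _ ≤ ∫ x in Ω, (k ^ p + E.indicator (fun _ => 2 ^ p * M) x +
      2 ^ p * M ^ (1 - q) * |f x| ^ q) :=
          integral_mono iu2 (((integrable_const _).add j1).add (if1.restrict.const_mul _)) hpt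
      _ = k ^ p * V + 2 ^ p * M * (volume : Measure (EuclideanSpace ℝ (Fin n))).real E +
          2 ^ p * M ^ (1 - q) * ∫ x in Ω, |f x| ^ q := by
          have j2 : Integrable (fun x => k ^ p + E.indicator (fun _ => 2 ^ p * M) x)
            ((volume : Measure (EuclideanSpace ℝ (Fin n))).restrict Ω) := (integrable_const _).add j1
          rw [integral_add j2 (if1.restrict.const_mul _),
            integral_add (integrable_const _) j1, integral_const_mul]
          congr 1
          rw [integral_indicator hEm, Measure.restrict_restrict hEm,
            inter_eq_self_of_subset_left hEΩ, setIntegral_const, setIntegral_const, smul_eq_mul,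
            smul_eq_mul]
          ring
      _ ≤ _ := by gcongr
  set vE := (volume : Measure (EuclideanSpace ℝ (Fin n))).real E
  have k1 : (C:ℝ) * (k ^ p * V) ≤ 1 / 4 := by
    rw [hkp]
    rw [show (C:ℝ) * (1 / (4 * C * (V + 1)) * V) = V / (V + 1) / 4 by field_simp]
    have : V / (V + 1) ≤ 1 := by rw [div_le_one (by positivity)]; linarith
    linarith
  have k2 : (C:ℝ) * (2 ^ p * M ^ (1 - q) * C0) ≤ 1 / 4 := by
    rw [hMq]
    rw [show (C:ℝ) * (2 ^ p * (1 / (4 * C * 2 ^ p * (C0 + 1))) * C0) = C0 / (C0 + 1) / 4 by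
      field_simp]
    have : C0 / (C0 + 1) ≤ 1 := by rw [div_le_one (by positivity)]; linarith
    linarith
  have k3 := mul_le_mul_of_nonneg_left hfinal hCr.le
  rw [div_le_iff₀ (by positivity)]
  nlinarith

open MeasureTheory Real Set Metric Bornology
open scoped RealInnerProductSpace Pointwise NNReal Topology
/-! part 10 -/

lemma log_grad (n : ℕ) (p : ℝ) (hp : 1 < p) (Ω : Set (EuclideanSpace ℝ (Fin n)))
    (hΩo : IsOpen Ω) (hΩb : IsBounded Ω) {C : ℝ≥0}
    (hC1 : (volume : Measure (EuclideanSpace ℝ (Fin n))).restrict Ω ≤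
      C • (gaussianMeasure n).restrict Ω)
    (hC2 : (gaussianMeasure n).restrict Ω ≤
      C • (volume : Measure (EuclideanSpace ℝ (Fin n))).restrict Ω)
    [IsFiniteMeasure ((gaussianMeasure n).restrict Ω)]
    [IsFiniteMeasure ((volume : Measure (EuclideanSpace ℝ (Fin n))).restrict Ω)]
    {η : EuclideanSpace ℝ (Fin n) → ℝ} (hη : ContDiff ℝ 1 η) (hc : HasCompactSupport η)
    (hs : tsupport η ⊆ Ω) (hη0 : ∀ x, 0 ≤ η x) (hη1 : ∀ x, η x ≤ 1) {L : ℝ}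
    (hL : ∀ x, ‖fderiv ℝ η x‖ ≤ L) {D : Set (EuclideanSpace ℝ (Fin n))} (hDo : IsOpen D)
    (hDη : ∀ x ∈ D, η x = 1) :
    ∃ K : ℝ≥0, ∀ ε : ℝ, 0 ≤ ε → ε ≤ 1 → ∀ u : EuclideanSpace ℝ (Fin n) → ℝ, Good n p ε Ω u →
      ∀ s : ℝ, 0 < s → ∫⁻ x in D, ‖fderiv ℝ (fun y => Real.log (u y + s)) x‖ₑ ≤ K := by
  have hp0 : 0 < p := by linarith
  have hp1 : 0 < p - 1 := by linarith
  have hL0 : 0 ≤ L := (norm_nonneg _).trans (hL 0)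
  have hDΩ : D ⊆ Ω := by
    intro x hx
    apply hs
    apply subset_tsupport
    simp [hDη x hx]
  set V : ℝ := (volume : Measure (EuclideanSpace ℝ (Fin n))).real Ω with hV
  set K0 : ℝ := Fe 1 p (1 + 1 / (p - 1)) (p * L / (p - 1)) with hK0
  refine ⟨(V + C ^ 2 * (K0 * V)).toNNReal, fun ε hε hε1 u hu s hs0 => ?_⟩
  have hsp : 0 < s ^ p := by positivity
  obtain ⟨i1, i2, h⟩ := hu.cacc hΩo hΩb hp hε hC1 hC2 hη hc hs hη0 hη1 hL
    (g := fun t => s ^ p / (p - 1) * (t + s) ^ (1 - p)) (a := fun t => s ^ p * (t + s) ^ (-p))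
    (b := fun t => (t + s) / (p - 1))
    (by
      intro t ht
      have h1 := (((hasDerivAt_id t).add_const s).rpow_const (p := 1 - p)
        (Or.inl (by simp only [id]; linarith))).const_mul (s ^ p / (p - 1))
      refine h1.congr_deriv ?_
      simp only [id]
      rw [show 1 - p - 1 = -p by ring]
      field_simp
      ring)
    (by
      intro t ht
      have h1 : ContDiffAt ℝ 1 (fun t : ℝ => (t + s) ^ (1 - p)) t :=
        (contDiffAt_id.add contDiffAt_const).rpow_const_of_ne (by simp only [id]; linarith)
      exact contDiffAt_const.mul h1)
    (by
      apply continuousOn_const.mul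
      apply ContinuousOn.rpow_const (by fun_prop)
      intro t ht
      have : (0:ℝ) ≤ t := ht
      exact Or.inl (by linarith))
    (by fun_prop)
    (fun t ht => by positivity)
    (fun t ht => by
      rw [Real.rpow_neg (by linarith), ← div_eq_mul_inv, div_le_one (by positivity)]
      gcongr
      linarith)
    (fun t ht => by positivity)
    (fun t ht => by
      have : (t + s) ^ (1 - p) = (t + s) ^ (-p) * (t + s) := by
        rw [← Real.rpow_add_one (by linarith)]; congr 1; ring
      rw [this]; ring)
  have hb : ∀ x, indicator {x | η x ≠ 0} (fun x => s ^ p * (u x + s) ^ (-p) *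
      Fe ε p (u x + (u x + s) / (p - 1)) (p * L * ((u x + s) / (p - 1)))) x ≤ s ^ p * K0 := by
    intro x
    have hu0 := hu.nonneg x
    have hus : 0 < u x + s := by linarith
    rw [indicator_apply]
    split_ifs with hx
    · have q2 : Fe ε p (u x + (u x + s) / (p - 1)) (p * L * ((u x + s) / (p - 1))) ≤
          Fe 1 p ((u x + s) * (1 + 1 / (p - 1))) ((u x + s) * (p * L / (p - 1))) := by
        refine (Fe_mono_eps hε hp0.le hε1).trans (Fe_mono zero_le_one hp0.le ?_ (by positivity) ?_)
        · rw [abs_of_nonneg (by positivity), abs_of_nonneg (by positivity)]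
          rw [mul_add, mul_one, mul_one_div]
          linarith
        · apply le_of_eq; ring
      rw [Fe_smul zero_le_one hus.le] at q2
      calc _ ≤ s ^ p * (u x + s) ^ (-p) * ((u x + s) ^ p * K0) := by gcongr
        _ = s ^ p * K0 * ((u x + s) ^ (-p) * (u x + s) ^ p) := by ring
        _ = s ^ p * K0 := by
          rw [← Real.rpow_add hus]; simp
    · exact mul_nonneg hsp.le (Fe_nonneg zero_le_one)
  have h' : ∫ x in Ω, η x ^ p * (s ^ p * (u x + s) ^ (-p)) * Fe ε p (u x) ‖fderiv ℝ u x‖ ≤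
      C ^ 2 * (s ^ p * K0 * V) := by
    refine h.trans ?_
    gcongr
    calc _ ≤ ∫ x in Ω, s ^ p * K0 := integral_mono i2 (integrable_const _) hb
      _ = _ := by rw [setIntegral_const, smul_eq_mul, mul_comm]
  set R : EuclideanSpace ℝ (Fin n) → ℝ := fun x => 1 + (s ^ p)⁻¹ *
    (η x ^ p * (s ^ p * (u x + s) ^ (-p)) * Fe ε p (u x) ‖fderiv ℝ u x‖) with hR
  have hR0 : ∀ x, 0 ≤ R x := by
    intro x
    have := hu.nonneg x
    have := hη0 x
    have := Fe_nonneg (ε := ε) (p := p) (s := u x) (r := ‖fderiv ℝ u x‖) hε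
    simp only [hR]
    positivity
  have iR : Integrable R ((volume : Measure (EuclideanSpace ℝ (Fin n))).restrict Ω) :=
    (integrable_const _).add (i1.const_mul _)
  have hRint : ∫ x in Ω, R x ≤ V + C ^ 2 * (K0 * V) := by
    simp only [hR]
    rw [integral_add (integrable_const _) (i1.const_mul _), integral_const_mul, setIntegral_const,
      smul_eq_mul, mul_one]
    have := mul_le_mul_of_nonneg_left h' (inv_nonneg.2 hsp.le)
    have e : (s ^ p)⁻¹ * (C ^ 2 * (s ^ p * K0 * V)) = C ^ 2 * (K0 * V) := by field_simp
    rw [e] at this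
    linarith
  have hpt : ∀ x ∈ D, ‖fderiv ℝ (fun y => Real.log (u y + s)) x‖ₑ ≤ ENNReal.ofReal (R x) := by
    intro x hx
    have hu0 := hu.nonneg x
    have hus : 0 < u x + s := by linarith
    have h1 := ((hu.dAt hΩo (hDΩ hx)).add_const s).log hus.ne'
    rw [h1.fderiv, ← ofReal_norm]
    apply ENNReal.ofReal_le_ofReal
    rw [norm_smul, Real.norm_of_nonneg (by positivity)]
    set r := ‖fderiv ℝ u x‖ with hr
    have hr0 : 0 ≤ r := norm_nonneg _
    refine (le_one_add_rpow (by positivity) hp).trans ?_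
    simp only [hR, hDη x hx, Real.one_rpow, one_mul]
    have y2 : r ^ p ≤ Fe ε p (u x) r := rpow_le_Fe hε hp0.le hr0
    rw [Real.mul_rpow (by positivity) hr0, Real.inv_rpow hus.le, ← Real.rpow_neg hus.le]
    rw [show (s ^ p)⁻¹ * (s ^ p * (u x + s) ^ (-p) * Fe ε p (u x) r) =
      (u x + s) ^ (-p) * Fe ε p (u x) r by field_simp]
    gcongr
  calc ∫⁻ x in D, ‖fderiv ℝ (fun y => Real.log (u y + s)) x‖ₑ
      ≤ ∫⁻ x in D, ENNReal.ofReal (R x) := setLIntegral_mono' hDo.measurableSet hpt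
    _ ≤ ∫⁻ x in Ω, ENNReal.ofReal (R x) := lintegral_mono_set hDΩ
    _ = ENNReal.ofReal (∫ x in Ω, R x) :=
        (ofReal_integral_eq_lintegral_ofReal iR (Filter.Eventually.of_forall hR0)).symm
    _ ≤ ENNReal.ofReal (V + C ^ 2 * (K0 * V)) := ENNReal.ofReal_le_ofReal hRint
    _ = _ := rfl

lemma log_small (n : ℕ) (p : ℝ) (Ω : Set (EuclideanSpace ℝ (Fin n)))
    (hΩo : IsOpen Ω) (hΩb : IsBounded Ω)
    {D : Set (EuclideanSpace ℝ (Fin n))} (hDo : IsOpen D) (hDc : Convex ℝ D) (hDΩ : D ⊆ Ω)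
    (K : ℝ≥0) (k θ ν : ℝ) (hk : 0 < k) (hθ : 0 < θ) (hν : 0 < ν) :
    ∃ κ : ℝ, 0 < κ ∧ ∀ ε : ℝ, ∀ u : EuclideanSpace ℝ (Fin n) → ℝ, Good n p ε Ω u →
      (∀ s : ℝ, 0 < s → ∫⁻ x in D, ‖fderiv ℝ (fun y => Real.log (u y + s)) x‖ₑ ≤ K) →
      θ ≤ (volume : Measure (EuclideanSpace ℝ (Fin n))).real (D ∩ {x | k ≤ u x}) →
      (volume : Measure (EuclideanSpace ℝ (Fin n))).real (D ∩ {x | u x < κ}) ≤ ν := by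
  have hDb : IsBounded D := hΩb.subset hDΩ
  have hDfin : volume D < ⊤ := hDb.measure_lt_top
  obtain ⟨d0, hd0⟩ := hDb.exists_norm_le
  set d : ℝ≥0 := (2 * d0).toNNReal with hd
  have hdd : ∀ x ∈ D, ∀ y ∈ D, ‖y - x‖ ≤ d := by
    intro x hx y hy
    refine (norm_sub_le _ _).trans ?_
    have := hd0 x hx
    have := hd0 y hy
    refine le_trans ?_ (Real.le_coe_toNNReal _)
    linarith
  set v : ℝ≥0 := (volume D).toNNReal with hv
  have hvD : volume D = v := (ENNReal.coe_toNNReal hDfin.ne).symm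
  set R : ℝ≥0 := 2 * (v * (d * (2 ^ n * K))) with hR
  set m : ℝ≥0 := (R / (θ * ν)).toNNReal + 1 with hm
  have hm0 : (0 : ℝ) < m := by positivity
  refine ⟨k * Real.exp (-m) / 2, by positivity, fun ε u hu hK hA => ?_⟩
  set κ : ℝ := k * Real.exp (-m) / 2 with hκ
  have hκ0 : 0 < κ := by positivity
  set A : Set (EuclideanSpace ℝ (Fin n)) := D ∩ {x | k ≤ u x} with hAdef
  set B : Set (EuclideanSpace ℝ (Fin n)) := D ∩ {x | u x < κ} with hBdef
  have hpos : ∀ x, u x + κ ≠ 0 := fun x => by linarith [hu.nonneg x]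
  have hcont : Continuous (fun y => Real.log (u y + κ)) :=
    (hu.cont.add continuous_const).log hpos
  have hpl := poincare_levels n D hDo hDc d hdd (fun y => Real.log (u y + κ))
    (fun x hx => (((hu.diffAt hΩo (hDΩ hx)).add contDiffAt_const).log (hpos x)).contDiffWithinAt)
    hcont.measurable A B (hDo.measurableSet.inter (hu.cont.measurable measurableSet_Ici))
    (hDo.measurableSet.inter (hu.cont.measurable measurableSet_Iio)) inter_subset_left
    inter_subset_left m (by
      intro x hx y hy
      have hx' : k ≤ u x := hx.2
      have hy' : u y < κ := hy.2
      have hy0 := hu.nonneg y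
      have h1 : Real.log k ≤ Real.log (u x + κ) := Real.log_le_log hk (by linarith)
      have h2 : Real.log (u y + κ) ≤ Real.log (k * Real.exp (-m)) :=
        Real.log_le_log (by linarith) (by rw [show k * Real.exp (-m) = κ + κ by rw [hκ]; ring]; linarith)
      rw [Real.log_mul hk.ne' (Real.exp_pos _).ne', Real.log_exp] at h2
      linarith)
  have hAf : volume A ≠ ⊤ := ((measure_mono inter_subset_left).trans_lt hDfin).ne
  have hBf : volume B ≠ ⊤ := ((measure_mono inter_subset_left).trans_lt hDfin).ne
  have h3 : (m : ENNReal) * volume A * volume B ≤ R := by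
    refine hpl.trans ?_
    rw [hvD, hR]
    push_cast
    gcongr
    exact hK κ hκ0
  have h4 : (m : ℝ) * (volume : Measure (EuclideanSpace ℝ (Fin n))).real A *
      (volume : Measure (EuclideanSpace ℝ (Fin n))).real B ≤ R := by
    have := ENNReal.toReal_mono ENNReal.coe_ne_top h3
    rw [ENNReal.toReal_mul, ENNReal.toReal_mul] at this
    exact this
  have h5 : (R : ℝ) / (θ * ν) ≤ m := by
    rw [hm]
    push_cast
    linarith [Real.le_coe_toNNReal ((R : ℝ) / (θ * ν))]
  rw [div_le_iff₀ (by positivity)] at h5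
  by_contra hcon
  push Not at hcon
  have h6 : m * (θ * ν) < (m : ℝ) * (volume : Measure (EuclideanSpace ℝ (Fin n))).real A *
      (volume : Measure (EuclideanSpace ℝ (Fin n))).real B := by
    rw [mul_assoc]
    apply mul_lt_mul_of_pos_left _ hm0
    exact mul_lt_mul' hA hcon hν.le (by linarith)
  linarith

open MeasureTheory Real Set Metric Bornology
open scoped RealInnerProductSpace Pointwise NNReal Topology
/-! part 11 -/

lemma exists_normalized_test (n : ℕ) (p : ℝ) (hp : 1 < p) (Ω : Set (EuclideanSpace ℝ (Fin n)))
    (hΩo : IsOpen Ω) {C : ℝ≥0}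
    (hC1 : (volume : Measure (EuclideanSpace ℝ (Fin n))).restrict Ω ≤
      C • (gaussianMeasure n).restrict Ω)
    [IsFiniteMeasure ((gaussianMeasure n).restrict Ω)]
    (hne : Ω.Nonempty) :
    ∃ v : EuclideanSpace ℝ (Fin n) → ℝ, IsTestFun n Ω v ∧
      (∫ x in Ω, |v x| ^ p ∂(gaussianMeasure n)) = 1 := by
  have hp0 : 0 < p := by linarith
  obtain ⟨x, hx⟩ := hne
  obtain ⟨f, hfs, hfc, hfd, hfr, hfx⟩ := exists_contDiff_tsupport_subset
    (n := (⊤ : ℕ∞)) (hΩo.mem_nhds hx)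
  have hcont : Continuous (fun x => |f x| ^ p) :=
    hfd.continuous.abs.rpow_const fun _ => Or.inr hp0.le
  have hcs : HasCompactSupport (fun x => |f x| ^ p) := by
    apply hfc.mono
    intro x hx h0
    apply hx
    simp [h0, Real.zero_rpow hp0.ne']
  have hb : ∀ x, |f x| ≤ 1 := by
    intro x
    have := hfr (mem_range_self x)
    rw [abs_of_nonneg this.1]; exact this.2
  have i1 : Integrable (fun x => |f x| ^ p) ((gaussianMeasure n).restrict Ω) := by
    refine Integrable.mono' (integrable_const (1:ℝ)) hcont.aestronglyMeasurable
      (Filter.Eventually.of_forall fun x => ?_)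
    rw [Real.norm_of_nonneg (by positivity)]
    exact Real.rpow_le_one (abs_nonneg _) (hb x) hp0.le
  set I := ∫ x in Ω, |f x| ^ p ∂(gaussianMeasure n) with hI
  have hI0 : 0 < I := by
    have h1 := (integral_transfer hC1 (fun x => by positivity) i1).2
    have h2 : 0 < ∫ x, |f x| ^ p := by
      apply hcont.integral_pos_of_hasCompactSupport_nonneg_nonzero hcs (fun x => by positivity)
        (x := x)
      rw [hfx]; simp
    have h3 : ∫ x in Ω, |f x| ^ p = ∫ x, |f x| ^ p := by
      apply setIntegral_eq_integral_of_forall_compl_eq_zero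
      intro y hy
      have : f y = 0 := image_eq_zero_of_notMem_tsupport fun h => hy (hfs h)
      simp [this, Real.zero_rpow hp0.ne']
    rw [h3] at h1
    have h4 : 0 ≤ I := integral_nonneg fun x => by positivity
    rcases h4.eq_or_lt with h | h
    · rw [← hI, ← h, mul_zero] at h1
      linarith
    · exact h
  set c : ℝ := I ^ (-(1 / p)) with hc
  have hc0 : 0 < c := by positivity
  have hcp : c ^ p = I⁻¹ := by
    rw [hc, ← Real.rpow_mul hI0.le, neg_mul, one_div_mul_cancel hp0.ne', Real.rpow_neg_one]
  refine ⟨fun x => c * f x, ⟨contDiff_const.mul hfd, hfc.mul_left, ?_⟩, ?_⟩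
  · exact (tsupport_mul_subset_right).trans hfs
  · simp_rw [abs_mul, abs_of_pos hc0, Real.mul_rpow hc0.le (abs_nonneg _)]
    rw [integral_const_mul, hcp, inv_mul_cancel₀ hI0.ne']

lemma test_integrable (n : ℕ) (p ε : ℝ) (hp : 1 < p) (Ω : Set (EuclideanSpace ℝ (Fin n)))
    [IsFiniteMeasure ((gaussianMeasure n).restrict Ω)]
    (v : EuclideanSpace ℝ (Fin n) → ℝ) (hv : IsTestFun n Ω v) :
    Integrable (fun x => Fe ε p (v x) ‖fderiv ℝ v x‖) ((gaussianMeasure n).restrict Ω) := by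
  have hp0 : 0 < p := by linarith
  have hcont : Continuous (fun x => Fe ε p (v x) ‖fderiv ℝ v x‖) :=
    Fe_continuous ε hp0.le hv.1.continuous (hv.1.continuous_fderiv (by simp)).norm
  have hcs : HasCompactSupport (fun x => Fe ε p (v x) ‖fderiv ℝ v x‖) := by
    apply hv.2.1.mono'
    intro x hx
    by_contra h
    apply hx
    have h1 := notMem_tsupport_iff_eventuallyEq.1 h
    have h2 : fderiv ℝ v x = 0 := by rw [h1.fderiv_eq]; simp
    have hv0 : v x = 0 := h1.eq_of_nhds
    show Fe ε p (v x) ‖fderiv ℝ v x‖ = 0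
    rw [hv0, h2]
    simp [Fe_zero_left, Real.zero_rpow hp0.ne']
  obtain ⟨M, hM⟩ := hcs.exists_bound_of_continuous hcont
  exact Integrable.mono' (integrable_const M) hcont.aestronglyMeasurable
    (Filter.Eventually.of_forall hM)

lemma lambda_upper (n : ℕ) (p : ℝ) (hp : 1 < p) (Ω : Set (EuclideanSpace ℝ (Fin n)))
    [IsFiniteMeasure ((gaussianMeasure n).restrict Ω)]
    (v : EuclideanSpace ℝ (Fin n) → ℝ) (hv : IsTestFun n Ω v)
    (hv1 : (∫ x in Ω, |v x| ^ p ∂(gaussianMeasure n)) = 1) (ε : ℝ) (hε : 0 ≤ ε) (hε1 : ε ≤ 1) :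
    lambdaEps n p ε Ω ≤ Jeps n p 1 Ω v := by
  have h1 : lambdaEps n p ε Ω ≤ Jeps n p ε Ω v :=
    csInf_le (lambda_bdd n p ε hε Ω) ⟨v, hv, hv1, rfl⟩
  refine h1.trans ?_
  rw [Jeps_eq, Jeps_eq]
  exact integral_mono (test_integrable n p ε hp Ω v hv) (test_integrable n p 1 hp Ω v hv)
    fun x => Fe_mono_eps hε (by linarith) hε1

lemma lambda_pos (n : ℕ) (p : ℝ) (hp : 1 < p) (Ω : Set (EuclideanSpace ℝ (Fin n)))
    [IsFiniteMeasure ((gaussianMeasure n).restrict Ω)]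
    (v : EuclideanSpace ℝ (Fin n) → ℝ) (hv : IsTestFun n Ω v)
    (hv1 : (∫ x in Ω, |v x| ^ p ∂(gaussianMeasure n)) = 1) (ε : ℝ) (hε : 0 < ε) :
    0 < lambdaEps n p ε Ω := by
  have hp0 : 0 < p := by linarith
  refine lt_of_lt_of_le (by positivity : 0 < ε ^ (p / 2)) ?_
  unfold lambdaEps
  refine le_csInf ⟨Jeps n p ε Ω v, v, hv, hv1, rfl⟩ ?_
  rintro r ⟨w, hw, hw1, rfl⟩
  rw [Jeps_eq]
  have iw : Integrable (fun x => |w x| ^ p) ((gaussianMeasure n).restrict Ω) := by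
    by_contra hc
    rw [integral_undef hc] at hw1
    exact zero_ne_one hw1
  calc ε ^ (p / 2) = ∫ x in Ω, ε ^ (p / 2) * |w x| ^ p ∂(gaussianMeasure n) := by
        rw [integral_const_mul, hw1, mul_one]
    _ ≤ _ := by
        apply integral_mono (iw.const_mul _) (test_integrable n p ε hp Ω w hw)
        intro x
        have e : |w x| ^ p = (w x ^ 2) ^ (p / 2) := by
          rw [← sq_abs, ← Real.rpow_natCast, ← Real.rpow_mul (abs_nonneg _)]
          congr 1; push_cast; ring
        simp only
        rw [e, ← Real.mul_rpow hε.le (by positivity)]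
        unfold Fe
        gcongr
        nlinarith [sq_nonneg ‖fderiv ℝ w x‖]

lemma good_of_min (n : ℕ) (p ε : ℝ) (Ω : Set (EuclideanSpace ℝ (Fin n)))
    (hΩo : IsOpen Ω) (hpos : 0 < lambdaEps n p ε Ω) (uε : EuclideanSpace ℝ (Fin n) → ℝ)
    (h : IsNormalizedMinimizer n p ε Ω uε) : Good n p ε Ω (Ω.indicator uε) := by
  obtain ⟨h1, h2, h3, h4, h5, h6⟩ := h
  have heq : ∀ x ∈ Ω, Ω.indicator uε x = uε x := fun x hx => indicator_of_mem hx _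
  have hev : ∀ x ∈ Ω, Ω.indicator uε =ᶠ[𝓝 x] uε := fun x hx => by
    filter_upwards [hΩo.mem_nhds hx] with y hy using heq y hy
  have hfe : ∀ x ∈ Ω, Fe ε p (Ω.indicator uε x) ‖fderiv ℝ (Ω.indicator uε) x‖ =
      Fe ε p (uε x) ‖fderiv ℝ uε x‖ := by
    intro x hx
    rw [heq x hx, (hev x hx).fderiv_eq]
  have e : ∫ x in Ω, Fe ε p (Ω.indicator uε x) ‖fderiv ℝ (Ω.indicator uε) x‖ ∂(gaussianMeasure n) =
      lambdaEps n p ε Ω := by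
    rw [← h6, Jeps_eq]
    exact setIntegral_congr_fun hΩo.measurableSet hfe
  refine ⟨?_, ?_, ?_, ?_, ?_, ?_, e⟩
  · exact continuous_indicator h4 h1
  · intro x
    exact indicator_nonneg (fun x hx => h3 x (subset_closure hx)) x
  · intro x hx
    exact indicator_of_notMem hx _
  · exact h2.congr heq
  · rw [← h5]
    refine setIntegral_congr_fun hΩo.measurableSet fun x hx => ?_
    simp only [heq x hx]
  · by_contra hc
    rw [integral_undef hc] at e
    exact hpos.ne e

lemma inner_convex (n : ℕ) (Ω : Set (EuclideanSpace ℝ (Fin n))) (hΩc : Convex ℝ Ω)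
    (hne : (Ωᶜ).Nonempty) (d : ℝ) : Convex ℝ {x | d < infDist x Ωᶜ} := by
  intro x hx y hy a b ha hb hab
  have hx' : d < infDist x Ωᶜ := hx
  have hy' : d < infDist y Ωᶜ := hy
  refine lt_of_lt_of_le (lt_min hx' hy') ?_
  rw [le_infDist hne]
  intro z hz
  by_contra hc
  push Not at hc
  apply hz
  set v := z - (a • x + b • y) with hv
  have hvn : ‖v‖ < min (infDist x Ωᶜ) (infDist y Ωᶜ) := by
    rw [hv, ← dist_eq_norm, dist_comm]; exact hc
  have h1 : x + v ∈ Ω := ball_infDist_compl_subset (by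
    rw [mem_ball, dist_eq_norm, add_sub_cancel_left]; exact hvn.trans_le (min_le_left _ _))
  have h2 : y + v ∈ Ω := ball_infDist_compl_subset (by
    rw [mem_ball, dist_eq_norm, add_sub_cancel_left]; exact hvn.trans_le (min_le_right _ _))
  have h3 := hΩc h1 h2 ha hb hab
  have e : a • (x + v) + b • (y + v) = z := by
    calc a • (x + v) + b • (y + v) = (a • x + b • y) + (a + b) • v := by module
      _ = z := by rw [hab, one_smul, hv]; abel
  rwa [e] at h3

lemma inner_cutoff (n : ℕ) (Ω : Set (EuclideanSpace ℝ (Fin n))) (hΩb : IsBounded Ω)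
    (d : ℝ) (hd : 0 < d) :
    ∃ η : EuclideanSpace ℝ (Fin n) → ℝ, ∃ L : ℝ, ContDiff ℝ 1 η ∧ HasCompactSupport η ∧
      tsupport η ⊆ Ω ∧ (∀ x, 0 ≤ η x) ∧ (∀ x, η x ≤ 1) ∧ (∀ x, ‖fderiv ℝ η x‖ ≤ L) ∧
      ∀ x ∈ {x | d < infDist x Ωᶜ}, η x = 1 := by
  have hc : Continuous (fun x => infDist x Ωᶜ) := continuous_infDist_pt _
  obtain ⟨η, h1, h2, h3, h4⟩ := exists_contMDiff_support_eq_eq_one_iff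
    (n := 1) (modelWithCornersSelf ℝ (EuclideanSpace ℝ (Fin n)))
    (s := {x | d / 2 < infDist x Ωᶜ}) (t := {x | d ≤ infDist x Ωᶜ})
    (isOpen_lt continuous_const hc) (isClosed_le continuous_const hc)
    (fun x hx => by
      have : d ≤ infDist x Ωᶜ := hx
      show d / 2 < _
      linarith)
  have hη := h1.contDiff
  have hts : tsupport η ⊆ Ω := by
    rw [tsupport, h3]
    refine (closure_minimal (t := {x | d / 2 ≤ infDist x Ωᶜ}) (fun x hx => by
      have h' : d / 2 < infDist x Ωᶜ := hx
      exact h'.le)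
      (isClosed_le continuous_const hc)).trans ?_
    intro x hx
    by_contra hxn
    have h0 : infDist x Ωᶜ = 0 := infDist_zero_of_mem hxn
    have : d / 2 ≤ infDist x Ωᶜ := hx
    linarith
  have hcs : HasCompactSupport η :=
    Metric.isCompact_of_isClosed_isBounded (isClosed_tsupport η) (hΩb.subset hts)
  obtain ⟨L, hL⟩ := (hcs.fderiv ℝ).exists_bound_of_continuous
    (hη.continuous_fderiv one_ne_zero)
  refine ⟨η, L, hη, hcs, hts, fun x => (h2 (mem_range_self x)).1, fun x => (h2 (mem_range_self x)).2,
    hL, fun x hx => (h4 x).1 (by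
      have h' : d < infDist x Ωᶜ := hx
      exact h'.le)⟩

lemma inner_measure (n : ℕ) (Ω : Set (EuclideanSpace ℝ (Fin n))) (hΩo : IsOpen Ω) (hΩb : IsBounded Ω)
    (hne : (Ωᶜ).Nonempty) (θ δ : ℝ) (hθ : 0 < θ) (hδ : 0 < δ) :
    ∃ d : ℝ, 0 < d ∧ d ≤ δ ∧
      (volume : Measure (EuclideanSpace ℝ (Fin n))).real (Ω \ {x | d < infDist x Ωᶜ}) ≤ θ := by
  have hc : Continuous (fun x => infDist x Ωᶜ) := continuous_infDist_pt _
  set s : ℕ → Set (EuclideanSpace ℝ (Fin n)) := fun j => Ω \ {x | δ / (j + 1) < infDist x Ωᶜ} with hs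
  have hanti : Antitone s := by
    intro i j hij x hx
    refine ⟨hx.1, fun h => hx.2 ?_⟩
    have h' : δ / (i + 1) < infDist x Ωᶜ := h
    show δ / (j + 1) < infDist x Ωᶜ
    refine lt_of_le_of_lt ?_ h'
    gcongr
  have hint : ⋂ j, s j = ∅ := by
    ext x
    simp only [mem_iInter, mem_empty_iff_false, iff_false, not_forall]
    by_cases hx : x ∈ Ω
    · have h0 : 0 < infDist x Ωᶜ :=
        (hΩo.isClosed_compl.notMem_iff_infDist_pos hne).1 (fun h => h hx)
      have ht : Filter.Tendsto (fun j : ℕ => δ / ((j : ℝ) + 1)) Filter.atTop (𝓝 0) := by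
        have := (tendsto_one_div_add_atTop_nhds_zero_nat (𝕜 := ℝ)).const_mul δ
        simpa [div_eq_mul_inv] using this
      obtain ⟨j, hj⟩ := (ht.eventually (gt_mem_nhds h0)).exists
      exact ⟨j, fun h => h.2 hj⟩
    · exact ⟨0, fun h => hx h.1⟩
  have hlim := tendsto_measure_iInter_atTop (μ := (volume : Measure (EuclideanSpace ℝ (Fin n))))
    (s := s) (fun j => (hΩo.measurableSet.diff
      (isOpen_lt continuous_const hc).measurableSet).nullMeasurableSet) hanti
    ⟨0, ((measure_mono sdiff_subset).trans_lt hΩb.measure_lt_top).ne⟩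
  rw [hint, measure_empty] at hlim
  obtain ⟨j, hj⟩ := (hlim.eventually (gt_mem_nhds (ENNReal.ofReal_pos.2 hθ))).exists
  refine ⟨δ / (j + 1), by positivity, div_le_self hδ.le (by linarith [(Nat.cast_nonneg j : (0:ℝ) ≤ j)]), ?_⟩
  exact ENNReal.toReal_le_of_le_ofReal hθ.le hj.le

lemma ball_in (n : ℕ) (Ω : Set (EuclideanSpace ℝ (Fin n))) (x : EuclideanSpace ℝ (Fin n))
    (hx : x ∈ Ω) (δ : ℝ) (hδ : δ < infDist x (frontier Ω)) : closedBall x δ ⊆ Ω := by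
  intro y hy
  by_contra hyn
  have hδ0 : 0 ≤ δ := dist_nonneg.trans (mem_closedBall.1 hy)
  have hpre : IsPreconnected (closedBall x δ) := (convex_closedBall x δ).isPreconnected
  have hfr : ∀ z ∈ closedBall x δ, z ∉ frontier Ω := by
    intro z hz1 hz2
    have h1 := infDist_le_dist_of_mem (x := x) hz2
    have h2 := mem_closedBall'.1 hz1
    linarith
  have hcov : ∀ z ∈ closedBall x δ, z ∈ interior Ω ∨ z ∈ (closure Ω)ᶜ := by
    intro z hz
    by_contra hc
    push Not at hc
    exact hfr z hz ⟨not_not.1 hc.2, hc.1⟩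
  have hxi : x ∈ interior Ω := (hcov x (mem_closedBall_self hδ0)).resolve_right
    fun h => h (subset_closure hx)
  have hyc : y ∈ (closure Ω)ᶜ := (hcov y hy).resolve_left fun h => hyn (interior_subset h)
  obtain ⟨z, -, hz1, hz2⟩ := hpre (interior Ω) (closure Ω)ᶜ isOpen_interior
    isClosed_closure.isOpen_compl hcov ⟨x, mem_closedBall_self hδ0, hxi⟩ ⟨y, hy, hyc⟩
  exact hz2 (subset_closure (interior_subset hz1))

/-- **Uniform interior positivity of the regularized minimizers** (Proposition 4.6 of the
paper): for every `δ > 0` there are `ε₀, τ > 0` such that every normalized minimizer of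
the `ε`-regularized problem with `0 < ε < ε₀` is bounded below by `τ` on
`Ω_δ = {x ∈ Ω : dist(x, ∂Ω) > δ}`. -/
theorem regularized_minimizers_interior_positivity
    (n : ℕ) (hn : 2 ≤ n) (p : ℝ) (hp : 1 < p)
    (Ω : Set (EuclideanSpace ℝ (Fin n)))
    (hΩo : IsOpen Ω) (hΩb : IsBounded Ω) (hΩconv : Convex ℝ Ω) (hΩ2 : HasC2Boundary n Ω)
    (hsc : ∃ R : ℝ, 0 < R ∧ ∀ x ∈ frontier Ω, ∃ y : EuclideanSpace ℝ (Fin n),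
      dist x y = R ∧ closure Ω ⊆ Metric.closedBall y R) :
    ∀ δ : ℝ, 0 < δ → ∃ (ε₀ τ : ℝ), 0 < ε₀ ∧ 0 < τ ∧
      ∀ ε : ℝ, 0 < ε → ε < ε₀ →
        ∀ uε : EuclideanSpace ℝ (Fin n) → ℝ, IsNormalizedMinimizer n p ε Ω uε →
          ∀ x ∈ {x ∈ Ω | δ < Metric.infDist x (frontier Ω)}, τ ≤ uε x := by
  intro δ hδ
  rcases Ω.eq_empty_or_nonempty with hemp | hΩne
  · refine ⟨1, 1, one_pos, one_pos, ?_⟩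
    intro ε _ _ uε _ x hx
    have := hx.1
    rw [hemp] at this
    exact absurd this (notMem_empty x)
  have hfin : volume Ω < ⊤ := hΩb.measure_lt_top
  obtain ⟨C, hC0, hC1, hC2⟩ := gauss_compare n Ω hΩo hΩb
  haveI iv : IsFiniteMeasure ((volume : Measure (EuclideanSpace ℝ (Fin n))).restrict Ω) :=
    ⟨by rw [Measure.restrict_apply_univ]; exact hfin⟩
  haveI ig : IsFiniteMeasure ((gaussianMeasure n).restrict Ω) := isFiniteMeasure_of_le _ hC2
  have hne : (Ωᶜ).Nonempty := by
    haveI : Nonempty (Fin n) := ⟨⟨0, by omega⟩⟩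
    haveI : Nontrivial (EuclideanSpace ℝ (Fin n)) := inferInstance
    rw [nonempty_compl]
    rintro rfl
    exact NormedSpace.unbounded_univ ℝ (EuclideanSpace ℝ (Fin n)) hΩb
  obtain ⟨v, hv, hv1⟩ := exists_normalized_test n p hp Ω hΩo hC1 hΩne
  have hΛ : 0 ≤ Jeps n p 1 Ω v := by
    rw [Jeps_eq]
    exact integral_nonneg fun x => Fe_nonneg zero_le_one
  obtain ⟨k, θ, hk, hθ, hbase⟩ := base_est n hn p hp Ω hΩo hΩb hC0 hC1 hC2 _ hΛ
  obtain ⟨d, hd, hdδ, hdm⟩ := inner_measure n Ω hΩo hΩb hne (θ / 2) (δ / 2) (by positivity)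
    (by positivity)
  set D : Set (EuclideanSpace ℝ (Fin n)) := {x | d < infDist x Ωᶜ} with hD
  have hDo : IsOpen D := isOpen_lt continuous_const (continuous_infDist_pt _)
  have hDc : Convex ℝ D := inner_convex n Ω hΩconv hne d
  have hDΩ : D ⊆ Ω := by
    intro x hx
    by_contra hxn
    have h0 : infDist x Ωᶜ = 0 := infDist_zero_of_mem hxn
    have : d < infDist x Ωᶜ := hx
    linarith
  obtain ⟨η, L, hη, hηc, hηs, hη0, hη1, hηL, hηD⟩ := inner_cutoff n Ω hΩb d hd
  obtain ⟨K, hK⟩ := log_grad n p hp Ω hΩo hΩb hC1 hC2 hη hηc hηs hη0 hη1 hηL hDo hηD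
  obtain ⟨ν, hν, hdg⟩ := de_giorgi n hn p hp Ω hΩo hΩb hC1 hC2 d hd
  obtain ⟨κ, hκ, hls⟩ := log_small n p Ω hΩo hΩb hDo hDc hDΩ K k (θ / 2) ν hk (by positivity) hν
  refine ⟨1, κ / 2, one_pos, by positivity, ?_⟩
  intro ε hε hε1 uε huε x hx
  have hG := good_of_min n p ε Ω hΩo (lambda_pos n p hp Ω v hv hv1 ε hε) uε huε
  set u := Ω.indicator uε with hu
  have h1 := hbase ε hε.le u hG (lambda_upper n p hp Ω v hv hv1 ε hε.le hε1.le)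
  have hsub : {x | k ≤ u x} ⊆ (D ∩ {x | k ≤ u x}) ∪ (Ω \ D) := by
    intro y hy
    by_cases hyD : y ∈ D
    · exact Or.inl ⟨hyD, hy⟩
    · refine Or.inr ⟨?_, hyD⟩
      by_contra hyn
      have h0 : u y = 0 := indicator_of_notMem hyn _
      have hy' : k ≤ u y := hy
      linarith
  have hDf : volume D < ⊤ := (measure_mono hDΩ).trans_lt hfin
  have hf1 : volume (D ∩ {x | k ≤ u x}) < ⊤ := (measure_mono inter_subset_left).trans_lt hDf
  have hf2 : volume (Ω \ D) < ⊤ := (measure_mono sdiff_subset).trans_lt hfin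
  have h2 : (volume : Measure (EuclideanSpace ℝ (Fin n))).real {x | k ≤ u x} ≤
      (volume : Measure (EuclideanSpace ℝ (Fin n))).real (D ∩ {x | k ≤ u x}) +
      (volume : Measure (EuclideanSpace ℝ (Fin n))).real (Ω \ D) :=
    (measureReal_mono hsub
      ((measure_union_le _ _).trans_lt (ENNReal.add_lt_top.2 ⟨hf1, hf2⟩)).ne).trans
      (measureReal_union_le _ _)
  have h3 := hls ε u hG (hK ε hε.le hε1.le u hG) (by linarith)
  have hbδ : closedBall x δ ⊆ Ω := ball_in n Ω x hx.1 δ hx.2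
  have hxd : δ ≤ infDist x Ωᶜ := by
    rw [le_infDist hne]
    intro z hz
    by_contra hc
    push Not at hc
    exact hz (hbδ (mem_closedBall'.2 hc.le))
  have hbD : ball x d ⊆ D := by
    intro y hy
    have hy' : dist x y < d := mem_ball'.1 hy
    have h4 : infDist x Ωᶜ ≤ infDist y Ωᶜ + dist x y := infDist_le_infDist_add_dist
    show d < infDist y Ωᶜ
    linarith
  have h5 : (volume : Measure (EuclideanSpace ℝ (Fin n))).real (ball x d ∩ {x | u x < κ}) ≤ ν :=
    (measureReal_mono (inter_subset_inter_left _ hbD)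
      ((measure_mono inter_subset_left).trans_lt hDf).ne).trans h3
  have h6 := hdg ε hε.le hε1.le u hG x
    ((closedBall_subset_closedBall (by linarith)).trans hbδ) κ hκ h5
  rwa [hu, indicator_of_mem hx.1] at h6
end

section
/- (Concavity maximum principle for the regularized problem.) Let n ≥ 2, p > 1, ε > 0, λ ∈ ℝ, let Ω ⊂ ℝⁿ be a bounded convex open set, and let δ > 0 be such that Ω_δ is nonempty. Let u be a positive C^∞ function on an open neighborhood of cl(Ω_δ) satisfying there the classical equation div[(ε u² + ‖∇u‖²)^{(p-2)/2} ∇u] − ⟨x, ∇u⟩ (ε u² + ‖∇u‖²)^{(p-2)/2} = −λ u^{p-1} + ε (ε u² + ‖∇u‖²)^{(p-2)/2} u. Set v = −log u and define the concavity function c(x, y, t) = v((1−t)x + t y) − (1−t) v(x) − t v(y) for (x, y, t) ∈ cl(Ω_δ) × cl(Ω_δ) × [0,1]. If the maximum of c over cl(Ω_δ) × cl(Ω_δ) × [0,1] is positive, then it is attained at some point (x̄, ȳ, t̄) with (x̄, ȳ) ∈ ∂(Ω_δ × Ω_δ), i.e. with x̄ ∈ ∂Ω_δ or ȳ ∈ ∂Ω_δ.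 -/
open MeasureTheory Real Set Metric Bornology
open scoped RealInnerProductSpace Pointwise NNReal Topology

noncomputable def trE (n : ℕ) (S : EuclideanSpace ℝ (Fin n) →L[ℝ] EuclideanSpace ℝ (Fin n)) : ℝ :=
  ∑ i : Fin n, (S (EuclideanSpace.single i 1)) i

noncomputable def PhiE (n : ℕ) (p ε lam : ℝ)
    (h : EuclideanSpace ℝ (Fin n) →L[ℝ] EuclideanSpace ℝ (Fin n))
    (x q : EuclideanSpace ℝ (Fin n)) : ℝ :=
  (ε + ‖q‖ ^ 2) * trE n h + (p - 2) * ⟪h q, q⟫ - (p - 1) * (ε + ‖q‖ ^ 2) * ‖q‖ ^ 2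
    - (ε + ‖q‖ ^ 2) * ⟪x, q⟫ - lam * (ε + ‖q‖ ^ 2) ^ (1 - (p - 2) / 2) + ε * (ε + ‖q‖ ^ 2)

theorem second_test (f f' : ℝ → ℝ) (f'' : ℝ) (hf : ∀ᶠ r in 𝓝 0, HasDerivAt f (f' r) r)
    (hf' : HasDerivAt f' f'' 0) (hm : IsLocalMax f 0) : f'' ≤ 0 := by
  by_contra hpos
  push Not at hpos
  have hd : deriv f =ᶠ[𝓝 0] f' := hf.mono fun r hr => hr.deriv
  have h2 : deriv (deriv f) 0 = f'' := by rw [hd.deriv_eq]; exact hf'.deriv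
  have hmin : IsLocalMin f 0 := isLocalMin_of_deriv_deriv_pos (by rw [h2]; exact hpos)
    hm.deriv_eq_zero hf.self_of_nhds.continuousAt
  have hcst : f =ᶠ[𝓝 0] fun _ => f 0 := by
    filter_upwards [hm, hmin] with r h1 h2 using le_antisymm h1 h2
  have h3 := hcst.deriv.deriv_eq
  rw [h2] at h3
  simp at h3
  linarith

theorem trace_est (n : ℕ) (p ε κ : ℝ) (hp : 1 < p) (hε : 0 < ε) (hκ : 0 ≤ κ)
    (S : EuclideanSpace ℝ (Fin n) →L[ℝ] EuclideanSpace ℝ (Fin n))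
    (e q : EuclideanSpace ℝ (Fin n)) (he : ‖e‖ = 1)
    (hS : ∀ ξ, ⟪S ξ, ξ⟫ ≤ - κ * ⟪e, ξ⟫ ^ 2) :
    (ε + ‖q‖ ^ 2) * trE n S + (p - 2) * ⟪S q, q⟫ ≤ - ε * κ := by
  have hq : (∑ i : Fin n, q i * q i) = ‖q‖ ^ 2 := by
    rw [EuclideanSpace.norm_sq_eq]; simp [sq]
  have hee : (∑ i : Fin n, e i ^ 2) = 1 := by
    have := EuclideanSpace.norm_sq_eq e
    rw [he] at this; simp at this; exact this.symm
  have htr : trE n S ≤ - κ := by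
    unfold trE
    have : ∀ i : Fin n, (S (EuclideanSpace.single i 1)) i ≤ - κ * e i ^ 2 := by
      intro i
      have := hS (EuclideanSpace.single i 1)
      simpa [EuclideanSpace.inner_single_right] using this
    calc _ ≤ ∑ i : Fin n, - κ * e i ^ 2 := Finset.sum_le_sum fun i _ => this i
      _ = - κ := by rw [← Finset.mul_sum, hee]; ring
  have hneg : ∀ ξ, ⟪S ξ, ξ⟫ ≤ 0 := fun ξ => (hS ξ).trans (by nlinarith [sq_nonneg ⟪e, ξ⟫])
  have hq1 : (∑ i : Fin n, q i * ⟪S (EuclideanSpace.single i 1), q⟫) = ⟪S q, q⟫ := by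
    conv_rhs => rw [← (EuclideanSpace.basisFun (Fin n) ℝ).sum_repr q]
    simp only [EuclideanSpace.basisFun_repr, EuclideanSpace.basisFun_apply, map_sum, map_smul]
    rw [sum_inner]
    simp only [real_inner_smul_left]
    congr 1; ext i; congr 2
    conv_lhs => rw [← (EuclideanSpace.basisFun (Fin n) ℝ).sum_repr q]
    simp
  have hq2 : (∑ i : Fin n, q i * (S q) i) = ⟪S q, q⟫ := by
    simp [PiLp.inner_apply]
  have key : ‖q‖ ^ 2 * trE n S ≤ ⟪S q, q⟫ := by
    by_cases hq0 : q = 0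
    · simp [hq0]
    have hpos : 0 < ‖q‖ ^ 2 := by positivity
    have hs : (∑ i : Fin n, ⟪S (‖q‖ ^ 2 • EuclideanSpace.single i 1 - q i • q),
        ‖q‖ ^ 2 • EuclideanSpace.single i 1 - q i • q⟫) ≤ 0 :=
      Finset.sum_nonpos fun i _ => hneg _
    have : (∑ i : Fin n, ⟪S (‖q‖ ^ 2 • EuclideanSpace.single i 1 - q i • q),
        ‖q‖ ^ 2 • EuclideanSpace.single i 1 - q i • q⟫)
        = ‖q‖ ^ 2 * (‖q‖ ^ 2 * trE n S - ⟪S q, q⟫) := by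
      have h1 : ∀ i : Fin n, ⟪S (‖q‖ ^ 2 • EuclideanSpace.single i 1 - q i • q),
        ‖q‖ ^ 2 • EuclideanSpace.single i 1 - q i • q⟫
        = ‖q‖ ^ 2 * ‖q‖ ^ 2 * (S (EuclideanSpace.single i 1)) i
          - ‖q‖ ^ 2 * (q i * ⟪S (EuclideanSpace.single i 1), q⟫)
          - ‖q‖ ^ 2 * (q i * (S q) i) + ⟪S q, q⟫ * (q i * q i) := by
        intro i
        simp only [map_sub, map_smul, inner_sub_left, inner_sub_right, real_inner_smul_left,
          real_inner_smul_right, EuclideanSpace.inner_single_right]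
        simp
        ring
      simp only [h1]
      rw [Finset.sum_add_distrib, Finset.sum_sub_distrib, Finset.sum_sub_distrib,
        ← Finset.mul_sum, ← Finset.mul_sum, ← Finset.mul_sum, ← Finset.mul_sum, hq1, hq2, hq]
      unfold trE; ring
    rw [this] at hs
    nlinarith
  nlinarith [hneg q]

theorem phi_lip (n : ℕ) (p ε lam R : ℝ) (hε : 0 < ε) :
    ∃ C : ℝ, 0 ≤ C ∧ ∀ (h : EuclideanSpace ℝ (Fin n) →L[ℝ] EuclideanSpace ℝ (Fin n))
      (x q q' : EuclideanSpace ℝ (Fin n)), ‖h‖ ≤ R → ‖x‖ ≤ R → ‖q‖ ≤ R → ‖q'‖ ≤ R →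
      |PhiE n p ε lam h x q - PhiE n p ε lam h x q'| ≤ C * ‖q - q'‖ := by
  set Ψ : (EuclideanSpace ℝ (Fin n) →L[ℝ] EuclideanSpace ℝ (Fin n)) ×
    EuclideanSpace ℝ (Fin n) × EuclideanSpace ℝ (Fin n) → ℝ :=
    fun z => PhiE n p ε lam z.1 z.2.1 z.2.2 with hΨ
  have hsm : ContDiff ℝ 1 Ψ := by
    rw [hΨ]
    unfold PhiE trE
    have hW : ContDiff ℝ 1 (fun z : (EuclideanSpace ℝ (Fin n) →L[ℝ] EuclideanSpace ℝ (Fin n)) ×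
      EuclideanSpace ℝ (Fin n) × EuclideanSpace ℝ (Fin n) => ε + ‖z.2.2‖ ^ 2) :=
      contDiff_const.add (contDiff_snd.snd.norm_sq ℝ)
    have hWr := hW.rpow_const_of_ne (p := 1 - (p - 2) / 2) (fun x => by positivity)
    have hN : ContDiff ℝ 1 (fun z : (EuclideanSpace ℝ (Fin n) →L[ℝ] EuclideanSpace ℝ (Fin n)) ×
      EuclideanSpace ℝ (Fin n) × EuclideanSpace ℝ (Fin n) => ‖z.2.2‖ ^ 2) :=
      (contDiff_snd.snd.norm_sq ℝ)
    have hT : ContDiff ℝ 1 (fun z : (EuclideanSpace ℝ (Fin n) →L[ℝ] EuclideanSpace ℝ (Fin n)) ×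
      EuclideanSpace ℝ (Fin n) × EuclideanSpace ℝ (Fin n) =>
        ∑ i : Fin n, (z.1 (EuclideanSpace.single i 1)) i) := by
      apply ContDiff.sum
      intro i _
      exact (contDiff_euclidean.1 (contDiff_fst.clm_apply contDiff_const)) i
    have hI : ContDiff ℝ 1 (fun z : (EuclideanSpace ℝ (Fin n) →L[ℝ] EuclideanSpace ℝ (Fin n)) ×
      EuclideanSpace ℝ (Fin n) × EuclideanSpace ℝ (Fin n) => ⟪z.1 z.2.2, z.2.2⟫) :=
      (contDiff_fst.clm_apply contDiff_snd.snd).inner ℝ contDiff_snd.snd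
    have hJ : ContDiff ℝ 1 (fun z : (EuclideanSpace ℝ (Fin n) →L[ℝ] EuclideanSpace ℝ (Fin n)) ×
      EuclideanSpace ℝ (Fin n) × EuclideanSpace ℝ (Fin n) => ⟪z.2.1, z.2.2⟫) :=
      contDiff_snd.fst.inner ℝ contDiff_snd.snd
    exact (((((hW.mul hT).add (contDiff_const.mul hI)).sub ((contDiff_const.mul hW).mul hN)).sub
      (hW.mul hJ)).sub (contDiff_const.mul hWr)).add (contDiff_const.mul hW)
  obtain ⟨C, hC⟩ := (isCompact_closedBall
    (0 : (EuclideanSpace ℝ (Fin n) →L[ℝ] EuclideanSpace ℝ (Fin n)) ×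
    EuclideanSpace ℝ (Fin n) × EuclideanSpace ℝ (Fin n)) R).exists_bound_of_continuousOn
      (hsm.continuous_fderiv one_ne_zero).continuousOn
  refine ⟨max C 0, le_max_right _ _, fun h x q q' hh hx hq hq' => ?_⟩
  have := (convex_closedBall (0 : (EuclideanSpace ℝ (Fin n) →L[ℝ] EuclideanSpace ℝ (Fin n)) ×
    EuclideanSpace ℝ (Fin n) × EuclideanSpace ℝ (Fin n)) R).norm_image_sub_le_of_norm_fderiv_le
      (𝕜 := ℝ) (fun z _ => (hsm.differentiable (by norm_num)) z)
      (fun z hz => (hC z hz).trans (le_max_left C 0))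
      (x := (h, x, q')) (y := (h, x, q)) (by simp [Prod.norm_def, *]) (by simp [Prod.norm_def, *])
  simpa [Prod.norm_def, hΨ] using this

theorem conv_aux (n : ℕ) (Ω : Set (EuclideanSpace ℝ (Fin n)))
    (hΩo : IsOpen Ω) (hΩconv : Convex ℝ Ω)
    (δ : ℝ) (hδ : 0 < δ) :
    Convex ℝ {x ∈ Ω | δ < Metric.infDist x (frontier Ω)} := by
  have hball : ∀ x ∈ {x ∈ Ω | δ < Metric.infDist x (frontier Ω)},
      ball x (infDist x (frontier Ω)) ⊆ Ω := by
    rintro x ⟨hx, hd⟩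
    have hpc : IsPreconnected (ball x (infDist x (frontier Ω))) :=
      (convex_ball _ _).isPreconnected
    have hnf : ∀ w ∈ ball x (infDist x (frontier Ω)), w ∉ frontier Ω := by
      intro w hw hw2
      have h1 := infDist_le_dist_of_mem (x := x) hw2
      rw [mem_ball, dist_comm] at hw
      linarith
    intro y hy
    by_contra hyn
    have hcl : ∀ w ∈ ball x (infDist x (frontier Ω)), w ∉ Ω → w ∈ (closure Ω)ᶜ := by
      intro w hw hwn hwc
      exact hnf w hw (by rw [hΩo.frontier_eq]; exact ⟨hwc, hwn⟩)
    obtain ⟨w, _, hw1, hw2⟩ := hpc Ω (closure Ω)ᶜ hΩo isClosed_closure.isOpen_compl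
      (fun w hw => by
        by_cases h : w ∈ Ω
        · exact Or.inl h
        · exact Or.inr (hcl w hw h))
      ⟨x, mem_ball_self (hδ.trans hd), hx⟩ ⟨y, hy, hcl y hy hyn⟩
    exact hw2 (subset_closure hw1)
  intro x hx y hy a b ha hb hab
  have hfne : (frontier Ω).Nonempty := by
    by_contra h
    rw [Set.not_nonempty_iff_eq_empty] at h
    have := hx.2
    rw [h, infDist_empty] at this
    linarith
  have hz : ∀ w ∈ ball (a • x + b • y) (min (infDist x (frontier Ω)) (infDist y (frontier Ω))),
      w ∈ Ω := by
    intro w hw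
    rw [mem_ball, lt_min_iff] at hw
    have h1 : x + (w - (a • x + b • y)) ∈ Ω := hball x hx (by
      rw [mem_ball, dist_eq_norm, add_sub_cancel_left, ← dist_eq_norm]; exact hw.1)
    have h2 : y + (w - (a • x + b • y)) ∈ Ω := hball y hy (by
      rw [mem_ball, dist_eq_norm, add_sub_cancel_left, ← dist_eq_norm]; exact hw.2)
    have := hΩconv h1 h2 ha hb hab
    convert this using 1
    obtain rfl : a = 1 - b := by linarith
    module
  refine ⟨hΩconv hx.1 hy.1 ha hb hab, ?_⟩
  refine (lt_min hx.2 hy.2).trans_le ?_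
  rw [le_infDist hfne]
  intro w hw
  by_contra hlt
  push Not at hlt
  have := hz w (by rw [mem_ball, dist_comm]; exact hlt)
  rw [hΩo.frontier_eq] at hw
  exact hw.2 this

theorem grad_v (n : ℕ) (u : EuclideanSpace ℝ (Fin n) → ℝ) (x : EuclideanSpace ℝ (Fin n))
    (hd : DifferentiableAt ℝ u x) (hpos : 0 < u x) :
    gradient u x = (- u x) • gradient (fun y => - Real.log (u y)) x := by
  have h1 : HasFDerivAt (fun y => - Real.log (u y)) (-((u x)⁻¹ • fderiv ℝ u x)) x :=
    (hd.hasFDerivAt.log hpos.ne').neg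
  unfold gradient
  rw [h1.fderiv]
  simp only [map_neg, map_smul, smul_neg, neg_smul, neg_neg]
  rw [smul_smul, mul_inv_cancel₀ hpos.ne', one_smul]

theorem v_smooth (n : ℕ) (V : Set (EuclideanSpace ℝ (Fin n))) (hVo : IsOpen V)
    (u : EuclideanSpace ℝ (Fin n) → ℝ)
    (hu : ContDiffOn ℝ (⊤ : ℕ∞) u V) (hupos : ∀ x ∈ V, 0 < u x) :
    ContDiffOn ℝ (⊤ : ℕ∞) (gradient (fun y => - Real.log (u y))) V := by
  have h1 : ContDiffOn ℝ (⊤ : ℕ∞) (fun y => - Real.log (u y)) V :=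
    (hu.log fun x hx => (hupos x hx).ne').neg
  have h2 := h1.fderiv_of_isOpen (m := (⊤ : ℕ∞)) hVo (by simp)
  exact (InnerProductSpace.toDual ℝ (EuclideanSpace ℝ (Fin n))).symm.contDiff.comp_contDiffOn h2

theorem pde_v (n : ℕ) (p : ℝ) (ε : ℝ) (hε : 0 < ε) (lam : ℝ)
    (V : Set (EuclideanSpace ℝ (Fin n))) (hVo : IsOpen V)
    (u : EuclideanSpace ℝ (Fin n) → ℝ)
    (hu : ContDiffOn ℝ (⊤ : ℕ∞) u V) (hupos : ∀ x ∈ V, 0 < u x)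
    (x : EuclideanSpace ℝ (Fin n)) (hx : x ∈ V)
    (hpde : (∑ i : Fin n, (fderiv ℝ
          (fun y => ((ε * u y ^ 2 + ‖gradient u y‖ ^ 2) ^ ((p - 2) / 2)) • gradient u y) x
          (EuclideanSpace.single i 1)) i)
        - ⟪x, gradient u x⟫ * (ε * u x ^ 2 + ‖gradient u x‖ ^ 2) ^ ((p - 2) / 2)
      = -lam * u x ^ (p - 1)
        + ε * (ε * u x ^ 2 + ‖gradient u x‖ ^ 2) ^ ((p - 2) / 2) * u x) :
    PhiE n p ε lam (fderiv ℝ (gradient (fun y => - Real.log (u y))) x) x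
      (gradient (fun y => - Real.log (u y)) x) = 0 := by
  set g := gradient (fun y => - Real.log (u y)) with hg
  set H := fderiv ℝ g x with hH
  have hud : ∀ y ∈ V, DifferentiableAt ℝ u y := fun y hy =>
    (hu.differentiableOn (by simp)).differentiableAt (hVo.mem_nhds hy)
  have hgu : ∀ y ∈ V, gradient u y = (- u y) • g y := fun y hy =>
    grad_v n u y (hud y hy) (hupos y hy)
  have hgd : HasFDerivAt g H x :=
    (((v_smooth n V hVo u hu hupos).differentiableOn (by simp)).differentiableAt
      (hVo.mem_nhds hx)).hasFDerivAt
  have hWpos : ∀ y, 0 < ε + ‖g y‖ ^ 2 := fun y => by positivity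
  have hpow : ∀ y ∈ V, (ε * u y ^ 2 + ‖gradient u y‖ ^ 2) ^ ((p - 2) / 2)
      = u y ^ (p - 2) * (ε + ‖g y‖ ^ 2) ^ ((p - 2) / 2) := by
    intro y hy
    have hp0 := hupos y hy
    rw [hgu y hy, norm_smul, norm_neg, Real.norm_eq_abs, mul_pow, sq_abs,
      show ε * u y ^ 2 + u y ^ 2 * ‖g y‖ ^ 2 = u y ^ 2 * (ε + ‖g y‖ ^ 2) by ring,
      Real.mul_rpow (by positivity) (hWpos y).le]
    congr 1
    rw [← Real.rpow_natCast, ← Real.rpow_mul hp0.le]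
    congr 1
    push_cast; ring
  have hup1 : ∀ y ∈ V, u y ^ (p - 2) * u y = u y ^ (p - 1) := by
    intro y hy
    rw [← Real.rpow_add_one (hupos y hy).ne']; congr 1; ring
  have hev : (fun y => ((ε * u y ^ 2 + ‖gradient u y‖ ^ 2) ^ ((p - 2) / 2)) • gradient u y)
      =ᶠ[𝓝 x] fun y => (-(u y ^ (p - 1) * (ε + ‖g y‖ ^ 2) ^ ((p - 2) / 2))) • g y := by
    filter_upwards [hVo.mem_nhds hx] with y hy
    rw [hpow y hy, ← hup1 y hy, hgu y hy, smul_smul]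
    congr 1; ring
  have hux := hupos x hx
  have hdu : ∀ ξ, fderiv ℝ u x ξ = - u x * ⟪g x, ξ⟫ := by
    intro ξ
    have : ⟪gradient u x, ξ⟫ = fderiv ℝ u x ξ := by
      unfold gradient; simp
    rw [← this, hgu x hx, real_inner_smul_left]
  have hs := (((hud x hx).hasFDerivAt.rpow_const (p := p - 1) (Or.inl hux.ne')).mul
    ((hgd.norm_sq.const_add ε).rpow_const (p := (p - 2) / 2) (Or.inl (hWpos x).ne'))).neg
  have hF := hs.smul hgd
  have hFd := hF.fderiv
  rw [hev.fderiv_eq] at hpde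
  erw [hFd] at hpde
  have hqsum : (∑ i : Fin n, g x i * g x i) = ‖g x‖ ^ 2 := by
    rw [EuclideanSpace.norm_sq_eq]; simp [sq]
  have hHq : (∑ i : Fin n, ⟪g x, H (EuclideanSpace.single i 1)⟫ * g x i) = ⟪H (g x), g x⟫ := by
    have : H (g x) = ∑ i, g x i • H (EuclideanSpace.single i 1) := by
      conv_lhs => rw [← (EuclideanSpace.basisFun (Fin n) ℝ).sum_repr (g x)]
      simp
    rw [this, sum_inner]
    refine Finset.sum_congr rfl fun i _ => ?_
    rw [real_inner_smul_left, real_inner_comm]; ring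
  rw [hpow x hx, hgu x hx, real_inner_smul_right] at hpde
  simp [hdu, EuclideanSpace.inner_single_right] at hpde
  have hsplit : ∀ i : Fin n,
      (-(u x ^ (p - 1) * (ε + ‖g x‖ ^ 2) ^ ((p - 2) / 2) * (H (EuclideanSpace.single i 1)).ofLp i) +
          ((ε + ‖g x‖ ^ 2) ^ ((p - 2) / 2) * ((p - 1) * u x ^ (p - 1 - 1) * (u x * (g x).ofLp i)) +
              -(u x ^ (p - 1) *
                  ((p - 2) / 2 * (ε + ‖g x‖ ^ 2) ^ ((p - 2) / 2 - 1) *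
                    (2 * ⟪g x, H (EuclideanSpace.single i 1)⟫)))) *
            (g x).ofLp i)
      = -(u x ^ (p - 1) * (ε + ‖g x‖ ^ 2) ^ ((p - 2) / 2)) *
          (H (EuclideanSpace.single i 1)).ofLp i
        + ((ε + ‖g x‖ ^ 2) ^ ((p - 2) / 2) * (p - 1) * (u x ^ (p - 2) * u x)) *
          ((g x).ofLp i * (g x).ofLp i)
        - (u x ^ (p - 1) * (p - 2) * (ε + ‖g x‖ ^ 2) ^ ((p - 2) / 2 - 1)) *
          (⟪g x, H (EuclideanSpace.single i 1)⟫ * (g x).ofLp i) := by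
    intro i
    rw [show p - 1 - 1 = p - 2 by ring]
    ring
  simp only [hsplit] at hpde
  rw [Finset.sum_sub_distrib, Finset.sum_add_distrib, ← Finset.mul_sum, ← Finset.mul_sum,
    ← Finset.mul_sum, hqsum, hHq, hup1 x hx] at hpde
  have hU := hup1 x hx
  have hUpos : 0 < u x ^ (p - 1) := Real.rpow_pos_of_pos hux _
  have hW0 := hWpos x
  have e1 : (ε + ‖g x‖ ^ 2) ^ (1 - (p - 2) / 2) * (ε + ‖g x‖ ^ 2) ^ ((p - 2) / 2)
      = ε + ‖g x‖ ^ 2 := by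
    rw [← Real.rpow_add hW0]; simp
  have e2 : (ε + ‖g x‖ ^ 2) ^ (1 - (p - 2) / 2) * (ε + ‖g x‖ ^ 2) ^ ((p - 2) / 2 - 1) = 1 := by
    rw [← Real.rpow_add hW0]; simp
  change _ * trE n H + _ - _ + _ = _ at hpde
  unfold PhiE
  generalize (ε + ‖g x‖ ^ 2) ^ (1 - (p - 2) / 2) = Wp at *
  generalize (ε + ‖g x‖ ^ 2) ^ ((p - 2) / 2) = Wm at *
  generalize (ε + ‖g x‖ ^ 2) ^ ((p - 2) / 2 - 1) = W1 at *
  generalize u x ^ (p - 1) = U at *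
  generalize u x ^ (p - 2) = U2 at *
  generalize trE n H = T at *
  generalize ⟪H (g x), g x⟫ = h at *
  generalize ⟪x, g x⟫ = j at *
  generalize ‖g x‖ ^ 2 = N at *
  have h1 : -Wm * T + Wm * (p - 1) * N - (p - 2) * W1 * h + j * Wm + lam - ε * Wm = 0 := by
    apply mul_left_cancel₀ hUpos.ne'
    linear_combination hpde - (j * Wm - ε * Wm) * hU
  linear_combination (-Wp) * h1 - (T - (p - 1) * N - j + ε) * e1 - (p - 2) * h * e2

theorem line_d1 (n : ℕ) (V : Set (EuclideanSpace ℝ (Fin n))) (hVo : IsOpen V)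
    (v : EuclideanSpace ℝ (Fin n) → ℝ) (hd : ∀ x ∈ V, DifferentiableAt ℝ v x)
    (a ξ : EuclideanSpace ℝ (Fin n)) (ha : a ∈ V) :
    ∀ᶠ r : ℝ in 𝓝 0, HasDerivAt (fun r : ℝ => v (a + r • ξ)) ⟪gradient v (a + r • ξ), ξ⟫ r := by
  have hcont : Continuous fun r : ℝ => a + r • ξ := by fun_prop
  have hmem : ∀ᶠ r : ℝ in 𝓝 0, a + r • ξ ∈ V :=
    hcont.continuousAt.eventually_mem (by simpa using hVo.mem_nhds ha)
  filter_upwards [hmem] with r hr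
  have h1 : HasDerivAt (fun r : ℝ => a + r • ξ) ξ r := by
    simpa using ((hasDerivAt_id r).smul_const ξ).const_add a
  have := (hd _ hr).hasFDerivAt.comp_hasDerivAt r h1
  have he : ⟪gradient v (a + r • ξ), ξ⟫ = fderiv ℝ v (a + r • ξ) ξ := by
    unfold gradient; simp
  rw [he]
  exact this

theorem line_d2 (n : ℕ)
    (g : EuclideanSpace ℝ (Fin n) → EuclideanSpace ℝ (Fin n))
    (a ξ : EuclideanSpace ℝ (Fin n)) (hd : DifferentiableAt ℝ g a) :
    HasDerivAt (fun r : ℝ => ⟪g (a + r • ξ), ξ⟫) ⟪fderiv ℝ g a ξ, ξ⟫ 0 := by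
  have h1 : HasDerivAt (fun r : ℝ => a + r • ξ) ξ 0 := by
    simpa using ((hasDerivAt_id (0 : ℝ)).smul_const ξ).const_add a
  have h2 : HasFDerivAt g (fderiv ℝ g a) (a + (0 : ℝ) • ξ) := by simpa using hd.hasFDerivAt
  have h3 := (h2.comp_hasDerivAt 0 h1).inner ℝ (hasDerivAt_const (0 : ℝ) ξ)
  simpa using h3

theorem curve_test (n : ℕ) (V : Set (EuclideanSpace ℝ (Fin n))) (hVo : IsOpen V)
    (v : EuclideanSpace ℝ (Fin n) → ℝ) (hd : ∀ x ∈ V, DifferentiableAt ℝ v x)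
    (hd2 : ∀ x ∈ V, DifferentiableAt ℝ (gradient v) x)
    (x y z e ξ ζ : EuclideanSpace ℝ (Fin n)) (hx : x ∈ V) (hy : y ∈ V) (hz : z ∈ V)
    (t η k : ℝ)
    (hm : IsLocalMax (fun r : ℝ => v (z + r • ((1 - t) • ξ + t • ζ)) - (1 - t) * v (x + r • ξ)
      - t * v (y + r • ζ) + η * Real.exp (k * ⟪e, x + r • ξ⟫)) 0) :
    ⟪gradient v z, (1 - t) • ξ + t • ζ⟫ - (1 - t) * ⟪gradient v x, ξ⟫
      - t * ⟪gradient v y, ζ⟫ + η * Real.exp (k * ⟪e, x⟫) * (k * ⟪e, ξ⟫) = 0 ∧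
    ⟪fderiv ℝ (gradient v) z ((1 - t) • ξ + t • ζ), (1 - t) • ξ + t • ζ⟫
      - (1 - t) * ⟪fderiv ℝ (gradient v) x ξ, ξ⟫
      - t * ⟪fderiv ℝ (gradient v) y ζ, ζ⟫
      + η * Real.exp (k * ⟪e, x⟫) * (k * ⟪e, ξ⟫) ^ 2 ≤ 0 := by
  have hE0 : ∀ r : ℝ, HasDerivAt (fun r : ℝ => k * ⟪e, x + r • ξ⟫) (k * ⟪e, ξ⟫) r := by
    intro r
    simp only [inner_add_right, real_inner_smul_right]
    have := (((hasDerivAt_id r).mul_const ⟪e, ξ⟫).const_add ⟪e, x⟫).const_mul k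
    simpa using this
  have h1 : ∀ᶠ r : ℝ in 𝓝 0, HasDerivAt (fun r : ℝ => v (z + r • ((1 - t) • ξ + t • ζ))
      - (1 - t) * v (x + r • ξ) - t * v (y + r • ζ) + η * Real.exp (k * ⟪e, x + r • ξ⟫))
      (⟪gradient v (z + r • ((1 - t) • ξ + t • ζ)), (1 - t) • ξ + t • ζ⟫
        - (1 - t) * ⟪gradient v (x + r • ξ), ξ⟫ - t * ⟪gradient v (y + r • ζ), ζ⟫
        + η * (Real.exp (k * ⟪e, x + r • ξ⟫) * (k * ⟪e, ξ⟫))) r := by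
    filter_upwards [line_d1 n V hVo v hd z ((1 - t) • ξ + t • ζ) hz,
      line_d1 n V hVo v hd x ξ hx, line_d1 n V hVo v hd y ζ hy] with r a1 a2 a3
    exact ((a1.sub (a2.const_mul (1 - t))).sub (a3.const_mul t)).add
      (((hE0 r).exp).const_mul η)
  constructor
  · have := hm.hasDerivAt_eq_zero h1.self_of_nhds
    simp only [zero_smul, add_zero] at this
    linarith
  · have h2 := (((line_d2 n (gradient v) z ((1 - t) • ξ + t • ζ) (hd2 z hz)).sub
      ((line_d2 n (gradient v) x ξ (hd2 x hx)).const_mul (1 - t))).sub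
      ((line_d2 n (gradient v) y ζ (hd2 y hy)).const_mul t)).add
      ((((hE0 0).exp).mul_const (k * ⟪e, ξ⟫)).const_mul η)
    have := second_test _ _ _ h1 h2 hm
    simp only [zero_smul, add_zero] at this
    linarith

/-- **Korevaar-type concavity maximum principle for the regularized equation**
(Proposition 4.8 of the paper): if `u` is a positive smooth classical solution of the
`ε`-regularized weighted `p`-Laplace eigenvalue equation on a neighborhood of `cl(Ω_δ)`
and the concavity function `c` of `v = -log u` has positive maximum on
`cl(Ω_δ) × cl(Ω_δ) × [0,1]`, then this maximum is attained at a point whose space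
components touch `∂Ω_δ`. -/
theorem concavity_maximum_principle
    (n : ℕ) (hn : 2 ≤ n) (p : ℝ) (hp : 1 < p) (ε : ℝ) (hε : 0 < ε) (lam : ℝ)
    (Ω : Set (EuclideanSpace ℝ (Fin n)))
    (hΩo : IsOpen Ω) (hΩb : IsBounded Ω) (hΩconv : Convex ℝ Ω)
    (δ : ℝ) (hδ : 0 < δ)
    (Ωδ : Set (EuclideanSpace ℝ (Fin n)))
    (hΩδ : Ωδ = {x ∈ Ω | δ < Metric.infDist x (frontier Ω)}) (hne : Ωδ.Nonempty)
    (V : Set (EuclideanSpace ℝ (Fin n))) (hVo : IsOpen V) (hV : closure Ωδ ⊆ V)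
    (u : EuclideanSpace ℝ (Fin n) → ℝ)
    (hu : ContDiffOn ℝ (⊤ : ℕ∞) u V) (hupos : ∀ x ∈ V, 0 < u x)
    (hpde : ∀ x ∈ V,
      (∑ i : Fin n, (fderiv ℝ
          (fun y => ((ε * u y ^ 2 + ‖gradient u y‖ ^ 2) ^ ((p - 2) / 2)) • gradient u y) x
          (EuclideanSpace.single i 1)) i)
        - ⟪x, gradient u x⟫ * (ε * u x ^ 2 + ‖gradient u x‖ ^ 2) ^ ((p - 2) / 2)
      = -lam * u x ^ (p - 1)
        + ε * (ε * u x ^ 2 + ‖gradient u x‖ ^ 2) ^ ((p - 2) / 2) * u x)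
    (c : EuclideanSpace ℝ (Fin n) → EuclideanSpace ℝ (Fin n) → ℝ → ℝ)
    (hc : ∀ x y t, c x y t =
      -Real.log (u ((1 - t) • x + t • y))
        - (1 - t) * (-Real.log (u x)) - t * (-Real.log (u y)))
    (xm ym : EuclideanSpace ℝ (Fin n)) (tm : ℝ)
    (hxm : xm ∈ closure Ωδ) (hym : ym ∈ closure Ωδ) (htm : tm ∈ Set.Icc (0 : ℝ) 1)
    (hmax : ∀ x ∈ closure Ωδ, ∀ y ∈ closure Ωδ, ∀ t ∈ Set.Icc (0 : ℝ) 1,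
      c x y t ≤ c xm ym tm)
    (hpos : 0 < c xm ym tm) :
    ∃ x' ∈ closure Ωδ, ∃ y' ∈ closure Ωδ, ∃ t' ∈ Set.Icc (0 : ℝ) 1,
      c x' y' t' = c xm ym tm ∧ (x' ∈ frontier Ωδ ∨ y' ∈ frontier Ωδ) := by
  by_contra hcon
  push Not at hcon
  set v : EuclideanSpace ℝ (Fin n) → ℝ := fun y => - Real.log (u y) with hv
  set g := gradient v with hg
  have hopen : IsOpen Ωδ := by
    rw [hΩδ]
    exact hΩo.inter (isOpen_lt continuous_const (continuous_infDist_pt _))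
  have hconv : Convex ℝ Ωδ := by rw [hΩδ]; exact conv_aux n Ω hΩo hΩconv δ hδ
  have hbdd : IsBounded Ωδ := hΩb.subset (by rw [hΩδ]; exact fun x hx => hx.1)
  have hK : IsCompact (closure Ωδ) := hbdd.isCompact_closure
  have hfr : ∀ x ∈ closure Ωδ, x ∉ frontier Ωδ → x ∈ Ωδ := by
    intro x hx hxn
    by_contra h
    exact hxn (by rw [hopen.frontier_eq]; exact ⟨hx, h⟩)
  have hvs : ContDiffOn ℝ (⊤ : ℕ∞) v V := (hu.log fun x hx => (hupos x hx).ne').neg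
  have hgs : ContDiffOn ℝ (⊤ : ℕ∞) g V := v_smooth n V hVo u hu hupos
  have hvd : ∀ x ∈ V, DifferentiableAt ℝ v x := fun y hy =>
    (hvs.differentiableOn (by simp)).differentiableAt (hVo.mem_nhds hy)
  have hgd : ∀ x ∈ V, DifferentiableAt ℝ g x := fun y hy =>
    (hgs.differentiableOn (by simp)).differentiableAt (hVo.mem_nhds hy)
  have hHc : ContinuousOn (fderiv ℝ g) V := hgs.continuousOn_fderiv_of_isOpen hVo (by simp)
  have hPhi : ∀ x ∈ V, PhiE n p ε lam (fderiv ℝ g x) x (g x) = 0 := fun x hx =>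
    pde_v n p ε hε lam V hVo u hu hupos x hx (hpde x hx)
  have hcv : ∀ x y t, c x y t = v ((1 - t) • x + t • y) - (1 - t) * v x - t * v y := hc
  have ht0 : 0 < tm := by
    rcases htm.1.eq_or_lt with h | h
    · rw [← h, hcv] at hpos; simp at hpos
    · exact h
  have ht1 : tm < 1 := by
    rcases htm.2.eq_or_lt with h | h
    · rw [h, hcv] at hpos; simp at hpos
    · exact h
  obtain ⟨R1, hR1⟩ := hK.exists_bound_of_continuousOn (hHc.mono hV)
  obtain ⟨R2, hR2⟩ := hK.exists_bound_of_continuousOn (hgs.continuousOn.mono hV)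
  obtain ⟨R3, hR3⟩ := hK.exists_bound_of_continuousOn (continuousOn_id (s := closure Ωδ))
  obtain ⟨C, hC0, hC⟩ := phi_lip n p ε lam (max R1 (max R2 R3)) hε
  set k : ℝ := C / ε + 1 with hk
  have hkpos : 0 < k := by positivity
  have hkC : C < ε * k := by rw [hk, mul_add, mul_div_cancel₀ _ hε.ne']; linarith
  set e : EuclideanSpace ℝ (Fin n) := EuclideanSpace.single ⟨0, by omega⟩ 1 with he
  have hen : ‖e‖ = 1 := by rw [he]; simp
  have hψc : Continuous fun x : EuclideanSpace ℝ (Fin n) => Real.exp (k * ⟪e, x⟫) := by fun_prop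
  obtain ⟨P, hP⟩ := hK.exists_bound_of_continuousOn hψc.continuousOn
  have hKc : Convex ℝ (closure Ωδ) := hconv.closure
  have hcc : ContinuousOn (fun w : EuclideanSpace ℝ (Fin n) × EuclideanSpace ℝ (Fin n) =>
      c w.1 w.2 tm) (closure Ωδ ×ˢ closure Ωδ) := by
    simp only [hcv]
    have hvc := hvs.continuousOn.mono hV
    refine ContinuousOn.sub (ContinuousOn.sub ?_ ?_) ?_
    · refine hvc.comp (by fun_prop) fun w hw => ?_
      exact hKc hw.1 hw.2 (by linarith) ht0.le (by ring)
    · exact continuousOn_const.mul (hvc.comp continuousOn_fst fun w hw => hw.1)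
    · exact continuousOn_const.mul (hvc.comp continuousOn_snd fun w hw => hw.2)
  have hBd : IsCompact ((closure Ωδ ×ˢ closure Ωδ) ∩ {w : EuclideanSpace ℝ (Fin n) ×
      EuclideanSpace ℝ (Fin n) | w.1 ∈ frontier Ωδ ∨ w.2 ∈ frontier Ωδ}) := by
    refine (hK.prod hK).inter_right ?_
    exact (isClosed_frontier.preimage continuous_fst).union
      (isClosed_frontier.preimage continuous_snd)
  obtain ⟨a, ha, haB⟩ := hBd.exists_forall_le' (a := - c xm ym tm)
    (hcc.mono inter_subset_left).neg (by
      rintro ⟨x, y⟩ ⟨⟨hx, hy⟩, hb⟩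
      refine neg_lt_neg (lt_of_le_of_ne (hmax x hx y hy tm htm) fun h => ?_)
      have := hcon x hx y hy tm htm h
      rcases hb with hb | hb
      · exact this.1 hb
      · exact this.2 hb)
  have hPpos : 0 < P := lt_of_lt_of_le (norm_pos_iff.2 (Real.exp_pos _).ne') (hP xm hxm)
  set η : ℝ := (c xm ym tm + a) / (2 * P) with hη
  have hηpos : 0 < η := by rw [hη]; apply div_pos <;> linarith
  have hηP : η * P < c xm ym tm + a := by
    have : η * P = (c xm ym tm + a) / 2 := by rw [hη]; field_simp
    rw [this]; linarith
  obtain ⟨⟨x, y⟩, ⟨hx, hy⟩, hxy⟩ := (hK.prod hK).exists_isMaxOn ⟨(xm, ym), hxm, hym⟩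
    (hcc.add ((continuousOn_const (c := η)).mul (hψc.comp continuous_fst).continuousOn))
  have hxy' : ∀ x' ∈ closure Ωδ, ∀ y' ∈ closure Ωδ,
      c x' y' tm + η * Real.exp (k * ⟪e, x'⟫) ≤ c x y tm + η * Real.exp (k * ⟪e, x⟫) := by
    intro x' hx' y' hy'
    exact hxy (a := (x', y')) ⟨hx', hy'⟩
  have hnot : ¬ (x ∈ frontier Ωδ ∨ y ∈ frontier Ωδ) := by
    intro hb
    have h1 : a ≤ - c x y tm := haB (x, y) ⟨⟨hx, hy⟩, hb⟩
    have h2 := hxy' xm hxm ym hym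
    have h3 : 0 < η * Real.exp (k * ⟪e, xm⟫) := by positivity
    have h4 : Real.exp (k * ⟪e, x⟫) ≤ P := (le_abs_self _).trans (hP x hx)
    have h5 := mul_le_mul_of_nonneg_left h4 hηpos.le
    linarith
  push Not at hnot
  have hxO := hfr x hx hnot.1
  have hyO := hfr y hy hnot.2
  set z := (1 - tm) • x + tm • y with hz
  have hzO : z ∈ Ωδ := hconv hxO hyO (by linarith) ht0.le (by ring)
  have hV' : ∀ w ∈ Ωδ, w ∈ V := fun w hw => hV (subset_closure hw)
  have hloc : ∀ ξ ζ : EuclideanSpace ℝ (Fin n),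
      IsLocalMax (fun r : ℝ => v (z + r • ((1 - tm) • ξ + tm • ζ)) - (1 - tm) * v (x + r • ξ)
      - tm * v (y + r • ζ) + η * Real.exp (k * ⟪e, x + r • ξ⟫)) 0 := by
    intro ξ ζ
    have m1 : ∀ᶠ r : ℝ in 𝓝 0, x + r • ξ ∈ Ωδ :=
      (show Continuous fun r : ℝ => x + r • ξ by fun_prop).continuousAt.eventually_mem
        (by simpa using hopen.mem_nhds hxO)
    have m2 : ∀ᶠ r : ℝ in 𝓝 0, y + r • ζ ∈ Ωδ :=
      (show Continuous fun r : ℝ => y + r • ζ by fun_prop).continuousAt.eventually_mem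
        (by simpa using hopen.mem_nhds hyO)
    filter_upwards [m1, m2] with r h1 h2
    have := hxy' _ (subset_closure h1) _ (subset_closure h2)
    rw [hcv, hcv] at this
    simp only [zero_smul, add_zero]
    rw [show z + r • ((1 - tm) • ξ + tm • ζ) = (1 - tm) • (x + r • ξ) + tm • (y + r • ζ) by
      rw [hz]; module]
    exact this
  have htest := fun ξ ζ => curve_test n V hVo v hvd hgd x y z e ξ ζ (hV' x hxO) (hV' y hyO)
    (hV' z hzO) tm η k (hloc ξ ζ)
  set ψ := Real.exp (k * ⟪e, x⟫) with hψ
  have hψpos : 0 < ψ := Real.exp_pos _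
  have hgy : g y = g z := by
    refine ext_inner_right ℝ fun ξ => ?_
    have := (htest 0 ξ).1
    simp only [← hg, smul_zero, zero_add, add_zero, inner_zero_right, mul_zero, sub_zero,
      real_inner_smul_right] at this
    have h2 : tm * (⟪g z, ξ⟫ - ⟪g y, ξ⟫) = 0 := by linarith
    rcases mul_eq_zero.1 h2 with h | h <;> linarith
  have hgx : (1 - tm) • (g z - g x) = - (η * ψ * k) • e := by
    refine ext_inner_right ℝ fun ξ => ?_
    have := (htest ξ 0).1
    simp only [← hg, smul_zero, zero_add, add_zero, inner_zero_right, mul_zero, sub_zero,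
      real_inner_smul_right] at this
    rw [real_inner_smul_left, real_inner_smul_left, inner_sub_left]
    linarith
  have hnorm : (1 - tm) * ‖g z - g x‖ = η * ψ * k := by
    have := congrArg norm hgx
    rw [norm_smul, norm_smul, hen, norm_neg, Real.norm_of_nonneg (by linarith),
      Real.norm_of_nonneg (by positivity)] at this
    linarith
  set D := fderiv ℝ g z - (1 - tm) • fderiv ℝ g x - tm • fderiv ℝ g y with hD
  have hDle : ∀ ξ, ⟪D ξ, ξ⟫ ≤ - (η * ψ * k ^ 2) * ⟪e, ξ⟫ ^ 2 := by
    intro ξ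
    have := (htest ξ ξ).2
    rw [show (1 - tm) • ξ + tm • ξ = ξ by module] at this
    simp only [hD, ContinuousLinearMap.sub_apply, ContinuousLinearMap.smul_apply, inner_sub_left,
      real_inner_smul_left]
    linarith
  have hT := trace_est n p ε (η * ψ * k ^ 2) hp hε (by positivity) D e (g z) hen hDle
  have htrD : trE n D = trE n (fderiv ℝ g z) - (1 - tm) * trE n (fderiv ℝ g x)
      - tm * trE n (fderiv ℝ g y) := by
    unfold trE
    rw [hD]
    simp only [ContinuousLinearMap.sub_apply, ContinuousLinearMap.smul_apply, PiLp.sub_apply,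
      PiLp.smul_apply, smul_eq_mul]
    rw [Finset.sum_sub_distrib, Finset.sum_sub_distrib, Finset.mul_sum, Finset.mul_sum]
  have hinD : ⟪D (g z), g z⟫ = ⟪fderiv ℝ g z (g z), g z⟫ - (1 - tm) * ⟪fderiv ℝ g x (g z), g z⟫
      - tm * ⟪fderiv ℝ g y (g z), g z⟫ := by
    simp only [hD, ContinuousLinearMap.sub_apply, ContinuousLinearMap.smul_apply, inner_sub_left,
      real_inner_smul_left]
  have hzin : ⟪z, g z⟫ = (1 - tm) * ⟪x, g z⟫ + tm * ⟪y, g z⟫ := by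
    nth_rewrite 1 [hz]
    rw [inner_add_left, real_inner_smul_left, real_inner_smul_left]
  have hcomb : (ε + ‖g z‖ ^ 2) * trE n D + (p - 2) * ⟪D (g z), g z⟫
      = PhiE n p ε lam (fderiv ℝ g z) z (g z) - (1 - tm) * PhiE n p ε lam (fderiv ℝ g x) x (g z)
        - tm * PhiE n p ε lam (fderiv ℝ g y) y (g z) := by
    rw [htrD, hinD]
    unfold PhiE
    rw [hzin]
    ring
  have hpy := hPhi y (hV' y hyO)
  rw [hgy] at hpy
  rw [hcomb, hPhi z (hV' z hzO), hpy] at hT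
  have hzK := subset_closure hzO
  have hlip := hC (fderiv ℝ g x) x (g z) (g x) ((hR1 x hx).trans (le_max_left _ _))
    ((hR3 x hx).trans ((le_max_right _ _).trans (le_max_right _ _)))
    ((hR2 z hzK).trans ((le_max_left _ _).trans (le_max_right _ _)))
    ((hR2 x hx).trans ((le_max_left _ _).trans (le_max_right _ _)))
  rw [hPhi x (hV' x hxO), sub_zero] at hlip
  have h1 := mul_le_mul_of_nonneg_left ((le_abs_self _).trans hlip) (show 0 ≤ 1 - tm by linarith)
  have h2 : (1 - tm) * (C * ‖g z - g x‖) = C * (η * ψ * k) := by rw [← hnorm]; ring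
  have h3 : 0 < η * ψ * k := by positivity
  have h4 : C * (η * ψ * k) < ε * k * (η * ψ * k) := mul_lt_mul_of_pos_right hkC h3
  nlinarith
end
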